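/- Let F be a field of characteristic p > 0 and let K^M_n(F) denote its n-th Milnor K-group. Then K^M_n(F) has no p-torsion. -/

import Mathlib

open scoped TensorProduct

/-- The subgroup of Steinberg relations in the `n`-fold tensor power of `F^×`:
generated by the pure tensors `a₁ ⊗ ⋯ ⊗ aₙ` with `aᵢ + aᵢ₊₁ = 1` for some `i`. -/
noncomputable def MilnorRelations (F : Type) [Field F] (n : ℕ) :
    AddSubgroup (⨂[ℤ] (_ : Fin n), Additive Fˣ) :=
  AddSubgroup.closure
    { z | ∃ (f : Fin n → Fˣ) (i : ℕ) (h : i + 1 < n),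
        ((f ⟨i, Nat.lt_of_succ_lt h⟩ : F) + (f ⟨i + 1, h⟩ : F) = 1) ∧
        z = PiTensorProduct.tprod ℤ fun j => Additive.ofMul (f j) }

/-- The `n`-th Milnor K-group of a field `F`. -/
def MilnorK (F : Type) [Field F] (n : ℕ) :=
  (⨂[ℤ] (_ : Fin n), Additive Fˣ) ⧸ MilnorRelations F n

noncomputable instance (F : Type) [Field F] (n : ℕ) : AddCommGroup (MilnorK F n) :=
  QuotientAddGroup.Quotient.addCommGroup (MilnorRelations F n)

namespace Izh

/-- Relations of the Milnor ring; the symbol of `0` is `0` by convention. -/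
inductive MRel (F : Type) [Field F] : FreeAlgebra ℤ F → FreeAlgebra ℤ F → Prop
  | zero : MRel F (FreeAlgebra.ι ℤ 0) 0
  | mul (x y : F) : x ≠ 0 → y ≠ 0 →
      MRel F (FreeAlgebra.ι ℤ (x * y)) (FreeAlgebra.ι ℤ x + FreeAlgebra.ι ℤ y)
  | st (x y : F) : x ≠ 0 → y ≠ 0 → x + y = 1 →
      MRel F (FreeAlgebra.ι ℤ x * FreeAlgebra.ι ℤ y) 0

/-- The Milnor K-ring. -/
def MK (F : Type) [Field F] : Type := RingQuot (MRel F)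

noncomputable instance (F : Type) [Field F] : Ring (MK F) :=
  inferInstanceAs (Ring (RingQuot (MRel F)))

section basic
variable {F : Type} [Field F]

/-- The quotient map. -/
noncomputable def mkM (F : Type) [Field F] : FreeAlgebra ℤ F →+* MK F :=
  RingQuot.mkRingHom (MRel F)

/-- The symbol of an element. -/
noncomputable def sy (x : F) : MK F := RingQuot.mkRingHom (MRel F) (FreeAlgebra.ι ℤ x)

theorem sy_zero : sy (0 : F) = 0 := by
  have := RingQuot.mkRingHom_rel (MRel.zero (F := F))
  rw [map_zero] at this; exact this

theorem sy_mul {x y : F} (hx : x ≠ 0) (hy : y ≠ 0) : sy (x * y) = sy x + sy y := by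
  have := RingQuot.mkRingHom_rel (MRel.mul x y hx hy)
  rw [map_add] at this; exact this

theorem sy_one : sy (1 : F) = 0 := by
  have := sy_mul (one_ne_zero (α := F)) one_ne_zero
  rw [mul_one] at this
  simpa using this

theorem sy_st {x y : F} (h : x + y = 1) : sy x * sy y = 0 := by
  by_cases hx : x = 0
  · rw [hx, sy_zero, zero_mul]
  by_cases hy : y = 0
  · rw [hy, sy_zero, mul_zero]
  have := RingQuot.mkRingHom_rel (MRel.st x y hx hy h)
  rw [map_mul, map_zero] at this; exact this

theorem sy_inv (x : F) : sy x⁻¹ = - sy x := by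
  by_cases hx : x = 0
  · simp [hx, sy_zero]
  have := sy_mul hx (inv_ne_zero hx)
  rw [mul_inv_cancel₀ hx, sy_one] at this
  exact (neg_eq_of_add_eq_zero_right this.symm).symm

theorem sy_div {x y : F} (hx : x ≠ 0) (hy : y ≠ 0) : sy (x / y) = sy x - sy y := by
  rw [div_eq_mul_inv, sy_mul hx (inv_ne_zero hy), sy_inv, sub_eq_add_neg]

theorem sy_pow (x : F) (n : ℕ) : sy (x ^ n) = n • sy x := by
  by_cases hx : x = 0
  · subst hx
    cases n with
    | zero => simp [sy_one]
    | succ n => simp [sy_zero]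
  induction n with
  | zero => simp [sy_one]
  | succ n ih => rw [pow_succ, sy_mul (pow_ne_zero _ hx) hx, ih, succ_nsmul]

theorem sy_zpow {x : F} (n : ℤ) : sy (x ^ n) = n • sy x := by
  cases n with
  | ofNat n => simp [sy_pow]
  | negSucc n => rw [zpow_negSucc, sy_inv, sy_pow, negSucc_zsmul]

theorem sy_neg_one_two : (2 : ℤ) • sy (-1 : F) = 0 := by
  have : sy ((-1 : F) ^ 2) = 2 • sy (-1 : F) := sy_pow _ _
  rw [neg_one_sq, sy_one] at this
  rw [two_zsmul, ← two_nsmul, ← this]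

theorem sy_neg {x : F} (hx : x ≠ 0) : sy (-x) = sy (-1) + sy x := by
  rw [← sy_mul (by simp) hx]; simp

theorem sy_mul_neg (x : F) : sy x * sy (-x) = 0 := by
  by_cases hx : x = 0
  · simp [hx, sy_zero]
  by_cases h1 : x = 1
  · simp [h1, sy_one]
  have hx' : 1 - x ≠ 0 := sub_ne_zero.2 (Ne.symm h1)
  have hi : 1 - x⁻¹ ≠ 0 := by
    rw [sub_ne_zero]; intro h; exact h1 (inv_eq_one.1 h.symm)
  have e : -x = (1 - x) / (1 - x⁻¹) := by
    rw [eq_div_iff hi]; field_simp; ring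
  rw [e, sy_div hx' hi, mul_sub, sy_st (by ring), zero_sub]
  have : sy x⁻¹ * sy (1 - x⁻¹) = 0 := sy_st (by ring)
  rw [sy_inv] at this
  simpa using this

theorem sy_mul_self (x : F) : sy x * sy x = sy x * sy (-1) := by
  by_cases hx : x = 0
  · simp [hx, sy_zero]
  have := sy_mul_neg x
  rw [sy_neg hx, mul_add] at this
  have h2 : sy x * ((2 : ℤ) • sy (-1)) = 0 := by rw [sy_neg_one_two, mul_zero]
  rw [two_zsmul, mul_add] at h2
  have : sy x * sy x = - (sy x * sy (-1)) := by
    rw [eq_neg_iff_add_eq_zero, add_comm]; exact this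
  rw [this, eq_comm, eq_neg_iff_add_eq_zero]; exact h2

theorem sy_anticomm (x y : F) : sy x * sy y = - (sy y * sy x) := by
  by_cases hx : x = 0
  · simp [hx, sy_zero]
  by_cases hy : y = 0
  · simp [hy, sy_zero]
  have h := sy_mul_neg (x * y)
  have e1 : -(x * y) = (-x) * y := by ring
  have hn : sy ((-x) * y) = sy (-x) + sy y := sy_mul (neg_ne_zero.2 hx) hy
  rw [e1, hn, sy_mul hx hy, add_mul, mul_add, mul_add, sy_mul_neg, zero_add] at h
  have h2 : sy y * sy (-x) + sy y * sy y = sy y * sy x := by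
    rw [sy_mul_self, ← mul_add, sy_neg hx, add_comm (sy (-1)), add_assoc, ← two_zsmul,
      sy_neg_one_two, add_zero]
  rw [h2] at h
  exact eq_neg_of_add_eq_zero_left h

/-- Universal property. -/
noncomputable def lift {R : Type*} [Ring R] (f : F → R) (h0 : f 0 = 0)
    (hm : ∀ x y, x ≠ 0 → y ≠ 0 → f (x * y) = f x + f y)
    (hs : ∀ x y, x ≠ 0 → y ≠ 0 → x + y = 1 → f x * f y = 0) : MK F →+* R :=
  RingQuot.lift ⟨(FreeAlgebra.lift ℤ f : FreeAlgebra ℤ F →ₐ[ℤ] R).toRingHom, by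
    intro a b h
    cases h with
    | zero => simpa using h0
    | mul x y hx hy => simpa using hm x y hx hy
    | st x y hx hy h => simpa using hs x y hx hy h⟩

@[simp] theorem lift_sy {R : Type*} [Ring R] (f : F → R) (h0 hm hs) (x : F) :
    lift f h0 hm hs (sy x) = f x := by
  unfold lift sy
  exact (RingQuot.lift_mkRingHom_apply _ _ _).trans (by simp)

theorem MK.induction {P : MK F → Prop} (h1 : P 1) (ha : ∀ a b, P a → P b → P (a + b))
    (hn : ∀ a, P a → P (-a)) (hm : ∀ x a, P a → P (sy x * a)) (z : MK F) : P z := by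
  have h0 : P 0 := by have := ha _ _ h1 (hn _ h1); simpa using this
  have key : ∀ a : FreeAlgebra ℤ F, ∀ z, P z → P (mkM F a * z) := by
    intro a
    induction a using FreeAlgebra.induction with
    | grade0 r =>
      intro z hz
      have : mkM F (algebraMap ℤ (FreeAlgebra ℤ F) r) = ((r : ℤ) : MK F) := by
        rw [eq_intCast, map_intCast]
      have e : mkM F (algebraMap ℤ (FreeAlgebra ℤ F) r) * z = r • z := by
        rw [zsmul_eq_mul, ← this]
      rw [e]
      have hnat : ∀ n : ℕ, P (n • z) := by
        intro n
        induction n with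
        | zero => simpa using h0
        | succ n ih => rw [succ_nsmul]; exact ha _ _ ih hz
      cases r with
      | ofNat n => simpa using hnat n
      | negSucc n => rw [negSucc_zsmul]; exact hn _ (hnat _)
    | grade1 x => intro z hz; exact hm x z hz
    | mul a b iha ihb => intro z hz; rw [map_mul, mul_assoc]; exact iha _ (ihb _ hz)
    | add a b iha ihb => intro z hz; rw [map_add, add_mul]; exact ha _ _ (iha _ hz) (ihb _ hz)
  obtain ⟨a, rfl⟩ : ∃ a, mkM F a = z := RingQuot.mkRingHom_surjective (MRel F) z
  have := key a 1 h1
  rwa [mul_one] at this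

theorem MK.hom_ext {R : Type*} [Ring R] {f g : MK F →+* R} (h : ∀ x : F, f (sy x) = g (sy x)) :
    f = g := by
  ext z
  induction z using MK.induction with
  | h1 => simp
  | ha a b h1 h2 => simp [h1, h2]
  | hn a h1 => simp [h1]
  | hm x a h1 => simp [h1, h]

/-- The graded pieces. -/
noncomputable def dg (F : Type) [Field F] : ℕ → AddSubgroup (MK F)
  | 0 => AddSubgroup.zmultiples 1
  | n + 1 => AddSubgroup.closure {z | ∃ (x : F) (a : MK F), a ∈ dg F n ∧ z = sy x * a}

theorem one_mem_dg : (1 : MK F) ∈ dg F 0 := AddSubgroup.mem_zmultiples _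

theorem sy_mul_mem {n : ℕ} (x : F) {a : MK F} (ha : a ∈ dg F n) : sy x * a ∈ dg F (n + 1) :=
  AddSubgroup.subset_closure ⟨x, a, ha, rfl⟩

theorem dg_induction {n : ℕ} {P : MK F → Prop} (h0 : P 0) (ha : ∀ a b, P a → P b → P (a + b))
    (hn : ∀ a, P a → P (-a)) (hm : ∀ x a, a ∈ dg F n → P (sy x * a)) {z : MK F}
    (hz : z ∈ dg F (n + 1)) : P z := by
  refine AddSubgroup.closure_induction (p := fun z _ => P z) ?_ h0 (fun a b _ _ => ha a b)
    (fun a _ => hn a) hz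
  rintro _ ⟨x, a, ha', rfl⟩
  exact hm x a ha'

/-- Degree-preserving induction. -/
theorem dg_rec {P : ℕ → MK F → Prop} (h1 : P 0 1) (h0 : ∀ n, P n 0)
    (ha : ∀ n a b, P n a → P n b → P n (a + b))
    (hn : ∀ n a, P n a → P n (-a)) (hm : ∀ n x a, a ∈ dg F n → P n a → P (n + 1) (sy x * a)) :
    ∀ {n : ℕ} {z : MK F}, z ∈ dg F n → P n z := by
  intro n
  induction n with
  | zero =>
    intro z hz
    refine AddSubgroup.closure_induction (p := fun z _ => P 0 z) ?_ (h0 0) (fun a b _ _ => ha 0 a b)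
      (fun a _ => hn 0 a) (show z ∈ AddSubgroup.closure {1} by
        rwa [← AddSubgroup.zmultiples_eq_closure])
    rintro x rfl; exact h1
  | succ n ih =>
    intro z hz
    exact dg_induction (h0 _) (ha _) (hn _) (fun x a ha => hm n x a ha (ih ha)) hz

/-- The grading homomorphism. -/
noncomputable def gr (F : Type) [Field F] : MK F →+* Polynomial (MK F) :=
  lift (fun x => Polynomial.C (sy x) * Polynomial.X) (by simp [sy_zero])
    (by intro x y hx hy; rw [sy_mul hx hy, map_add, add_mul])
    (by
      intro x y _ _ h
      rw [mul_assoc, ← mul_assoc Polynomial.X, Polynomial.X_mul_C, mul_assoc, ← mul_assoc,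
        ← map_mul, sy_st h, map_zero, zero_mul])

/-- Projection to degree n. -/
noncomputable def pr (n : ℕ) (z : MK F) : MK F := (gr F z).coeff n

theorem pr_add (n : ℕ) (a b : MK F) : pr n (a + b) = pr n a + pr n b := by simp [pr]
theorem pr_neg (n : ℕ) (a : MK F) : pr n (-a) = - pr n a := by simp [pr]
theorem gr_sy (x : F) : gr F (sy x) = Polynomial.C (sy x) * Polynomial.X := by simp [gr]
theorem pr_sy_mul_succ (n : ℕ) (x : F) (a : MK F) : pr (n+1) (sy x * a) = sy x * pr n a := by
  simp [pr, gr_sy, mul_assoc, Polynomial.coeff_C_mul, Polynomial.coeff_X_mul]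
theorem pr_sy_mul_zero (x : F) (a : MK F) : pr 0 (sy x * a) = 0 := by
  simp [pr, gr_sy, mul_assoc]
theorem pr_zero_one : pr 0 (1 : MK F) = 1 := by simp [pr]
theorem pr_succ_one (n : ℕ) : pr (n+1) (1 : MK F) = 0 := by simp [pr, Polynomial.coeff_one]

theorem pr_mem (n : ℕ) (z : MK F) : pr n z ∈ dg F n := by
  revert n
  induction z using MK.induction with
  | h1 =>
    intro n
    cases n with
    | zero => rw [pr_zero_one]; exact one_mem_dg
    | succ n => rw [pr_succ_one]; exact zero_mem _
  | ha a b h1 h2 => intro n; rw [pr_add]; exact add_mem (h1 n) (h2 n)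
  | hn a h1 => intro n; rw [pr_neg]; exact neg_mem (h1 n)
  | hm x a h1 =>
    intro n
    cases n with
    | zero => rw [pr_sy_mul_zero]; exact zero_mem _
    | succ n => rw [pr_sy_mul_succ]; exact sy_mul_mem _ (h1 n)

theorem pr_of_mem {n : ℕ} {z : MK F} (hz : z ∈ dg F n) : pr n z = z := by
  refine dg_rec (P := fun n z => pr n z = z) pr_zero_one (by simp [pr]) ?_ ?_ ?_ hz
  · intro n a b h1 h2; rw [pr_add, h1, h2]
  · intro n a h1; rw [pr_neg, h1]
  · intro n x a _ h; rw [pr_sy_mul_succ, h]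

/-- Augmentation. -/
noncomputable def aug (F : Type) [Field F] : MK F →+* ℤ :=
  lift (fun _ => 0) rfl (by simp) (by simp)

theorem dg_zero_torsion {z : MK F} (hz : z ∈ dg F 0) (n : ℤ) (hn : n ≠ 0) (h : n • z = 0) :
    z = 0 := by
  obtain ⟨k, rfl⟩ := AddSubgroup.mem_zmultiples_iff.1 hz
  have := congrArg (aug F) h
  simp at this
  rcases this with h | h
  · exact absurd h hn
  · simp [h]

/-- Functoriality for multiplicative maps of specialization type. -/
noncomputable def spc {K κ : Type} [Field K] [Field κ] (l : K →*₀ κ)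
    (h : ∀ x y, x ≠ 0 → y ≠ 0 → x + y = 1 → l x = 1 ∨ l y = 1 ∨ l x + l y = 1 ∨ l x + l y = 0) :
    MK K →+* MK κ :=
  lift (fun x => sy (l x)) (by simp [sy_zero])
    (by intro x y hx hy
        rw [map_mul, sy_mul (by simpa using hx) (by simpa using hy)])
    (by
      intro x y hx hy hxy
      rcases h x y hx hy hxy with h | h | h | h
      · rw [h, sy_one, zero_mul]
      · rw [h, sy_one, mul_zero]
      · exact sy_st h
      · rw [eq_neg_of_add_eq_zero_right h, sy_mul_neg])

@[simp] theorem spc_sy {K κ : Type} [Field K] [Field κ] (l : K →*₀ κ) (h) (x : K) :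
    spc l h (sy x) = sy (l x) := by simp [spc]

/-- Graded ring homs. -/
def Homog {K κ : Type} [Field K] [Field κ] (f : MK K →+* MK κ) : Prop :=
  ∀ x : K, ∃ y : κ, f (sy x) = sy y

theorem Homog.mem {K κ : Type} [Field K] [Field κ] {f : MK K →+* MK κ} (hf : Homog f)
    {n : ℕ} {z : MK K} (hz : z ∈ dg K n) : f z ∈ dg κ n := by
  refine dg_rec (P := fun n z => f z ∈ dg κ n) ?_ (by simp) ?_ ?_ ?_ hz
  · rw [map_one]; exact one_mem_dg
  · intro n a b h1 h2; rw [map_add]; exact add_mem h1 h2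
  · intro n a h1; rw [map_neg]; exact neg_mem h1
  · intro n x a _ h; rw [map_mul]; obtain ⟨y, hy⟩ := hf x; rw [hy]; exact sy_mul_mem _ h

theorem Homog.pr {K κ : Type} [Field K] [Field κ] {f : MK K →+* MK κ} (hf : Homog f)
    (n : ℕ) (z : MK K) : pr n (f z) = f (pr n z) := by
  revert n
  induction z using MK.induction with
  | h1 =>
    intro n
    cases n with
    | zero => simp [pr_zero_one]
    | succ n => simp [pr_succ_one]
  | ha a b h1 h2 => intro n; simp only [map_add, pr_add, h1, h2]
  | hn a h1 => intro n; simp only [map_neg, pr_neg, h1]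
  | hm x a h1 =>
    intro n
    obtain ⟨y, hy⟩ := hf x
    cases n with
    | zero => rw [map_mul, hy, pr_sy_mul_zero, pr_sy_mul_zero, map_zero]
    | succ n => rw [map_mul, hy, pr_sy_mul_succ, pr_sy_mul_succ, map_mul, hy, h1]

theorem spc_homog {K κ : Type} [Field K] [Field κ] (l : K →*₀ κ) (h) : Homog (spc l h) :=
  fun x => ⟨l x, by simp⟩

/-- Functoriality. -/
noncomputable def mp {K L : Type} [Field K] [Field L] (f : K →+* L) : MK K →+* MK L :=
  spc f.toMonoidWithZeroHom (by
    intro x y _ _ h; right; right; left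
    have := congrArg f h
    simpa using this)

@[simp] theorem mp_sy {K L : Type} [Field K] [Field L] (f : K →+* L) (x : K) :
    mp f (sy x) = sy (f x) := by simp [mp]

theorem mp_homog {K L : Type} [Field K] [Field L] (f : K →+* L) : Homog (mp f) :=
  fun x => ⟨f x, by simp⟩

theorem mp_mp {K L N : Type} [Field K] [Field L] [Field N] (f : K →+* L) (g : L →+* N) (z : MK K) :
    mp g (mp f z) = mp (g.comp f) z := by
  rw [← RingHom.comp_apply]
  congr 1
  apply MK.hom_ext; simp

theorem mp_congr {K L : Type} [Field K] [Field L] {f g : K →+* L} (h : ∀ x, f x = g x) (z : MK K) :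
    mp f z = mp g z := by
  rw [RingHom.ext h]

theorem mp_id {K : Type} [Field K] (z : MK K) : mp (RingHom.id K) z = z := by
  have : mp (RingHom.id K) = RingHom.id _ := MK.hom_ext (by simp)
  rw [this]; rfl

end basic
end Izh

namespace Izh

section link
variable {F : Type} [Field F]

theorem ofFn_prod_zero {R : Type*} [Ring R] : ∀ {n : ℕ} (g : Fin n → R) (i : ℕ) (h : i + 1 < n),
    g ⟨i, Nat.lt_of_succ_lt h⟩ * g ⟨i + 1, h⟩ = 0 → (List.ofFn g).prod = 0
  | 0, _, _, h, _ => absurd h (by omega)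
  | 1, _, _, h, _ => absurd h (by omega)
  | n + 2, g, 0, h, hg => by
    rw [List.ofFn_succ, List.ofFn_succ, List.prod_cons, List.prod_cons, ← mul_assoc]
    have : g 0 * g (Fin.succ 0) = 0 := hg
    rw [this, zero_mul]
  | n + 2, g, i + 1, h, hg => by
    rw [List.ofFn_succ, List.prod_cons, ofFn_prod_zero (fun j => g j.succ) i (by omega) hg, mul_zero]

/-- symbol as a linear map -/
noncomputable def syL (F : Type) [Field F] : Additive Fˣ →ₗ[ℤ] MK F :=
  AddMonoidHom.toIntLinearMap
    { toFun := fun x => sy (x.toMul : F)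
      map_zero' := by simp [sy_one]
      map_add' := by intro x y; simp [sy_mul] }

/-- The link to the Milnor ring, on tensors. -/
noncomputable def link0 (F : Type) [Field F] (n : ℕ) : (⨂[ℤ] (_ : Fin n), Additive Fˣ) →ₗ[ℤ] MK F :=
  PiTensorProduct.lift ((MultilinearMap.mkPiAlgebraFin ℤ n (MK F)).compLinearMap fun _ => syL F)

theorem link0_tprod {n : ℕ} (f : Fin n → Fˣ) :
    link0 F n (PiTensorProduct.tprod ℤ fun j => Additive.ofMul (f j)) =
      (List.ofFn fun j => sy (f j : F)).prod := by
  simp [link0, syL]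

/-- The link to the Milnor ring. -/
noncomputable def link (F : Type) [Field F] (n : ℕ) : MilnorK F n →+ MK F :=
  QuotientAddGroup.lift (MilnorRelations F n) (link0 F n).toAddMonoidHom (by
    rw [MilnorRelations, AddSubgroup.closure_le]
    rintro _ ⟨f, i, h, hs, rfl⟩
    exact (link0_tprod f).trans (ofFn_prod_zero _ i h (sy_st hs)))

theorem list_mem_dg : ∀ {n : ℕ} (f : Fin n → F), (List.ofFn fun j => sy (f j : F)).prod ∈ dg F n
  | 0, f => by simpa using one_mem_dg
  | n + 1, f => by
    rw [List.ofFn_succ, List.prod_cons]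
    exact sy_mul_mem _ (list_mem_dg fun j => f j.succ)

/-- quotient map -/
noncomputable def mkq (F : Type) [Field F] (n : ℕ) :
    (⨂[ℤ] (_ : Fin n), Additive Fˣ) →+ MilnorK F n :=
  QuotientAddGroup.mk' (MilnorRelations F n)

/-- class of a pure tensor -/
noncomputable def cls {n : ℕ} (f : Fin n → Additive Fˣ) : MilnorK F n :=
  mkq F n (PiTensorProduct.tprod ℤ f)

theorem MilnorK_ind {n : ℕ} {P : MilnorK F n → Prop} (h0 : P 0) (ha : ∀ a b, P a → P b → P (a + b))
    (hc : ∀ f : Fin n → Additive Fˣ, P (cls f)) (hn : ∀ a, P a → P (-a)) (t : MilnorK F n) : P t := by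
  obtain ⟨t, rfl⟩ : ∃ t', mkq F n t' = t := QuotientAddGroup.mk'_surjective (MilnorRelations F n) t
  induction t using PiTensorProduct.induction_on with
  | smul_tprod r f =>
    rw [map_zsmul]
    change P (r • cls f)
    have hnat : ∀ k : ℕ, P (k • cls f) := by
      intro k
      induction k with
      | zero => simpa using h0
      | succ k ih => rw [succ_nsmul]; exact ha _ _ ih (hc f)
    cases r with
    | ofNat k => simpa using hnat k
    | negSucc k => rw [negSucc_zsmul]; exact hn _ (hnat _)
  | add a b iha ihb => rw [map_add]; exact ha _ _ iha ihb

theorem link_cls {n : ℕ} (f : Fin n → Additive Fˣ) :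
    link F n (cls f) = (List.ofFn fun j => sy ((f j).toMul : F)).prod := link0_tprod _

theorem link_mem {n : ℕ} (t : MilnorK F n) : link F n t ∈ dg F n := by
  induction t using MilnorK_ind with
  | h0 => simp
  | ha a b h1 h2 => rw [map_add]; exact add_mem h1 h2
  | hn a h => rw [map_neg]; exact neg_mem h
  | hc f => rw [link_cls]; exact list_mem_dg _

/-- prepending -/
noncomputable def prep (n : ℕ) (x : Additive Fˣ) : MilnorK F n →+ MilnorK F (n + 1) :=
  QuotientAddGroup.map (MilnorRelations F n) (MilnorRelations F (n + 1))
    (PiTensorProduct.lift ((PiTensorProduct.tprod ℤ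
      (s := fun _ : Fin (n + 1) => Additive Fˣ)).curryLeft x)).toAddMonoidHom (by
    conv_lhs => rw [MilnorRelations]
    rw [AddSubgroup.closure_le]
    rintro _ ⟨f, i, h, hs, rfl⟩
    refine AddSubgroup.subset_closure ⟨Fin.cons x.toMul f, i + 1, by omega, hs, ?_⟩
    simp only [LinearMap.toAddMonoidHom_coe, PiTensorProduct.lift.tprod]
    rw [MultilinearMap.curryLeft_apply]
    congr 1)

theorem prep_cls {n : ℕ} (x : Additive Fˣ) (f : Fin n → Additive Fˣ) :
    prep n x (cls f) = cls (Fin.cons x f : Fin (n + 1) → Additive Fˣ) := by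
  have : prep n x (cls f) = mkq F (n + 1) (PiTensorProduct.lift ((PiTensorProduct.tprod ℤ
      (s := fun _ : Fin (n + 1) => Additive Fˣ)).curryLeft x) (PiTensorProduct.tprod ℤ f)) := rfl
  rw [this, PiTensorProduct.lift.tprod, MultilinearMap.curryLeft_apply]; rfl

theorem prep_add {n : ℕ} (x y : Additive Fˣ) (t : MilnorK F n) :
    prep n (x + y) t = prep n x t + prep n y t := by
  induction t using MilnorK_ind with
  | h0 => simp
  | ha a b h1 h2 => simp only [map_add, h1, h2]; abel
  | hn a h => simp only [map_neg, h]; abel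
  | hc f =>
    rw [prep_cls, prep_cls, prep_cls, cls, cls, cls, ← map_add]
    congr 1
    have := (PiTensorProduct.tprod ℤ (s := fun _ : Fin (n + 1) => Additive Fˣ)).cons_add f x y
    exact this

theorem prep_st {n : ℕ} (x y : Fˣ) (h : (x : F) + y = 1) (t : MilnorK F n) :
    prep (n + 1) (Additive.ofMul x) (prep n (Additive.ofMul y) t) = 0 := by
  induction t using MilnorK_ind with
  | h0 => simp
  | ha a b h1 h2 => simp only [map_add, h1, h2]; abel
  | hn a h => simp only [map_neg, h]; abel
  | hc f =>
    rw [prep_cls, prep_cls]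
    refine (QuotientAddGroup.eq_zero_iff _).2 (AddSubgroup.subset_closure
      ⟨Fin.cons x (Fin.cons y fun j => (f j).toMul : Fin (n + 1) → Fˣ), 0, Nat.succ_lt_succ (Nat.succ_pos n), h, ?_⟩)
    congr 1

/-- The module on which the Milnor ring acts. -/
abbrev NN (F : Type) [Field F] : Type := ∀ n : ℕ, MilnorK F n

/-- action of a unit -/
noncomputable def actU (x : Fˣ) : AddMonoid.End (NN F) where
  toFun f n := match n with
    | 0 => 0
    | n + 1 => prep n (Additive.ofMul x) (f n)
  map_zero' := by
    funext n; cases n <;> simp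
  map_add' f g := by
    funext n; cases n <;> simp

open Classical in
/-- action of the Milnor ring -/
noncomputable def act (F : Type) [Field F] : MK F →+* AddMonoid.End (NN F) :=
  lift (fun x => if h : x = 0 then 0 else actU (Units.mk0 x h)) (by simp)
    (by
      intro x y hx hy
      simp only [hx, hy, mul_eq_zero, or_self, dite_false]
      ext f n
      cases n with
      | zero => change (0 : MilnorK F 0) = 0 + 0; simp
      | succ n =>
        change prep n (Additive.ofMul (Units.mk0 (x * y) _)) (f n) =
          prep n (Additive.ofMul (Units.mk0 x _)) (f n) + prep n (Additive.ofMul (Units.mk0 y _)) (f n)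
        rw [← prep_add, ← ofMul_mul]; congr 3; exact Units.mk0_mul x y _)
    (by
      intro x y hx hy h
      simp only [hx, hy, dite_false]
      ext f n
      match n with
      | 0 => rfl
      | 1 => exact map_zero (prep 0 _)
      | n + 2 => exact prep_st _ _ h _)

theorem act_sy (x : Fˣ) : act F (sy (x : F)) = actU x := by
  simp [act]

/-- base vector -/
noncomputable def base (F : Type) [Field F] : NN F := Pi.single 0 (cls Fin.elim0)

theorem act_list : ∀ {n : ℕ} (f : Fin n → Additive Fˣ),
    act F (List.ofFn fun j => sy ((f j).toMul : F)).prod (base F) n = cls f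
  | 0, f => by
    simp only [List.ofFn_zero, List.prod_nil, map_one]
    change base F 0 = _
    simp only [base, Pi.single_eq_same]
    congr 1; funext i; exact i.elim0
  | n + 1, f => by
    rw [List.ofFn_succ, List.prod_cons, map_mul, act_sy]
    change prep n (Additive.ofMul (f 0).toMul) (act F _ (base F) n) = _
    rw [act_list fun j => f j.succ, prep_cls]
    congr 1
    exact Fin.cons_self_tail f

theorem act_link {n : ℕ} (t : MilnorK F n) : act F (link F n t) (base F) n = t := by
  induction t using MilnorK_ind with
  | h0 => rw [map_zero, map_zero]; rfl
  | ha a b h1 h2 => rw [map_add, map_add]; exact congrArg₂ (· + ·) h1 h2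
  | hn a h => rw [map_neg, map_neg]; exact congrArg Neg.neg h
  | hc f => rw [link_cls, act_list]

theorem link_inj {n : ℕ} (t : MilnorK F n) (h : link F n t = 0) : t = 0 := by
  rw [← act_link t, h, map_zero]; rfl

end link

section colim
variable (F : Type) [Field F]

/-- f.g. subfields -/
abbrev fgs (S : Finset F) : Subfield F := Subfield.closure (S : Set F)

/-- eventually zero sequences -/
def evz : Ideal (∀ S : Finset F, MK (fgs F S)) where
  carrier := {f | ∀ᶠ S in Filter.atTop, f S = 0}
  zero_mem' := by simp
  add_mem' := by
    intro a b ha hb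
    filter_upwards [ha, hb] with S h1 h2
    simp [h1, h2]
  smul_mem' := by
    intro c a ha
    filter_upwards [ha] with S h1
    simp [h1]

instance : (evz F).IsTwoSided := ⟨by
  intro a b ha
  filter_upwards [ha] with S h1
  simp [h1]⟩

variable {F}

theorem ev_mem (x : F) : ∀ᶠ S : Finset F in Filter.atTop, x ∈ fgs F S := by
  filter_upwards [Filter.eventually_ge_atTop {x}] with S hS
  exact Subfield.subset_closure (by simpa using hS)

open Classical in
/-- symbols in f.g. subfields -/
noncomputable def seqs (x : F) : ∀ S : Finset F, MK (fgs F S) :=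
  fun S => if h : x ∈ fgs F S then sy ⟨x, h⟩ else 0

/-- the map to the colimit -/
noncomputable def toCol (F : Type) [Field F] : MK F →+* ((∀ S : Finset F, MK (fgs F S)) ⧸ evz F) :=
  lift (fun x => Ideal.Quotient.mk _ (seqs x))
    (by
      rw [Ideal.Quotient.eq_zero_iff_mem]
      filter_upwards with S
      simp only [seqs, zero_mem, dite_true]
      exact sy_zero)
    (by
      intro x y hx hy
      rw [← map_add, Ideal.Quotient.eq]
      filter_upwards [ev_mem x, ev_mem y] with S h1 h2
      simp only [Pi.sub_apply, Pi.add_apply, seqs, h1, h2, mul_mem h1 h2, dite_true]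
      rw [← sy_mul, sub_eq_zero]
      · rfl
      · simpa [Subtype.ext_iff] using hx
      · simpa [Subtype.ext_iff] using hy)
    (by
      intro x y hx hy h
      rw [← map_mul, Ideal.Quotient.eq_zero_iff_mem]
      filter_upwards [ev_mem x, ev_mem y] with S h1 h2
      simp only [Pi.mul_apply, seqs, h1, h2, dite_true]
      exact sy_st (Subtype.ext h))

open Classical in
theorem toCol_mp (S0 : Finset F) (z : MK (fgs F S0)) :
    toCol F (mp (fgs F S0).subtype z) = Ideal.Quotient.mk _ (fun S =>
      if h : S0 ≤ S then mp (Subfield.inclusion (Subfield.closure_mono (by simpa using h))) z else 0) := by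
  induction z using MK.induction with
  | h1 =>
    rw [map_one, map_one, eq_comm, ← map_one (Ideal.Quotient.mk _), Ideal.Quotient.eq]
    filter_upwards [Filter.eventually_ge_atTop S0] with S hS
    simp [hS]
  | ha a b h1 h2 =>
    rw [map_add, map_add, h1, h2, ← map_add]
    congr 1
    funext S
    by_cases h : S0 ≤ S <;> simp [h]
  | hn a h =>
    rw [map_neg, map_neg, h, ← map_neg]
    congr 1
    funext S
    by_cases h : S0 ≤ S <;> simp [h]
  | hm x a h =>
    rw [map_mul, map_mul, h, mp_sy, toCol, lift_sy, ← map_mul, Ideal.Quotient.eq]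
    filter_upwards [Filter.eventually_ge_atTop S0] with S hS
    have hx : (x : F) ∈ fgs F S := Subfield.closure_mono (by simpa using hS) x.2
    simp only [Pi.sub_apply, Pi.mul_apply, hS, dite_true, map_mul, mp_sy, seqs, Subfield.coe_subtype,
      hx]
    exact sub_self _

theorem mp_incl {k l : Subfield F} (h : k ≤ l) (z : MK k) :
    mp l.subtype (mp (Subfield.inclusion h) z) = mp k.subtype z := by
  rw [mp_mp]
  exact mp_congr (fun _ => rfl) _

theorem incl_mem {k l : Subfield F} (h : k ≤ l) {n : ℕ} {z : MK k} (hz : z ∈ dg k n) :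
    mp (Subfield.inclusion h) z ∈ dg l n := (mp_homog _).mem hz

theorem fg_mono {n : ℕ} {z : MK F} {S : Finset F} (S' : Finset F) (h : S ≤ S')
    (hz : ∃ z' ∈ dg (fgs F S) n, mp (fgs F S).subtype z' = z) :
    ∃ z' ∈ dg (fgs F S') n, mp (fgs F S').subtype z' = z := by
  obtain ⟨z', hz', rfl⟩ := hz
  have h' : fgs F S ≤ fgs F S' := Subfield.closure_mono (by simpa using h)
  exact ⟨_, incl_mem h' hz', mp_incl h' z'⟩

theorem fg_sy {n : ℕ} {z : MK F} {S : Finset F} (x : F) (hx : x ∈ S)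
    (hz : ∃ z' ∈ dg (fgs F S) n, mp (fgs F S).subtype z' = z) :
    ∃ z' ∈ dg (fgs F S) (n + 1), mp (fgs F S).subtype z' = sy x * z := by
  obtain ⟨z', hz', rfl⟩ := hz
  refine ⟨sy ⟨x, Subfield.subset_closure (by simpa using hx)⟩ * z', sy_mul_mem _ hz', ?_⟩
  rw [map_mul, mp_sy, Subfield.coe_subtype]

theorem fg_add {n : ℕ} {a b : MK F} {S : Finset F}
    (ha : ∃ z' ∈ dg (fgs F S) n, mp (fgs F S).subtype z' = a)
    (hb : ∃ z' ∈ dg (fgs F S) n, mp (fgs F S).subtype z' = b) :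
    ∃ z' ∈ dg (fgs F S) n, mp (fgs F S).subtype z' = a + b := by
  obtain ⟨a', ha', rfl⟩ := ha
  obtain ⟨b', hb', rfl⟩ := hb
  exact ⟨a' + b', add_mem ha' hb', map_add _ _ _⟩

theorem exists_fg {n : ℕ} {z : MK F} (hz : z ∈ dg F n) :
    ∃ S : Finset F, ∃ z' ∈ dg (fgs F S) n, mp (fgs F S).subtype z' = z := by
  classical
  refine dg_rec (P := fun n z => ∃ S : Finset F, ∃ z' ∈ dg (fgs F S) n,
    mp (fgs F S).subtype z' = z) ?_ ?_ ?_ ?_ ?_ hz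
  · exact ⟨∅, 1, one_mem_dg, map_one _⟩
  · exact fun n => ⟨∅, 0, zero_mem _, map_zero _⟩
  · rintro n a b ⟨S, ha⟩ ⟨T, hb⟩
    exact ⟨S ∪ T, fg_add (fg_mono (S ∪ T) Finset.subset_union_left ha)
      (fg_mono (S ∪ T) Finset.subset_union_right hb)⟩
  · rintro n a ⟨S, a', ha', rfl⟩
    exact ⟨S, -a', neg_mem ha', map_neg _ _⟩
  · rintro n x a - ⟨S, ha⟩
    exact ⟨S ∪ {x}, fg_sy x (by simp) (fg_mono (S ∪ {x}) Finset.subset_union_left ha)⟩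

theorem torsion_colim (p : ℕ)
    (hA : ∀ S : Finset F, ∀ n (z : MK (fgs F S)), z ∈ dg (fgs F S) n → p • z = 0 → z = 0)
    {n : ℕ} {z : MK F} (hz : z ∈ dg F n) (hp : p • z = 0) : z = 0 := by
  obtain ⟨S, z', hz', rfl⟩ := exists_fg hz
  have h := toCol_mp S (p • z')
  rw [map_nsmul, hp, map_zero, eq_comm, Ideal.Quotient.eq_zero_iff_mem] at h
  obtain ⟨S', h1, hS'⟩ := (h.and (Filter.eventually_ge_atTop S)).exists
  simp only [hS', dite_true, map_nsmul] at h1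
  have h2 := hA S' n _ (incl_mem _ hz') h1
  have h3 := congrArg (mp (fgs F S').subtype) h2
  rwa [mp_incl, map_zero] at h3

end colim
end Izh

namespace Izh

theorem even_smul_eps {κ : Type} [Field κ] {n : ℤ} (h : Even n) : n • sy (-1 : κ) = 0 := by
  obtain ⟨k, rfl⟩ := h
  rw [← mul_two, mul_smul, sy_neg_one_two, smul_zero]

/-- Discrete valuation data with a leading-coefficient map. -/
structure DVD (K κ : Type) [Field K] [Field κ] where
  v : K → ℤ
  l : K →*₀ κ
  v_mul : ∀ x y, x ≠ 0 → y ≠ 0 → v (x * y) = v x + v y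
  st : ∀ x y, x ≠ 0 → y ≠ 0 → x + y = 1 → (v y = 0 ∧ l y = 1) ∨ (v x = 0 ∧ l x = 1) ∨
    (v x = v y ∧ l x + l y = 0) ∨ (v x = 0 ∧ v y = 0 ∧ l x + l y = 1)

namespace DVD
variable {K κ : Type} [Field K] [Field κ] (d : DVD K κ)

open Classical in
/-- The residue homomorphism in matrix form. -/
noncomputable def rho : MK K →+* Matrix (Fin 2) (Fin 2) (MK κ) :=
  lift (fun x => if x = 0 then 0 else !![sy (d.l x), 0; d.v x • 1, - sy (d.l x) + d.v x • sy (-1)])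
    (by simp)
    (by
      intro x y hx hy
      simp only [hx, hy, mul_eq_zero, or_self, if_false]
      rw [d.v_mul x y hx hy, map_mul, sy_mul (by simpa using hx) (by simpa using hy)]
      ext i j
      fin_cases i <;> fin_cases j <;> simp [add_smul, add_mul] <;> abel)
    (by
      intro x y hx hy h
      simp only [hx, hy, if_false]
      rcases d.st x y hx hy h with ⟨h1, h2⟩ | ⟨h1, h2⟩ | ⟨h1, h2⟩ | ⟨h1, h2, h3⟩
      · rw [h1, h2, sy_one]
        ext i j
        fin_cases i <;> fin_cases j <;> simp [Matrix.mul_apply]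
      · rw [h1, h2, sy_one]
        ext i j
        fin_cases i <;> fin_cases j <;> simp [Matrix.mul_apply]
      · have e : d.l y = - d.l x := eq_neg_of_add_eq_zero_right h2
        have hl : d.l x ≠ 0 := by simpa using hx
        have e0 : sy (d.l x) * sy (-(d.l x)) = 0 := sy_mul_neg _
        have ev : ∀ n : ℤ, n • (n • sy (-1 : κ)) + n • sy (-1 : κ) = 0 := by
          intro n
          rw [smul_smul, ← add_smul]
          apply even_smul_eps
          have := Int.even_mul_succ_self n
          rwa [mul_add, mul_one] at this
        rw [← h1, e]
        generalize d.v x = n at *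
        ext i j
        fin_cases i <;> fin_cases j
        · simpa [Matrix.mul_apply] using e0
        · simp [Matrix.mul_apply]
        · simp only [Matrix.mul_apply, Fin.sum_univ_two]
          simp only [Matrix.of_apply, Matrix.cons_val', Matrix.cons_val_zero, Matrix.cons_val_one,
            Matrix.cons_val_fin_one, Fin.mk_one, Fin.zero_eta, Matrix.zero_apply]
          rw [smul_mul_assoc, one_mul, mul_smul_comm, mul_one, sy_neg hl, smul_add, smul_add, ← ev n]
          rw [smul_neg]; abel
        · simp only [Matrix.mul_apply, Fin.sum_univ_two]
          simp [- zsmul_eq_mul]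
          rw [mul_add, add_mul, add_mul]
          simp only [mul_neg, neg_mul, neg_neg, mul_smul_comm, smul_mul_assoc]
          rw [e0, sy_neg hl, mul_add]
          have e1 : sy (-1 : κ) * sy (d.l x) = - (sy (d.l x) * sy (-1)) := sy_anticomm _ _
          have e2 : n • (n • (sy (-1 : κ) * sy (-1))) = - (n • (sy (-1 : κ) * sy (-1))) := by
            have := congrArg (fun t => t * sy (-1 : κ)) (ev n)
            simp only [add_mul, smul_mul_assoc, zero_mul] at this
            exact eq_neg_of_add_eq_zero_left this
          have e3 : n • (sy (-1 : κ) * sy (-1)) + n • (sy (-1 : κ) * sy (-1)) = 0 := by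
            rw [← smul_add, ← two_zsmul, ← smul_mul_assoc, sy_neg_one_two, zero_mul, smul_zero]
          rw [e1, e2]
          simp only [smul_add, smul_neg]
          rw [eq_neg_of_add_eq_zero_left e3]
          have e5 := neg_eq_of_add_eq_zero_left e3
          generalize n • (sy (d.l x) * sy (-1 : κ)) = A at *
          generalize n • (sy (-1 : κ) * sy (-1)) = B at *
          abel_nf
          try rw [two_smul]; exact e3
      · rw [h1, h2]
        have := sy_st h3
        ext i j
        fin_cases i <;> fin_cases j <;> simp [Matrix.mul_apply, this])

theorem rho_sy {x : K} (hx : x ≠ 0) : d.rho (sy x) =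
    !![sy (d.l x), 0; d.v x • 1, - sy (d.l x) + d.v x • sy (-1)] := by
  rw [rho, lift_sy, if_neg hx]

/-- The specialization. -/
noncomputable def s : MK K →+* MK κ := spc d.l (by
  intro x y hx hy h
  rcases d.st x y hx hy h with ⟨h1, h2⟩ | ⟨h1, h2⟩ | ⟨h1, h2⟩ | ⟨h1, h2, h3⟩ <;> tauto)

@[simp] theorem s_sy (x : K) : d.s (sy x) = sy (d.l x) := by simp [s]

/-- The residue. -/
noncomputable def r : MK K →+ MK κ where
  toFun z := d.rho z 1 0
  map_zero' := by simp
  map_add' := by simp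

theorem rho00 (z : MK K) : d.rho z 0 0 = d.s z ∧ d.rho z 0 1 = 0 := by
  induction z using MK.induction with
  | h1 => simp
  | ha a b h1 h2 => simp [h1, h2]
  | hn a h => simp [h]
  | hm x a h =>
    by_cases hx : x = 0
    · simp [hx, sy_zero]
    · rw [map_mul, map_mul, Matrix.mul_apply, Matrix.mul_apply]
      simp [Fin.sum_univ_two, h, d.rho_sy hx]

@[simp] theorem r_one : d.r 1 = 0 := by simp [r]

theorem r_sy_mul {x : K} (hx : x ≠ 0) (z : MK K) : d.r (sy x * z) =
    d.v x • d.s z + (- sy (d.l x) + d.v x • sy (-1)) * d.r z := by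
  change d.rho (sy x * z) 1 0 = _ + _ * d.rho z 1 0
  rw [map_mul, Matrix.mul_apply, Fin.sum_univ_two, (d.rho00 z).1]
  simp [d.rho_sy hx]

theorem r_sy {x : K} (hx : x ≠ 0) : d.r (sy x) = d.v x • 1 := by
  have := d.r_sy_mul hx 1
  simpa using this

theorem s_homog : Homog d.s := spc_homog _ _

theorem r_mem0 {z : MK K} (hz : z ∈ dg K 0) : d.r z = 0 := by
  obtain ⟨k, rfl⟩ := AddSubgroup.mem_zmultiples_iff.1 hz
  rw [map_zsmul, r_one, smul_zero]

theorem r_mem {n : ℕ} {z : MK K} (hz : z ∈ dg K (n + 1)) : d.r z ∈ dg κ n := by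
  have key : ∀ {m : ℕ} {z : MK K}, z ∈ dg K m → ∀ n, m = n + 1 → d.r z ∈ dg κ n := by
    intro m z hz
    refine dg_rec (P := fun m z => ∀ n, m = n + 1 → d.r z ∈ dg κ n) ?_ ?_ ?_ ?_ ?_ hz
    · intro n h; omega
    · simp
    · intro m a b h1 h2 n hn; rw [map_add]; exact add_mem (h1 n hn) (h2 n hn)
    · intro m a h1 n hn; rw [map_neg]; exact neg_mem (h1 n hn)
    · intro m x a ha h n hn
      obtain rfl : m = n := by omega
      by_cases hx : x = 0
      · simp [hx, sy_zero]
      rw [d.r_sy_mul hx]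
      refine add_mem (AddSubgroup.zsmul_mem _ (d.s_homog.mem ha) _) ?_
      cases m with
      | zero => rw [d.r_mem0 ha, mul_zero]; exact zero_mem _
      | succ m =>
        have := h m rfl
        rw [add_mul, neg_mul, smul_mul_assoc]
        exact add_mem (neg_mem (sy_mul_mem _ this)) (AddSubgroup.zsmul_mem _ (sy_mul_mem _ this) _)
  exact key hz n rfl

/-- Constants. -/
theorem const {k : Type} [Field k] (φ : k →+* K) (ψ : k →+* κ) (h1 : ∀ x, x ≠ 0 → d.v (φ x) = 0)
    (h2 : ∀ x, d.l (φ x) = ψ x) (z : MK k) : d.s (mp φ z) = mp ψ z ∧ d.r (mp φ z) = 0 := by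
  induction z using MK.induction with
  | h1 => simp
  | ha a b h1 h2 => simp [h1, h2]
  | hn a h => simp [h]
  | hm x a h =>
    by_cases hx : x = 0
    · simp [hx, sy_zero]
    · rw [map_mul, map_mul, map_mul, mp_sy, mp_sy, d.r_sy_mul (by simpa using hx), h.1, h.2, h1 x hx]
      simp [h2]

/-- Naturality. -/
theorem natural {K' κ' : Type} [Field K'] [Field κ'] (d' : DVD K' κ') (φ : K →+* K') (ψ : κ →+* κ')
    (e : ℤ) (h : κ') (hv : ∀ x, x ≠ 0 → d'.v (φ x) = e * d.v x)
    (hh : h ≠ 0)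
    (hl : ∀ x, x ≠ 0 → d'.l (φ x) = ψ (d.l x) * h ^ (d.v x)) (z : MK K) :
    d'.s (mp φ z) = mp ψ (d.s z) + sy h * mp ψ (d.r z) ∧ d'.r (mp φ z) = e • mp ψ (d.r z) := by
  induction z using MK.induction with
  | h1 => simp
  | ha a b h1 h2 =>
    simp only [map_add, h1.1, h1.2, h2.1, h2.2, mul_add, smul_add, and_true]; abel
  | hn a h => simp [h]; abel
  | hm x a ih =>
    by_cases hx : x = 0
    · simp [hx, sy_zero]
    have hx' : φ x ≠ 0 := by simpa using hx
    have hlx : ψ (d.l x) ≠ 0 := by simpa using hx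
    have e1 : sy h * sy (ψ (d.l x)) = - (sy (ψ (d.l x)) * sy h) := sy_anticomm _ _
    have e2 : sy h * sy h = sy h * sy (-1) := sy_mul_self _
    rw [map_mul, map_mul, mp_sy, d'.r_sy_mul hx', d'.s_sy, hv x hx, hl x hx,
      sy_mul hlx (zpow_ne_zero _ hh), sy_zpow, ih.1, ih.2, map_mul, d.s_sy, map_mul, mp_sy,
      d.r_sy_mul hx, map_add, map_zsmul, map_mul, map_add, map_neg, map_zsmul, mp_sy, mp_sy,
      map_neg, map_one]
    set l := sy (ψ (d.l x))
    set S := mp ψ (d.s a)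
    set R := mp ψ (d.r a)
    set n := d.v x
    constructor
    · simp only [add_mul, mul_add, smul_mul_assoc, neg_mul, mul_neg, mul_smul_comm]
      rw [← mul_assoc (sy h) l, ← mul_assoc (sy h) (sy (-1)), ← mul_assoc (sy h) (sy h), e1, e2]
      simp only [neg_mul, mul_assoc]
      abel
    · simp only [add_mul, mul_add, smul_mul_assoc, neg_mul, mul_neg, mul_smul_comm, smul_add,
        smul_smul, smul_neg, neg_add]
      have ev : ((e * n) * e) • sy (-1 : κ') = (e * n) • sy (-1 : κ') := by
        rw [← sub_eq_zero, ← sub_smul]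
        apply even_smul_eps
        have := Int.even_mul_pred_self e
        have h3 : e * n * e - e * n = e * (e - 1) * n := by ring
        rw [h3]; exact this.mul_right n
      have ev2 : ((e * n) * e) • (sy (-1 : κ') * R) = (e * n) • (sy (-1 : κ') * R) := by
        rw [← smul_mul_assoc, ev, smul_mul_assoc]
      rw [mul_comm (e * n) e] at ev2
      have h4 : e * n * e = e * (e * n) := by ring
      simp only [h4, ev2, mul_comm n e]
      abel

end DVD
end Izh

namespace Izh
open Polynomial

variable {F : Type} [Field F]

/-- The embedding of polynomials in rational functions. -/
noncomputable abbrev cc (f : F[X]) : RatFunc F := algebraMap F[X] (RatFunc F) f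

theorem cc_ne {f : F[X]} (h : f ≠ 0) : cc f ≠ 0 := by
  simpa using h

theorem cc_rep (x : RatFunc F) : ∃ a b : F[X], b ≠ 0 ∧ x = cc a / cc b :=
  ⟨x.num, x.denom, x.denom_ne_zero, x.num_div_denom.symm⟩

theorem cc_rep2 (x y : RatFunc F) : ∃ a b c : F[X], c ≠ 0 ∧ x = cc a / cc c ∧ y = cc b / cc c := by
  obtain ⟨a, c, hc, rfl⟩ := cc_rep x
  obtain ⟨b, d, hd, rfl⟩ := cc_rep y
  have hc' := cc_ne hc
  have hd' := cc_ne hd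
  refine ⟨a * d, b * c, c * d, mul_ne_zero hc hd, ?_, ?_⟩
  · simp only [cc, map_mul] at *; field_simp
  · simp only [cc, map_mul] at *; field_simp

/-- Valuation data on polynomials. -/
structure PVD (F κ : Type) [Field F] [Field κ] where
  v : F[X] → ℤ
  l : F[X] →*₀ κ
  ne : ∀ a, a ≠ 0 → l a ≠ 0
  v_mul : ∀ x y, x ≠ 0 → y ≠ 0 → v (x * y) = v x + v y
  st : ∀ a b c, a ≠ 0 → b ≠ 0 → c ≠ 0 → a + b = c → (v b = v c ∧ l b = l c) ∨
    (v a = v c ∧ l a = l c) ∨ (v a = v b ∧ l a + l b = 0) ∨ (v a = v c ∧ v b = v c ∧ l a + l b = l c)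

namespace PVD
variable {κ : Type} [Field κ] (P : PVD F κ)

/-- value -/
noncomputable def vK (x : RatFunc F) : ℤ := P.v x.num - P.v x.denom

theorem vK_div {a b : F[X]} (ha : a ≠ 0) (hb : b ≠ 0) : P.vK (cc a / cc b) = P.v a - P.v b := by
  set x := cc a / cc b with hx
  have hx0 : x ≠ 0 := div_ne_zero (cc_ne ha) (cc_ne hb)
  have h1 : a * x.denom = x.num * b := by
    have h2 := x.num_div_denom
    have hd := cc_ne x.denom_ne_zero
    have hb' := cc_ne hb
    apply RatFunc.algebraMap_injective F
    have h3 : cc a = x * cc b := by rw [hx]; field_simp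
    have h4 : cc x.num = x * cc x.denom := by
      rw [← div_eq_iff hd]; exact h2
    simp only [cc, map_mul] at *
    rw [h3, h4]; ring
  have hn : x.num ≠ 0 := RatFunc.num_ne_zero hx0
  have h2 := congrArg P.v h1
  rw [P.v_mul _ _ ha x.denom_ne_zero, P.v_mul _ _ hn hb] at h2
  rw [vK]; omega

theorem hne : nonZeroDivisors F[X] ≤ (nonZeroDivisors κ).comap P.l := by
  intro a ha
  rw [Submonoid.mem_comap]
  exact mem_nonZeroDivisors_of_ne_zero (P.ne a (nonZeroDivisors.ne_zero ha))

/-- The DVD on rational functions. -/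
noncomputable def toDVD : DVD (RatFunc F) κ where
  v := P.vK
  l := RatFunc.liftMonoidWithZeroHom P.l P.hne
  v_mul := by
    intro x y hx hy
    obtain ⟨a, b, hb, rfl⟩ := cc_rep x
    obtain ⟨c, d, hd, rfl⟩ := cc_rep y
    have ha : a ≠ 0 := by rintro rfl; simp at hx
    have hc : c ≠ 0 := by rintro rfl; simp at hy
    have : cc a / cc b * (cc c / cc d) = cc (a * c) / cc (b * d) := by
      simp only [cc, map_mul]; rw [div_mul_div_comm]
    rw [this, P.vK_div ha hb, P.vK_div hc hd, P.vK_div (mul_ne_zero ha hc) (mul_ne_zero hb hd),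
      P.v_mul _ _ ha hc, P.v_mul _ _ hb hd]
    ring
  st := by
    intro x y hx hy h
    obtain ⟨a, b, c, hc, rfl, rfl⟩ := cc_rep2 x y
    have ha : a ≠ 0 := by rintro rfl; simp at hx
    have hb : b ≠ 0 := by rintro rfl; simp at hy
    have hc' := cc_ne hc
    have h1 : a + b = c := by
      apply RatFunc.algebraMap_injective F
      rw [← add_div, div_eq_one_iff_eq hc'] at h
      rw [map_add]; exact h
    have hlc := P.ne c hc
    rw [P.vK_div ha hc, P.vK_div hb hc, RatFunc.liftMonoidWithZeroHom_apply_div,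
      RatFunc.liftMonoidWithZeroHom_apply_div, div_eq_one_iff_eq hlc, div_eq_one_iff_eq hlc,
      ← add_div, div_eq_one_iff_eq hlc, div_eq_zero_iff]
    have := P.st a b c ha hb hc h1
    simp only [hlc, or_false]
    rcases this with h | h | h | h
    · left; exact ⟨by omega, h.2⟩
    · right; left; exact ⟨by omega, h.2⟩
    · right; right; left; exact ⟨by omega, h.2⟩
    · right; right; right; exact ⟨by omega, by omega, h.2.2⟩

theorem toDVD_v {a b : F[X]} (ha : a ≠ 0) (hb : b ≠ 0) :
    P.toDVD.v (cc a / cc b) = P.v a - P.v b := P.vK_div ha hb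

theorem toDVD_l (a b : F[X]) : P.toDVD.l (cc a / cc b) = P.l a / P.l b :=
  RatFunc.liftMonoidWithZeroHom_apply_div _ P.hne _ _

theorem v_one : P.v 1 = 0 := by
  have := P.v_mul 1 1 one_ne_zero one_ne_zero
  rw [mul_one] at this; omega

theorem toDVD_v' {a : F[X]} (ha : a ≠ 0) : P.toDVD.v (cc a) = P.v a := by
  have := P.toDVD_v ha one_ne_zero
  rw [P.v_one] at this
  simpa using this

theorem toDVD_l' (a : F[X]) : P.toDVD.l (cc a) = P.l a := by
  have := P.toDVD_l a 1
  simpa using this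

end PVD

/-- Leading coefficient. -/
noncomputable def leadHom (F : Type) [Field F] : F[X] →*₀ F where
  toFun := Polynomial.leadingCoeff
  map_zero' := leadingCoeff_zero
  map_one' := leadingCoeff_one
  map_mul' := leadingCoeff_mul

theorem leadHom_apply (f : F[X]) : leadHom F f = f.leadingCoeff := rfl

/-- The infinite place. -/
noncomputable def infP (F : Type) [Field F] : PVD F F where
  v f := - (f.natDegree : ℤ)
  l := leadHom F
  ne := by simp [leadHom_apply]
  v_mul := by
    intro x y hx hy
    rw [natDegree_mul hx hy]; push_cast; ring
  st := by
    intro a b c ha hb hc h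
    simp only [leadHom_apply, neg_inj, Nat.cast_inj]
    subst h
    rcases lt_trichotomy a.degree b.degree with h | h | h
    · left
      rw [leadingCoeff_add_of_degree_lt h]
      exact ⟨by rw [natDegree_eq_natDegree (degree_add_eq_right_of_degree_lt h)], rfl⟩
    · have h' := natDegree_eq_natDegree h
      by_cases h0 : a.leadingCoeff + b.leadingCoeff = 0
      · right; right; left; exact ⟨h', h0⟩
      · right; right; right
        have := degree_add_eq_of_leadingCoeff_add_ne_zero h0
        rw [h, max_self] at this
        refine ⟨?_, ?_, ?_⟩
        · rw [natDegree_eq_natDegree this, h']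
        · rw [natDegree_eq_natDegree this]
        · rw [leadingCoeff_add_of_degree_eq h h0]
    · right; left
      rw [add_comm, leadingCoeff_add_of_degree_lt h]
      exact ⟨by rw [natDegree_eq_natDegree (degree_add_eq_right_of_degree_lt h)], rfl⟩

section padic
variable {κ : Type} [Field κ] (π : F[X]) (hπ : Prime π) (q : F[X] →+* κ)
  (hq : ∀ a, q a = 0 ↔ π ∣ a)

theorem pex (π : F[X]) (hπ : Prime π) {a : F[X]} (ha : a ≠ 0) : ∃ (n : ℕ) (c : F[X]), a = π ^ n * c ∧ ¬ π ∣ c := by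
  obtain ⟨c, h1, h2⟩ := (FiniteMultiplicity.of_prime_left hπ ha).exists_eq_pow_mul_and_not_dvd
  exact ⟨_, c, h1, h2⟩

theorem puniq (π : F[X]) (hπ : Prime π) {n m : ℕ} {c d : F[X]} (hc : ¬ π ∣ c) (hd : ¬ π ∣ d) (h : π ^ n * c = π ^ m * d) :
    n = m ∧ c = d := by
  have h0 : π ≠ 0 := hπ.ne_zero
  have aux : ∀ {n m : ℕ} {c d : F[X]}, ¬ π ∣ c → π ^ n * c = π ^ m * d → m ≤ n := by
    intro n m c d hc h
    by_contra hlt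
    push Not at hlt
    obtain ⟨k, rfl⟩ := Nat.exists_eq_add_of_lt hlt
    apply hc
    rw [add_assoc, pow_add, mul_assoc] at h
    rw [mul_left_cancel₀ (pow_ne_zero n h0) h, pow_succ']
    exact ⟨π ^ k * d, by ring⟩
  have e : n = m := le_antisymm (aux hd h.symm) (aux hc h)
  subst e
  exact ⟨rfl, mul_left_cancel₀ (pow_ne_zero n h0) h⟩

open Classical in
/-- valuation -/
noncomputable def pv (a : F[X]) : ℕ := if h : a = 0 then 0 else (pex π hπ h).choose
open Classical in
/-- cofactor -/
noncomputable def pc (a : F[X]) : F[X] := if h : a = 0 then 0 else (pex π hπ h).choose_spec.choose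

theorem pv_spec {a : F[X]} (ha : a ≠ 0) : a = π ^ (pv π hπ a) * pc π hπ a ∧ ¬ π ∣ pc π hπ a := by
  rw [pv, pc, dif_neg ha, dif_neg ha]
  exact (pex π hπ ha).choose_spec.choose_spec

theorem pv_eq {n : ℕ} {c : F[X]} (hc : ¬ π ∣ c) :
    pv π hπ (π ^ n * c) = n ∧ pc π hπ (π ^ n * c) = c := by
  have h0 : π ^ n * c ≠ 0 := by
    apply mul_ne_zero (pow_ne_zero _ hπ.ne_zero); rintro rfl; simp at hc
  have h := pv_spec π hπ h0
  have := puniq π hπ hc h.2 h.1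
  exact ⟨this.1.symm, this.2.symm⟩

/-- The place of a prime polynomial. -/
noncomputable def padP : PVD F κ where
  v a := (pv π hπ a : ℤ)
  l := { toFun := fun a => q (pc π hπ a)
         map_zero' := by simp [pc]
         map_one' := by
          have h := (pv_eq π hπ (n := 0) (c := 1) (fun h => hπ.not_unit (isUnit_of_dvd_one h))).2
          rw [pow_zero, one_mul] at h
          rw [h, map_one]
         map_mul' := by
          intro a b
          by_cases ha : a = 0
          · simp [ha, pc]
          by_cases hb : b = 0
          · simp [hb, pc]
          have h1 := pv_spec π hπ ha
          have h2 := pv_spec π hπ hb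
          have h3 : a * b = π ^ (pv π hπ a + pv π hπ b) * (pc π hπ a * pc π hπ b) := by
            conv_lhs => rw [h1.1, h2.1]
            ring
          rw [h3, (pv_eq π hπ _).2, map_mul]
          exact fun h => (hπ.dvd_or_dvd h).elim h1.2 h2.2 }
  ne := by
    intro a ha h
    exact (pv_spec π hπ ha).2 ((hq _).1 h)
  v_mul := by
    intro a b ha hb
    have h1 := pv_spec π hπ ha
    have h2 := pv_spec π hπ hb
    have h3 : a * b = π ^ (pv π hπ a + pv π hπ b) * (pc π hπ a * pc π hπ b) := by
      conv_lhs => rw [h1.1, h2.1]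
      ring
    rw [h3, (pv_eq π hπ _).1]
    · simp
    exact fun h => (hπ.dvd_or_dvd h).elim h1.2 h2.2
  st := by
    intro a b c ha hb hc h
    simp only [MonoidWithZeroHom.coe_mk, ZeroHom.coe_mk, Nat.cast_inj]
    have h1 := pv_spec π hπ ha
    have h2 := pv_spec π hπ hb
    have hqπ : q π = 0 := (hq _).2 dvd_rfl
    have key : ∀ i j a b, i < j → ¬ π ∣ a → ¬ π ∣ b →
        pv π hπ (π ^ i * a + π ^ j * b) = i ∧ q (pc π hπ (π ^ i * a + π ^ j * b)) = q a := by
      intro i j a b hij ha hb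
      obtain ⟨k, rfl⟩ := Nat.exists_eq_add_of_lt hij
      have h4 : π ^ i * a + π ^ (i + k + 1) * b = π ^ i * (a + π * (π ^ k * b)) := by ring
      have h5 : ¬ π ∣ (a + π * (π ^ k * b)) := by
        rwa [dvd_add_left (Dvd.intro _ rfl)]
      rw [h4]
      have := pv_eq π hπ (n := i) h5
      exact ⟨this.1, by rw [this.2, map_add, map_mul, hqπ, zero_mul, add_zero]⟩
    generalize pv π hπ a = i at *
    generalize pv π hπ b = j at *
    generalize pc π hπ a = a' at *
    generalize pc π hπ b = b' at *
    rw [h1.1, h2.1] at h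
    rcases lt_trichotomy i j with hij | hij | hij
    · right; left
      have := key i j a' b' hij h1.2 h2.2
      rw [h] at this
      exact ⟨this.1.symm, this.2.symm⟩
    · subst hij
      right; right
      by_cases h0 : q a' + q b' = 0
      · left; exact ⟨rfl, h0⟩
      · right
        rw [← mul_add] at h
        have := pv_eq π hπ (n := i) (c := a' + b') (by rw [← hq, map_add]; exact h0)
        rw [h] at this
        rw [this.1, this.2, map_add]
        exact ⟨rfl, rfl, rfl⟩
    · left
      have := key j i b' a' hij h2.2 h1.2
      rw [add_comm, h] at this
      exact ⟨this.1.symm, this.2.symm⟩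

theorem padP_v (a : F[X]) : (padP π hπ q hq).v a = pv π hπ a := rfl
theorem padP_l (a : F[X]) : (padP π hπ q hq).l a = q (pc π hπ a) := rfl

theorem padP_eq {n : ℕ} {c : F[X]} (hc : ¬ π ∣ c) :
    (padP π hπ q hq).v (π ^ n * c) = n ∧ (padP π hπ q hq).l (π ^ n * c) = q c := by
  rw [padP_v, padP_l, (pv_eq π hπ hc).1, (pv_eq π hπ hc).2]
  exact ⟨rfl, rfl⟩

end padic

/-- Monic irreducible polynomials. -/
abbrev MI (F : Type) [Field F] := {π : F[X] // π.Monic ∧ Irreducible π}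

instance (π : MI F) : Fact (Irreducible π.1) := ⟨π.2.2⟩

theorem MI.prime (π : MI F) : Prime π.1 := π.2.2.prime

/-- The residue field. -/
abbrev MI.κ (π : MI F) : Type := AdjoinRoot π.1

/-- The place. -/
noncomputable def MI.P (π : MI F) : PVD F π.κ :=
  padP π.1 π.prime (AdjoinRoot.mk π.1) (fun _ => AdjoinRoot.mk_eq_zero)

/-- The valuation. -/
noncomputable def MI.d (π : MI F) : DVD (RatFunc F) π.κ := π.P.toDVD

theorem MI.d_eq (π : MI F) {n : ℕ} {c : F[X]} (hc : ¬ π.1 ∣ c) :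
    π.d.v (cc (π.1 ^ n * c)) = n ∧ π.d.l (cc (π.1 ^ n * c)) = AdjoinRoot.mk π.1 c := by
  have h0 : π.1 ^ n * c ≠ 0 := by
    apply mul_ne_zero (pow_ne_zero _ π.prime.ne_zero); rintro rfl; simp at hc
  rw [MI.d, PVD.toDVD_v' _ h0, PVD.toDVD_l']
  exact padP_eq _ _ _ _ hc

theorem MI.d_unit (π : MI F) {c : F[X]} (hc : ¬ π.1 ∣ c) :
    π.d.v (cc c) = 0 ∧ π.d.l (cc c) = AdjoinRoot.mk π.1 c := by
  have := π.d_eq (n := 0) hc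
  simpa using this

theorem MI.d_self (π : MI F) : π.d.v (cc π.1) = 1 ∧ π.d.l (cc π.1) = 1 := by
  have := π.d_eq (n := 1) (c := 1) (fun h => π.prime.not_unit (isUnit_of_dvd_one h))
  simpa using this

theorem MI.not_dvd_of_deg (π : MI F) {c : F[X]} (hc : c ≠ 0) (h : c.natDegree < π.1.natDegree) :
    ¬ π.1 ∣ c := fun h' => absurd (natDegree_le_of_dvd h' hc) (by omega)

theorem MI.not_dvd (π π' : MI F) (h : π ≠ π') : ¬ π.1 ∣ π'.1 := by
  intro h1
  apply h
  have := π.2.2.associated_of_dvd π'.2.2 h1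
  exact Subtype.ext (eq_of_monic_of_associated π.2.1 π'.2.1 this)

/-- The valuation at infinity. -/
noncomputable def dinf (F : Type) [Field F] : DVD (RatFunc F) F := (infP F).toDVD

theorem dinf_v {f : F[X]} (hf : f ≠ 0) : (dinf F).v (cc f) = - (f.natDegree : ℤ) :=
  PVD.toDVD_v' _ hf
theorem dinf_l (f : F[X]) : (dinf F).l (cc f) = f.leadingCoeff :=
  PVD.toDVD_l' _ f

theorem cc_C (a : F) : cc (Polynomial.C a) = RatFunc.C a := RatFunc.algebraMap_C a

theorem MI.const (π : MI F) (z : MK F) : π.d.s (mp RatFunc.C z) = mp (AdjoinRoot.of π.1) z ∧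
    π.d.r (mp RatFunc.C z) = 0 := by
  have h : ∀ x : F, x ≠ 0 → ¬ π.1 ∣ Polynomial.C x := fun x hx => π.not_dvd_of_deg (by simpa using hx)
    (by rw [natDegree_C]; exact π.2.2.natDegree_pos)
  apply DVD.const
  · intro x hx
    rw [← cc_C, (π.d_unit (h x hx)).1]
  · intro x
    by_cases hx : x = 0
    · simp [hx]
    rw [← cc_C, (π.d_unit (h x hx)).2]; rfl

theorem dinf_const (z : MK F) : (dinf F).s (mp RatFunc.C z) = z ∧
    (dinf F).r (mp RatFunc.C z) = 0 := by
  have := (dinf F).const RatFunc.C (RingHom.id F) (fun x hx => by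
    rw [← cc_C, dinf_v (by simpa using hx)]; simp) (fun x => by
    rw [← cc_C, dinf_l]; simp) z
  rwa [mp_id] at this

end Izh

namespace Izh
open Polynomial

variable {F : Type} [Field F]

theorem cc_mul (f g : F[X]) : cc (f * g) = cc f * cc g := map_mul _ _ _

/-- Subring generated by symbols of polynomials of degree less than `d`. -/
noncomputable def Lr (F : Type) [Field F] (d : ℕ) : Subring (MK (RatFunc F)) :=
  Subring.closure {z | ∃ f : F[X], f.natDegree < d ∧ z = sy (cc f)}

theorem sy_mem_Lr {d : ℕ} {f : F[X]} (h : f.natDegree < d) : sy (cc f) ∈ Lr F d :=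
  Subring.subset_closure ⟨f, h, rfl⟩

theorem sy_neg_one_mem {d : ℕ} (h : 0 < d) : sy (-1 : RatFunc F) ∈ Lr F d := by
  have := sy_mem_Lr (F := F) (f := -1) (d := d) (by simpa using h)
  simpa [cc] using this

theorem Lr_mono {d e : ℕ} (h : d ≤ e) : Lr F d ≤ Lr F e :=
  Subring.closure_mono (by rintro z ⟨f, h1, h2⟩; exact ⟨f, h1.trans_le h, h2⟩)

/-- Induction on left multiplication. -/
theorem Lr_induction {d : ℕ} {P : MK (RatFunc F) → Prop} (h1 : P 1)
    (ha : ∀ a b, P a → P b → P (a + b)) (hn : ∀ a, P a → P (-a))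
    (hm : ∀ (f : F[X]) a, f.natDegree < d → a ∈ Lr F d → P a → P (sy (cc f) * a))
    {z : MK (RatFunc F)} (hz : z ∈ Lr F d) : P z := by
  have h0 : P 0 := by have := ha _ _ h1 (hn _ h1); rwa [add_neg_cancel] at this
  have key : ∀ w ∈ Lr F d, ∀ a, a ∈ Lr F d → P a → P (w * a) := by
    intro w hw
    refine Subring.closure_induction (p := fun w _ => ∀ a, a ∈ Lr F d → P a → P (w * a))
      ?_ ?_ ?_ ?_ ?_ ?_ hw
    · rintro x ⟨f, hf, rfl⟩ a ha h; exact hm f a hf ha h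
    · intro a _ _; rwa [zero_mul]
    · intro a _ h; rwa [one_mul]
    · intro x y _ _ hx hy a h h'; rw [add_mul]; exact ha _ _ (hx a h h') (hy a h h')
    · intro x _ hx a h h'; rw [neg_mul]; exact hn _ (hx a h h')
    · intro x y _ hy' hx hy a h h'
      rw [mul_assoc]; exact hx _ (mul_mem hy' h) (hy a h h')
  have := key z hz 1 (one_mem _) h1
  rwa [mul_one] at this

theorem exists_Lr (z : MK (RatFunc F)) : ∃ d, 1 ≤ d ∧ z ∈ Lr F d := by
  induction z using MK.induction with
  | h1 => exact ⟨1, le_rfl, one_mem _⟩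
  | ha a b h1 h2 =>
    obtain ⟨d, hd, h1⟩ := h1
    obtain ⟨e, he, h2⟩ := h2
    exact ⟨max d e, le_max_of_le_left hd,
      add_mem (Lr_mono (le_max_left _ _) h1) (Lr_mono (le_max_right _ _) h2)⟩
  | hn a h => obtain ⟨d, hd, h⟩ := h; exact ⟨d, hd, neg_mem h⟩
  | hm x a h =>
    obtain ⟨d, hd, h⟩ := h
    obtain ⟨f, g, hg, rfl⟩ := cc_rep x
    by_cases hf : f = 0
    · exact ⟨1, le_rfl, by simp [hf, sy_zero]⟩
    rw [sy_div (cc_ne hf) (cc_ne hg)]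
    refine ⟨max d (max (f.natDegree + 1) (g.natDegree + 1)), le_max_of_le_left hd, ?_⟩
    refine mul_mem (sub_mem (sy_mem_Lr ?_) (sy_mem_Lr ?_)) (Lr_mono (le_max_left _ _) h)
    · exact lt_of_lt_of_le (Nat.lt_succ_self _) (le_max_of_le_right (le_max_left _ _))
    · exact lt_of_lt_of_le (Nat.lt_succ_self _) (le_max_of_le_right (le_max_right _ _))

theorem Lr_one {z : MK (RatFunc F)} (hz : z ∈ Lr F 1) : ∃ y, z = mp RatFunc.C y := by
  refine Lr_induction (P := fun z => ∃ y, z = mp RatFunc.C y) ⟨1, by simp⟩ ?_ ?_ ?_ hz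
  · rintro _ _ ⟨a, rfl⟩ ⟨b, rfl⟩; exact ⟨a + b, by simp⟩
  · rintro _ ⟨a, rfl⟩; exact ⟨-a, by simp⟩
  · rintro f _ hf _ ⟨a, rfl⟩
    have : f = Polynomial.C (f.coeff 0) := eq_C_of_natDegree_eq_zero (by omega)
    refine ⟨sy (f.coeff 0) * a, ?_⟩
    rw [map_mul, mp_sy, ← cc_C, ← this]

theorem Lr_r (π : MI F) {d : ℕ} (h : d ≤ π.1.natDegree) {z : MK (RatFunc F)} (hz : z ∈ Lr F d) :
    π.d.r z = 0 := by
  refine Lr_induction (P := fun z => π.d.r z = 0) (by simp) ?_ ?_ ?_ hz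
  · intro a b h1 h2; rw [map_add, h1, h2, add_zero]
  · intro a h1; rw [map_neg, h1, neg_zero]
  · intro f a hf _ h1
    by_cases h0 : f = 0
    · simp [h0, sy_zero]
    rw [π.d.r_sy_mul (cc_ne h0), h1, (π.d_unit (π.not_dvd_of_deg h0 (by omega))).1]
    simp

theorem Lr_r_self (π : MI F) {z : MK (RatFunc F)} (hz : z ∈ Lr F π.1.natDegree) :
    π.d.r (sy (cc π.1) * z) = π.d.s z := by
  rw [π.d.r_sy_mul (cc_ne π.prime.ne_zero), Lr_r π le_rfl hz, π.d_self.1]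
  simp

theorem Lr_r_other (π π' : MI F) (hne : π' ≠ π) {d : ℕ} (h : d ≤ π'.1.natDegree) {z : MK (RatFunc F)}
    (hz : z ∈ Lr F d) : π'.d.r (sy (cc π.1) * z) = 0 := by
  rw [π'.d.r_sy_mul (cc_ne π.prime.ne_zero), Lr_r π' h hz, (π'.d_unit (π'.not_dvd π hne)).1]
  simp

section B
variable (π : MI F)

/-- The ideal `A`. -/
noncomputable def Aid : Ideal (Lr F π.1.natDegree) where
  carrier := {β | sy (cc π.1) * β.1 ∈ Lr F π.1.natDegree}
  zero_mem' := by simp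
  add_mem' := by
    intro a b ha hb
    simp only [Set.mem_setOf_eq, Subring.coe_add, mul_add] at *
    exact add_mem ha hb
  smul_mem' := by
    intro c x hx
    simp only [Set.mem_setOf_eq, smul_eq_mul, Subring.coe_mul] at *
    refine Lr_induction (P := fun c => sy (cc π.1) * (c * x.1) ∈ Lr F π.1.natDegree)
      (by simpa using hx) ?_ ?_ ?_ c.2
    · intro a b h1 h2; rw [add_mul, mul_add]; exact add_mem h1 h2
    · intro a h1; rw [neg_mul, mul_neg]; exact neg_mem h1
    · intro f a hf _ h
      rw [mul_assoc, ← mul_assoc, sy_anticomm, neg_mul, mul_assoc]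
      exact neg_mem (mul_mem (sy_mem_Lr hf) h)

instance : (Aid π).IsTwoSided := ⟨by
  intro a b ha
  change sy (cc π.1) * (a.1 * b.1) ∈ Lr F π.1.natDegree
  rw [← mul_assoc]
  exact mul_mem ha b.2⟩

theorem mem_Aid (β : Lr F π.1.natDegree) :
    β ∈ Aid π ↔ sy (cc π.1) * β.1 ∈ Lr F π.1.natDegree := Iff.rfl

/-- representative of small degree -/
noncomputable def rep (k : π.κ) : F[X] := (AdjoinRoot.mk_surjective k).choose %ₘ π.1

theorem rep_deg (k : π.κ) : (rep π k).natDegree < π.1.natDegree :=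
  natDegree_modByMonic_lt _ π.2.1 (fun h => π.prime.not_unit (by rw [h]; exact isUnit_one))

theorem rep_mk (k : π.κ) : AdjoinRoot.mk π.1 (rep π k) = k := by
  conv_rhs => rw [← (AdjoinRoot.mk_surjective k).choose_spec]
  rw [AdjoinRoot.mk_eq_mk, rep]
  have := modByMonic_add_div (AdjoinRoot.mk_surjective k).choose π.1
  exact ⟨- ((AdjoinRoot.mk_surjective k).choose /ₘ π.1), by linear_combination this⟩

theorem rep_unique {f g : F[X]} (hf : f.natDegree < π.1.natDegree) (hg : g.natDegree < π.1.natDegree)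
    (h : AdjoinRoot.mk π.1 f = AdjoinRoot.mk π.1 g) : f = g := by
  rw [AdjoinRoot.mk_eq_mk] at h
  by_contra hne
  have h1 := natDegree_le_of_dvd h (sub_ne_zero.2 hne)
  have h2 := natDegree_sub_le f g
  have : max f.natDegree g.natDegree < π.1.natDegree := max_lt hf hg
  omega

theorem rep_eq {f : F[X]} (hf : f.natDegree < π.1.natDegree) : rep π (AdjoinRoot.mk π.1 f) = f :=
  rep_unique π (rep_deg π _) hf (rep_mk π _)

theorem rep_zero : rep π 0 = 0 := by
  have := rep_eq π (f := 0) (by simpa using π.2.2.natDegree_pos)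
  simpa using this

theorem rep_ne {k : π.κ} (hk : k ≠ 0) : rep π k ≠ 0 := by
  intro h
  apply hk
  rw [← rep_mk π k, h, map_zero]

/-- The key congruence. -/
theorem rep_mul {g1 g2 h : F[X]} (d1 : g1.natDegree < π.1.natDegree)
    (d2 : g2.natDegree < π.1.natDegree) (dh : h.natDegree < π.1.natDegree) (n1 : g1 ≠ 0)
    (n2 : g2 ≠ 0) (nh : h ≠ 0) (hd : π.1 ∣ g1 * g2 - h) :
    sy (cc π.1) * (sy (cc h) - sy (cc g1) - sy (cc g2)) ∈ Lr F π.1.natDegree := by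
  obtain ⟨m, hm⟩ := hd
  have c1 := cc_ne n1
  have c2 := cc_ne n2
  have ch := cc_ne nh
  have cπ := cc_ne π.prime.ne_zero
  by_cases m0 : m = 0
  · rw [m0, mul_zero, sub_eq_zero] at hm
    rw [← hm, cc_mul, sy_mul c1 c2]
    have : sy (cc g1) + sy (cc g2) - sy (cc g1) - sy (cc g2) = 0 := by abel
    rw [this, mul_zero]; exact zero_mem _
  have cm := cc_ne m0
  have dm : m.natDegree < π.1.natDegree := by
    by_contra hlt
    have e1 : (π.1 * m).natDegree = π.1.natDegree + m.natDegree := natDegree_mul π.prime.ne_zero m0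
    have e2 : (g1 * g2 - h).natDegree ≤ max (g1 * g2).natDegree h.natDegree := natDegree_sub_le _ _
    have e3 : (g1 * g2).natDegree = g1.natDegree + g2.natDegree := natDegree_mul n1 n2
    rw [hm, e1, e3] at e2
    rcases le_max_iff.1 e2 with h | h <;> omega
  have e : cc h / (cc g1 * cc g2) + cc π.1 * cc m / (cc g1 * cc g2) = 1 := by
    rw [← add_div, div_eq_one_iff_eq (mul_ne_zero c1 c2)]
    simp only [cc, ← map_mul, ← map_add]
    rw [← hm]; congr 1; ring
  have := sy_st e
  rw [sy_div ch (mul_ne_zero c1 c2), sy_div (mul_ne_zero cπ cm) (mul_ne_zero c1 c2), sy_mul c1 c2,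
    sy_mul cπ cm] at this
  have hX : sy (cc h) - sy (cc g1) - sy (cc g2) ∈ Lr F π.1.natDegree :=
    sub_mem (sub_mem (sy_mem_Lr dh) (sy_mem_Lr d1)) (sy_mem_Lr d2)
  have hY : sy (cc m) - (sy (cc g1) + sy (cc g2)) ∈ Lr F π.1.natDegree :=
    sub_mem (sy_mem_Lr dm) (add_mem (sy_mem_Lr d1) (sy_mem_Lr d2))
  have e2 : sy (cc π.1) * (sy (cc h) - sy (cc g1) - sy (cc g2)) =
      (sy (cc h) - sy (cc g1) - sy (cc g2)) * (sy (cc m) - (sy (cc g1) + sy (cc g2))) := by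
    simp only [mul_sub, sub_mul, mul_add, add_mul] at this ⊢
    rw [sy_anticomm (cc π.1) (cc h), sy_anticomm (cc π.1) (cc g1), sy_anticomm (cc π.1) (cc g2)]
    rw [← sub_eq_zero, ← neg_eq_zero, ← this]; abel
  rw [e2]; exact mul_mem hX hY

open Classical in
/-- The homomorphism from the residue field. -/
noncomputable def hφ : MK π.κ →+* (Lr F π.1.natDegree) ⧸ (Aid π) :=
  lift (fun k => Ideal.Quotient.mk (Aid π) ⟨sy (cc (rep π k)), sy_mem_Lr (rep_deg π k)⟩)
    (by
      rw [← map_zero (Ideal.Quotient.mk (Aid π))]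
      congr 1
      ext
      simp [rep_zero, sy_zero])
    (by
      intro x y hx hy
      rw [← map_add]
      rw [Ideal.Quotient.eq, mem_Aid]
      have hd : π.1 ∣ rep π x * rep π y - rep π (x * y) := by
        rw [← AdjoinRoot.mk_eq_mk, map_mul, rep_mk, rep_mk, rep_mk]
      have := rep_mul π (rep_deg π x) (rep_deg π y) (rep_deg π (x * y)) (rep_ne π hx) (rep_ne π hy)
        (rep_ne π (mul_ne_zero hx hy)) hd
      convert this using 2
      exact (sub_sub _ _ _).symm)
    (by
      intro x y hx hy h
      rw [← map_mul, ← map_zero (Ideal.Quotient.mk (Aid π))]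
      congr 1
      ext
      simp only [Subring.coe_mul, Subring.coe_zero]
      apply sy_st
      have : rep π x + rep π y = 1 := by
        apply rep_unique π
        · exact (natDegree_add_le _ _).trans_lt (max_lt (rep_deg π x) (rep_deg π y))
        · simpa using π.2.2.natDegree_pos
        · rw [map_add, rep_mk, rep_mk, h, map_one]
      rw [cc, ← map_add, this, map_one])

theorem hφ_s {β : MK (RatFunc F)} (hβ : β ∈ Lr F π.1.natDegree) :
    hφ π (π.d.s β) = Ideal.Quotient.mk (Aid π) ⟨β, hβ⟩ := by
  have : ∃ h : β ∈ Lr F π.1.natDegree, hφ π (π.d.s β) = Ideal.Quotient.mk (Aid π) ⟨β, h⟩ := by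
    refine Lr_induction (P := fun β => ∃ h : β ∈ Lr F π.1.natDegree,
      hφ π (π.d.s β) = Ideal.Quotient.mk (Aid π) ⟨β, h⟩) ?_ ?_ ?_ ?_ hβ
    · refine ⟨one_mem _, ?_⟩
      rw [map_one, map_one]; exact (map_one _).symm
    · rintro a b ⟨h1, h1'⟩ ⟨h2, h2'⟩
      refine ⟨add_mem h1 h2, ?_⟩
      rw [map_add, map_add, h1', h2', ← map_add]; rfl
    · rintro a ⟨h1, h1'⟩
      refine ⟨neg_mem h1, ?_⟩
      rw [map_neg, map_neg, h1', ← map_neg]; rfl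
    · rintro f a hf ha ⟨h1, h1'⟩
      refine ⟨mul_mem (sy_mem_Lr hf) h1, ?_⟩
      rw [map_mul, map_mul, h1', DVD.s_sy]
      have e : π.d.l (cc f) = AdjoinRoot.mk π.1 f := by
        by_cases h0 : f = 0
        · simp [h0]
        · exact (π.d_unit (π.not_dvd_of_deg h0 hf)).2
      rw [e, hφ, lift_sy, ← map_mul]
      congr 1
      ext
      simp only [Subring.coe_mul, rep_eq π hf]
  exact this.2

theorem claimB {β : MK (RatFunc F)} (hβ : β ∈ Lr F π.1.natDegree) (h : π.d.s β = 0) :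
    sy (cc π.1) * β ∈ Lr F π.1.natDegree := by
  have := hφ_s π hβ
  rw [h, map_zero] at this
  exact (Ideal.Quotient.eq_zero_iff_mem.1 this.symm)

end B

/-- The group `G`. -/
noncomputable def Gr (F : Type) [Field F] (d : ℕ) : AddSubgroup (MK (RatFunc F)) :=
  AddSubgroup.closure ({z | z ∈ Lr F d} ∪
    {z | ∃ (π : MI F) (β : MK (RatFunc F)), π.1.natDegree = d ∧ β ∈ Lr F d ∧ z = sy (cc π.1) * β})

theorem Lr_sub_Gr {d : ℕ} {z : MK (RatFunc F)} (h : z ∈ Lr F d) : z ∈ Gr F d :=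
  AddSubgroup.subset_closure (Or.inl h)
theorem pi_mem_Gr {d : ℕ} (π : MI F) (hπ : π.1.natDegree = d) {z : MK (RatFunc F)}
    (h : z ∈ Lr F d) : sy (cc π.1) * z ∈ Gr F d :=
  AddSubgroup.subset_closure (Or.inr ⟨π, z, hπ, h, rfl⟩)

theorem Gr_small {d : ℕ} {f : F[X]} (hf : f.natDegree < d) {z : MK (RatFunc F)}
    (h : z ∈ Gr F d) : sy (cc f) * z ∈ Gr F d := by
  refine AddSubgroup.closure_induction (p := fun z _ => sy (cc f) * z ∈ Gr F d) ?_ ?_ ?_ ?_ h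
  · rintro z (hz | ⟨π, β, h1, h2, rfl⟩)
    · exact Lr_sub_Gr (mul_mem (sy_mem_Lr hf) hz)
    · rw [← mul_assoc, sy_anticomm, neg_mul, mul_assoc]
      exact neg_mem (pi_mem_Gr π h1 (mul_mem (sy_mem_Lr hf) h2))
  · simp
  · intro a b _ _ h1 h2; rw [mul_add]; exact add_mem h1 h2
  · intro a _ h1; rw [mul_neg]; exact neg_mem h1

theorem Gr_pi {d : ℕ} (hd : 0 < d) (π : MI F) (hπ : π.1.natDegree = d) {z : MK (RatFunc F)}
    (h : z ∈ Gr F d) : sy (cc π.1) * z ∈ Gr F d := by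
  refine AddSubgroup.closure_induction (p := fun z _ => sy (cc π.1) * z ∈ Gr F d) ?_ ?_ ?_ ?_ h
  · rintro z (hz | ⟨π', β, h1, h2, rfl⟩)
    · exact pi_mem_Gr π hπ hz
    · by_cases he : π = π'
      · subst he
        rw [← mul_assoc, sy_mul_self, mul_assoc]
        exact pi_mem_Gr π hπ (mul_mem (sy_neg_one_mem hd) h2)
      · set f := π'.1 - π.1 with hf
        have f0 : f ≠ 0 := by
          intro h0
          apply he
          exact Subtype.ext (sub_eq_zero.1 h0).symm
        have fd : f.natDegree < d := by
          have e1 : (π'.1 - π.1).degree < π'.1.degree := by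
            apply degree_sub_lt
            · rw [degree_eq_natDegree π.prime.ne_zero, degree_eq_natDegree π'.prime.ne_zero, hπ, h1]
            · exact π'.prime.ne_zero
            · rw [π.2.1.leadingCoeff, π'.2.1.leadingCoeff]
          rw [← h1]
          exact natDegree_lt_natDegree f0 e1
        have cπ := cc_ne π.prime.ne_zero
        have cπ' := cc_ne π'.prime.ne_zero
        have cf := cc_ne f0
        have e : cc π.1 / cc π'.1 + cc f / cc π'.1 = 1 := by
          rw [← add_div, div_eq_one_iff_eq cπ']
          simp only [cc, ← map_add]
          rw [hf]; congr 1; ring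
        have := sy_st e
        rw [sy_div cπ cπ', sy_div cf cπ'] at this
        simp only [mul_sub, sub_mul] at this
        rw [sy_mul_self (cc π'.1)] at this
        have e2 : sy (cc π.1) * sy (cc π'.1) = sy (cc π.1) * sy (cc f) - sy (cc π'.1) * sy (cc f) +
            sy (cc π'.1) * sy (-1) := by
          rw [← sub_eq_zero, ← neg_eq_zero, ← this]; abel
        rw [← mul_assoc, e2, add_mul, sub_mul, mul_assoc, mul_assoc, mul_assoc]
        exact add_mem (sub_mem (pi_mem_Gr π hπ (mul_mem (sy_mem_Lr fd) h2))
          (pi_mem_Gr π' h1 (mul_mem (sy_mem_Lr fd) h2)))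
          (pi_mem_Gr π' h1 (mul_mem (sy_neg_one_mem hd) h2))
  · simp
  · intro a b _ _ h1 h2; rw [mul_add]; exact add_mem h1 h2
  · intro a _ h1; rw [mul_neg]; exact neg_mem h1

theorem Lr_le_Gr {d : ℕ} (hd : 0 < d) {z : MK (RatFunc F)} (h : z ∈ Lr F (d + 1)) : z ∈ Gr F d := by
  refine Lr_induction (Lr_sub_Gr (one_mem _)) (fun a b h1 h2 => add_mem h1 h2)
    (fun a h1 => neg_mem h1) ?_ h
  intro f a hf _ ha
  by_cases h1 : f.natDegree < d
  · exact Gr_small h1 ha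
  have hfd : f.natDegree = d := by omega
  have f0 : f ≠ 0 := by rintro rfl; simp at hfd; omega
  by_cases hirr : Irreducible f
  · have hlc : f.leadingCoeff ≠ 0 := by simpa using f0
    let π : MI F := ⟨f * Polynomial.C f.leadingCoeff⁻¹, monic_mul_leadingCoeff_inv f0,
      irreducible_mul_leadingCoeff_inv.2 hirr⟩
    have hπ : π.1.natDegree = d := by
      rw [← hfd]; exact natDegree_mul_leadingCoeff_inv f f0
    have e : f = Polynomial.C f.leadingCoeff * π.1 := by
      change f = Polynomial.C f.leadingCoeff * (f * Polynomial.C f.leadingCoeff⁻¹)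
      rw [mul_left_comm, ← Polynomial.C_mul, mul_inv_cancel₀ hlc, Polynomial.C_1, mul_one]
    rw [e, cc, map_mul, sy_mul (cc_ne (by simpa using hlc)) (cc_ne π.prime.ne_zero), add_mul]
    exact add_mem (Gr_small (by simpa using hd) ha) (Gr_pi hd π hπ ha)
  · rw [irreducible_iff] at hirr
    push Not at hirr
    obtain ⟨a', b', hab, ha', hb'⟩ := hirr (fun hu => by
      have := natDegree_eq_zero_of_isUnit hu; omega)
    have na : a' ≠ 0 := by rintro rfl; simp at hab; exact f0 hab
    have nb : b' ≠ 0 := by rintro rfl; simp at hab; exact f0 hab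
    have pos : ∀ g : F[X], g ≠ 0 → ¬ IsUnit g → 0 < g.natDegree := by
      intro g h0 hg
      by_contra h
      apply hg
      have h2 : g = Polynomial.C (g.coeff 0) := eq_C_of_natDegree_eq_zero (by omega)
      rw [h2]
      apply (Polynomial.isUnit_C).2
      rw [isUnit_iff_ne_zero]
      intro h3; rw [h3, Polynomial.C_0] at h2; exact h0 h2
    have e := natDegree_mul na nb
    rw [← hab] at e
    have p1 := pos a' na ha'
    have p2 := pos b' nb hb'
    rw [hab, cc, map_mul, sy_mul (cc_ne na) (cc_ne nb), add_mul]
    exact add_mem (Gr_small (by omega) ha) (Gr_small (by omega) ha)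

theorem Gr_rep {d : ℕ} {z : MK (RatFunc F)} (h : z ∈ Gr F d) : ∃ b : MI F →₀ MK (RatFunc F),
    (∀ π, b π ≠ 0 → π.1.natDegree = d) ∧ (∀ π, b π ∈ Lr F d) ∧
    z - b.sum (fun π β => sy (cc π.1) * β) ∈ Lr F d := by
  classical
  refine AddSubgroup.closure_induction (p := fun z _ => ∃ b : MI F →₀ MK (RatFunc F),
    (∀ π, b π ≠ 0 → π.1.natDegree = d) ∧ (∀ π, b π ∈ Lr F d) ∧
    z - b.sum (fun π β => sy (cc π.1) * β) ∈ Lr F d) ?_ ?_ ?_ ?_ h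
  · rintro z (hz | ⟨π, β, h1, h2, rfl⟩)
    · exact ⟨0, by simp, by simp, by simpa using hz⟩
    · refine ⟨Finsupp.single π β, ?_, ?_, ?_⟩
      · intro π' h
        by_cases he : π = π'
        · rw [← he, h1]
        · rw [Finsupp.single_apply, if_neg he] at h; exact absurd rfl h
      · intro π'
        rw [Finsupp.single_apply]
        split_ifs
        · exact h2
        · exact zero_mem _
      · rw [Finsupp.sum_single_index (by simp), sub_self]; exact zero_mem _
  · exact ⟨0, by simp, by simp, by simp⟩
  · rintro x y _ _ ⟨b, h1, h2, h3⟩ ⟨c, h1', h2', h3'⟩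
    refine ⟨b + c, ?_, ?_, ?_⟩
    · intro π h
      by_cases hb : b π = 0
      · apply h1'; intro h0; apply h; simp [hb, h0]
      · exact h1 π hb
    · intro π; exact add_mem (h2 π) (h2' π)
    · rw [Finsupp.sum_add_index' (by simp) (by intro a b c; rw [mul_add]), add_sub_add_comm]
      exact add_mem h3 h3'
  · rintro x _ ⟨b, h1, h2, h3⟩
    refine ⟨-b, ?_, ?_, ?_⟩
    · intro π h; apply h1; intro h0; apply h; simp [h0]
    · intro π; exact neg_mem (h2 π)
    · rw [Finsupp.sum_neg_index (by simp)]
      have : -x - b.sum (fun π β => sy (cc π.1) * -β) = -(x - b.sum (fun π β => sy (cc π.1) * β)) := by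
        simp only [mul_neg, Finsupp.sum, Finset.sum_neg_distrib]; abel
      rw [this]; exact neg_mem h3

theorem Lr_descend {d : ℕ} (hd : 0 < d) {z : MK (RatFunc F)} (h : z ∈ Lr F (d + 1))
    (hr : ∀ π : MI F, π.d.r z = 0) : z ∈ Lr F d := by
  classical
  obtain ⟨b, h1, h2, h3⟩ := Gr_rep (Lr_le_Gr hd h)
  have key : ∀ π ∈ b.support, sy (cc π.1) * b π ∈ Lr F d := by
    intro π hπ
    have hdeg := h1 π (Finsupp.mem_support_iff.1 hπ)
    have h4 := h2 π
    have := Lr_r π hdeg.ge h3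
    rw [map_sub, hr π, zero_sub, neg_eq_zero, Finsupp.sum, map_sum, Finset.sum_eq_single π] at this
    · subst hdeg
      rw [Lr_r_self π h4] at this
      exact claimB π h4 this
    · intro π' _ hne
      exact Lr_r_other π' π hne.symm hdeg.ge (h2 π')
    · intro h; exact absurd hπ h
  have h5 : b.sum (fun π β => sy (cc π.1) * β) ∈ Lr F d := sum_mem key
  have := add_mem h3 h5
  rwa [sub_add_cancel] at this

theorem M1 {z : MK (RatFunc F)} (hr : ∀ π : MI F, π.d.r z = 0) : ∃ y, z = mp RatFunc.C y := by
  obtain ⟨d, hd, hz⟩ := exists_Lr z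
  have : ∀ d, z ∈ Lr F (d + 1) → z ∈ Lr F 1 := by
    intro d
    induction d with
    | zero => exact id
    | succ d ih => intro h; exact ih (Lr_descend (Nat.succ_pos _) h hr)
  apply Lr_one
  apply this (d - 1)
  rwa [Nat.sub_add_cancel hd]

theorem finite_dvd {a : F[X]} (ha : a ≠ 0) : ∃ S : Finset (MI F), ∀ π : MI F, π.1 ∣ a → π ∈ S := by
  classical
  have hfin : {π : MI F | π.1 ∣ a}.Finite := by
    apply Set.Finite.of_finite_image (f := Subtype.val)
    · apply Set.Finite.subset (UniqueFactorizationMonoid.normalizedFactors a).toFinset.finite_toSet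
      rintro _ ⟨π, h, rfl⟩
      simp only [Finset.mem_coe, Multiset.mem_toFinset]
      rw [UniqueFactorizationMonoid.mem_normalizedFactors_iff' ha]
      exact ⟨π.2.2, π.2.1.normalize_eq_self, h⟩
    · exact Subtype.val_injective.injOn
  exact ⟨hfin.toFinset, fun π h => by simpa using h⟩

theorem finite_res (z : MK (RatFunc F)) : ∃ S : Finset (MI F), ∀ π : MI F, π ∉ S → π.d.r z = 0 := by
  classical
  induction z using MK.induction with
  | h1 => exact ⟨∅, by simp⟩
  | ha a b h1 h2 =>
    obtain ⟨S, h1⟩ := h1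
    obtain ⟨T, h2⟩ := h2
    refine ⟨S ∪ T, fun π h => ?_⟩
    rw [Finset.mem_union, not_or] at h
    rw [map_add, h1 π h.1, h2 π h.2, add_zero]
  | hn a h => obtain ⟨S, h⟩ := h; exact ⟨S, fun π hπ => by rw [map_neg, h π hπ, neg_zero]⟩
  | hm x z h =>
    obtain ⟨S, h⟩ := h
    obtain ⟨f, g, hg, rfl⟩ := cc_rep x
    by_cases hf : f = 0
    · exact ⟨∅, by simp [hf, sy_zero]⟩
    obtain ⟨A, hA⟩ := finite_dvd hf
    obtain ⟨B, hB⟩ := finite_dvd hg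
    refine ⟨S ∪ A ∪ B, fun π hπ => ?_⟩
    simp only [Finset.mem_union, not_or] at hπ
    have e1 := π.d_unit (fun h' => hπ.1.2 (hA π h'))
    have e2 := π.d_unit (fun h' => hπ.2 (hB π h'))
    rw [sy_div (cc_ne hf) (cc_ne hg), sub_mul, map_sub, π.d.r_sy_mul (cc_ne hf),
      π.d.r_sy_mul (cc_ne hg), h π hπ.1.1, e1.1, e2.1]
    simp

theorem lift_residue (π : MI F) {n : ℕ} {y : MK π.κ} (hy : y ∈ dg π.κ n) :
    ∃ β ∈ dg (RatFunc F) n, β ∈ Lr F π.1.natDegree ∧ π.d.s β = y := by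
  refine dg_rec (P := fun n y => ∃ β ∈ dg (RatFunc F) n, β ∈ Lr F π.1.natDegree ∧ π.d.s β = y)
    ?_ ?_ ?_ ?_ ?_ hy
  · exact ⟨1, one_mem_dg, one_mem _, map_one _⟩
  · intro n; exact ⟨0, zero_mem _, zero_mem _, map_zero _⟩
  · rintro n _ _ ⟨a, h1, h2, rfl⟩ ⟨b, h3, h4, rfl⟩
    exact ⟨a + b, add_mem h1 h3, add_mem h2 h4, map_add _ _ _⟩
  · rintro n _ ⟨a, h1, h2, rfl⟩
    exact ⟨-a, neg_mem h1, neg_mem h2, map_neg _ _⟩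
  · rintro n x _ _ ⟨a, h1, h2, rfl⟩
    refine ⟨sy (cc (rep π x)) * a, sy_mul_mem _ h1, mul_mem (sy_mem_Lr (rep_deg π x)) h2, ?_⟩
    rw [map_mul, DVD.s_sy]
    by_cases hx : x = 0
    · simp [hx, rep_zero]
    · rw [(π.d_unit (π.not_dvd_of_deg (rep_ne π hx) (rep_deg π x))).2, rep_mk]

theorem M2 (π : MI F) {n : ℕ} {y : MK π.κ} (hy : y ∈ dg π.κ n) :
    ∃ z ∈ dg (RatFunc F) (n + 1), π.d.r z = y ∧ ∀ π' : MI F, π' ≠ π → π'.d.r z = 0 := by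
  classical
  have key : ∀ (m : ℕ) (π : MI F), π.1.natDegree = m → ∀ y ∈ dg π.κ n,
      ∃ z ∈ dg (RatFunc F) (n + 1), π.d.r z = y ∧ ∀ π' : MI F, π' ≠ π → π'.d.r z = 0 := by
    intro m
    induction m using Nat.strong_induction_on with
    | _ m ih =>
    intro π hm y hy
    obtain ⟨β, hβ, hβL, rfl⟩ := lift_residue π hy
    set z0 := sy (cc π.1) * β with hz0
    have hz0d : z0 ∈ dg (RatFunc F) (n + 1) := sy_mul_mem _ hβ
    obtain ⟨S, hS⟩ := finite_res z0
    have hbig : ∀ π' : MI F, π' ≠ π → m ≤ π'.1.natDegree → π'.d.r z0 = 0 := by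
      intro π' hne hle
      exact Lr_r_other π π' hne (hm.trans_le hle) hβL
    have hex : ∀ π' : MI F, ∃ z ∈ dg (RatFunc F) (n + 1), π'.1.natDegree < m → (π'.d.r z = π'.d.r z0 ∧
        ∀ π'' : MI F, π'' ≠ π' → π''.d.r z = 0) := by
      intro π'
      by_cases hlt : π'.1.natDegree < m
      · obtain ⟨z, h1, h2, h3⟩ := ih _ hlt π' rfl (π'.d.r z0) (π'.d.r_mem hz0d)
        exact ⟨z, h1, fun _ => ⟨h2, h3⟩⟩
      · exact ⟨0, zero_mem _, fun h => absurd h hlt⟩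
    choose w hw1 hw2 using hex
    set T := S.filter (fun π' => π'.1.natDegree < m) with hT
    have hTm : ∀ π' ∈ T, π'.1.natDegree < m := fun π' h => (Finset.mem_filter.1 h).2
    refine ⟨z0 - ∑ π' ∈ T, w π', sub_mem hz0d (sum_mem fun π' _ => hw1 π'), ?_, ?_⟩
    · rw [map_sub, map_sum, Finset.sum_eq_zero, sub_zero, hz0, Lr_r_self π hβL]
      intro π' hπ'
      have hlt := hTm π' hπ'
      refine (hw2 π' hlt).2 π ?_
      rintro rfl; omega
    · intro π' hne
      rw [map_sub, map_sum]
      by_cases hmem : π' ∈ T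
      · rw [Finset.sum_eq_single π']
        · rw [(hw2 π' (hTm π' hmem)).1, sub_self]
        · intro π'' h'' hne''
          exact (hw2 π'' (hTm π'' h'')).2 π' hne''.symm
        · intro h; exact absurd hmem h
      · have h0 : π'.d.r z0 = 0 := by
          by_cases hlt : π'.1.natDegree < m
          · apply hS; intro h; exact hmem (Finset.mem_filter.2 ⟨h, hlt⟩)
          · exact hbig π' hne (by omega)
        rw [h0, Finset.sum_eq_zero, sub_zero]
        intro π'' h''
        refine (hw2 π'' (hTm π'' h'')).2 π' ?_
        rintro rfl; exact hmem h''
  exact key _ π rfl y hy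

theorem NR (π : MI F) {β : MK F} (h : mp (AdjoinRoot.of π.1) β = 0) : π.1.natDegree • β = 0 := by
  have hr : ∀ π' : MI F, π'.d.r (sy (cc π.1) * mp RatFunc.C β) = 0 := by
    intro π'
    rw [π'.d.r_sy_mul (cc_ne π.prime.ne_zero), (π'.const β).2, (π'.const β).1]
    by_cases he : π' = π
    · subst he; rw [h]; simp
    · rw [(π'.d_unit (π'.not_dvd π he)).1]; simp
  obtain ⟨y, hy⟩ := M1 hr
  have := congrArg (dinf F).r hy
  rw [(dinf F).r_sy_mul (cc_ne π.prime.ne_zero), (dinf_const β).2, (dinf_const β).1,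
    (dinf_const y).2, dinf_v π.prime.ne_zero, mul_zero, add_zero, neg_smul, neg_eq_zero] at this
  simpa using this

end Izh

namespace Izh
open Polynomial

theorem DVD.v_div {K κ : Type} [Field K] [Field κ] (d : DVD K κ) {x y : K} (hx : x ≠ 0) (hy : y ≠ 0) :
    d.v (x / y) = d.v x - d.v y := by
  have := d.v_mul (x / y) y (div_ne_zero hx hy) hy
  rw [div_mul_cancel₀ _ hy] at this
  omega

section
variable {K K' : Type} [Field K] [Field K'] (φ : K →+* K')

/-- Base change of rational functions. -/
noncomputable def rmap : RatFunc K →+* RatFunc K' :=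
  RatFunc.mapRingHom (Polynomial.mapRingHom φ) (by
    intro a ha
    rw [Submonoid.mem_comap]
    apply mem_nonZeroDivisors_of_ne_zero
    rw [coe_mapRingHom, Ne, Polynomial.map_eq_zero]
    exact nonZeroDivisors.ne_zero ha)

theorem rmap_cc (f : K[X]) : rmap φ (cc f) = cc (f.map φ) := by
  have := RatFunc.map_apply_div (R := K') (K := K) (Polynomial.mapRingHom φ) (by
    intro a ha
    rw [Submonoid.mem_comap]
    apply mem_nonZeroDivisors_of_ne_zero
    rw [coe_mapRingHom, Ne, Polynomial.map_eq_zero]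
    exact nonZeroDivisors.ne_zero ha) f 1
  simp only [map_one, div_one] at this
  exact this

theorem rmap_C (a : K) : rmap φ (RatFunc.C a) = RatFunc.C (φ a) := by
  rw [← cc_C, rmap_cc, Polynomial.map_C, cc_C]

variable {φ} in
theorem natural_poly {κ κ' : Type} [Field κ] [Field κ'] (d : DVD (RatFunc K) κ) (d' : DVD (RatFunc K') κ')
    (ψ : κ →+* κ') (e : ℤ) (h : κ') (hv : ∀ f : K[X], f ≠ 0 → d'.v (cc (f.map φ)) = e * d.v (cc f))
    (hh : h ≠ 0)
    (hl : ∀ f : K[X], f ≠ 0 → d'.l (cc (f.map φ)) = ψ (d.l (cc f)) * h ^ (d.v (cc f)))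
    (z : MK (RatFunc K)) :
    d'.s (mp (rmap φ) z) = mp ψ (d.s z) + sy h * mp ψ (d.r z) ∧
    d'.r (mp (rmap φ) z) = e • mp ψ (d.r z) := by
  refine d.natural d' (rmap φ) ψ e h ?_ hh ?_ z
  · intro x hx
    obtain ⟨a, b, hb, rfl⟩ := cc_rep x
    have ha : a ≠ 0 := by rintro rfl; simp at hx
    rw [map_div₀, rmap_cc, rmap_cc, d'.v_div, d.v_div (cc_ne ha) (cc_ne hb), hv a ha, hv b hb]
    · ring
    · exact cc_ne (by simpa using ha)
    · exact cc_ne (by simpa using hb)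
  · intro x hx
    obtain ⟨a, b, hb, rfl⟩ := cc_rep x
    have ha : a ≠ 0 := by rintro rfl; simp at hx
    rw [map_div₀, rmap_cc, rmap_cc, map_div₀, hl a ha, hl b hb, d.v_div (cc_ne ha) (cc_ne hb),
      map_div₀, map_div₀, zpow_sub₀ hh, div_mul_div_comm]

theorem natural_inf (z : MK (RatFunc K)) :
    (dinf K').r (mp (rmap φ) z) = mp φ ((dinf K).r z) := by
  have := (natural_poly (φ := φ) (dinf K) (dinf K') φ 1 1 (fun f hf => by
    rw [dinf_v hf, dinf_v (by simpa using hf), natDegree_map, one_mul]) one_ne_zero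
    (fun f hf => by rw [dinf_l, dinf_l, leadingCoeff_map]; simp) z).2
  rwa [one_smul] at this

theorem natural_place (q : MI K) (q' : MI K') (hdvd : q'.1 ∣ q.1.map φ) :
    ∃ (e : ℤ) (ψ : q.κ →+* q'.κ), (∀ f, ψ (AdjoinRoot.mk q.1 f) = AdjoinRoot.mk q'.1 (f.map φ)) ∧
      (∀ z, q'.d.r (mp (rmap φ) z) = e • mp ψ (q.d.r z)) ∧
      (∀ h, q.1.map φ = q'.1 * h → ¬ q'.1 ∣ h → e = 1) := by
  have h0 : q.1.map φ ≠ 0 := by simpa using q.prime.ne_zero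
  obtain ⟨e, h, he, hh⟩ := pex q'.1 q'.prime h0
  have hroot : q.1.eval₂ ((AdjoinRoot.of q'.1).comp φ) (AdjoinRoot.root q'.1) = 0 := by
    rw [← Polynomial.eval₂_map]
    have : (q.1.map φ).eval₂ (AdjoinRoot.of q'.1) (AdjoinRoot.root q'.1) =
        AdjoinRoot.mk q'.1 (q.1.map φ) := by
      rw [← AdjoinRoot.aeval_eq]; rfl
    rw [this]
    exact AdjoinRoot.mk_eq_zero.2 hdvd
  let ψ : q.κ →+* q'.κ := AdjoinRoot.lift ((AdjoinRoot.of q'.1).comp φ) (AdjoinRoot.root q'.1) hroot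
  have hψ : ∀ f, ψ (AdjoinRoot.mk q.1 f) = AdjoinRoot.mk q'.1 (f.map φ) := by
    intro f
    rw [AdjoinRoot.lift_mk, ← Polynomial.eval₂_map, ← AdjoinRoot.aeval_eq]; rfl
  have hcop : ∀ c : K[X], ¬ q.1 ∣ c → ¬ q'.1 ∣ c.map φ := by
    intro c hc hd
    have h1 : IsCoprime q.1 c := (q.2.2.coprime_iff_not_dvd).2 hc
    have h2 := h1.map (Polynomial.mapRingHom φ)
    exact q'.prime.not_unit (h2.isUnit_of_dvd' hdvd hd)
  have hh' : AdjoinRoot.mk q'.1 h ≠ 0 := by rwa [Ne, AdjoinRoot.mk_eq_zero]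
  have key : ∀ f : K[X], f ≠ 0 → q'.d.v (cc (f.map φ)) = e * q.d.v (cc f) ∧
      q'.d.l (cc (f.map φ)) = ψ (q.d.l (cc f)) * (AdjoinRoot.mk q'.1 h) ^ (q.d.v (cc f)) := by
    intro f hf
    obtain ⟨n, c, rfl, hc⟩ := pex q.1 q.prime hf
    have e1 := q.d_eq (n := n) hc
    have e2 : (q.1 ^ n * c).map φ = q'.1 ^ (e * n) * (h ^ n * c.map φ) := by
      rw [Polynomial.map_mul, Polynomial.map_pow, he]; ring
    have e3 := q'.d_eq (n := e * n) (c := h ^ n * c.map φ) (fun hd => by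
      rcases q'.prime.dvd_or_dvd hd with hd | hd
      · exact hh (q'.prime.dvd_of_dvd_pow hd)
      · exact hcop c hc hd)
    rw [e2, e3.1, e3.2, e1.1, e1.2, hψ, map_mul, map_pow, zpow_natCast]
    exact ⟨by push_cast; ring, mul_comm _ _⟩
  refine ⟨e, ψ, hψ, fun z => (natural_poly q.d q'.d ψ e (AdjoinRoot.mk q'.1 h)
    (fun f hf => (key f hf).1) hh' (fun f hf => (key f hf).2) z).2, ?_⟩
  intro h2 e2 hd2
  rw [he] at e2
  have := (puniq q'.1 q'.prime hh hd2 (n := e) (m := 1) (by rw [e2, pow_one])).1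
  rw [this]; rfl

end

/-- The place of a point. -/
noncomputable def ptMI {K : Type} [Field K] (θ : K) : MI K :=
  ⟨X - Polynomial.C θ, monic_X_sub_C θ, irreducible_X_sub_C θ⟩

theorem exists_below {K : Type} [Field K] (π : MI K) (q' : MI π.κ) :
    ∃ q : MI K, q'.1 ∣ q.1.map (AdjoinRoot.of π.1) := by
  haveI : Module.Finite K π.κ := (AdjoinRoot.powerBasis π.prime.ne_zero).finite
  haveI : Module.Finite π.κ q'.κ := (AdjoinRoot.powerBasis q'.prime.ne_zero).finite
  haveI : Module.Finite K q'.κ := Module.Finite.trans π.κ q'.κ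
  have hintg : IsIntegral K (AdjoinRoot.root q'.1) := Algebra.IsIntegral.isIntegral _
  refine ⟨⟨minpoly K (AdjoinRoot.root q'.1), minpoly.monic hintg, minpoly.irreducible hintg⟩, ?_⟩
  rw [← AdjoinRoot.mk_eq_zero, ← AdjoinRoot.aeval_eq]
  have := minpoly.aeval K (AdjoinRoot.root q'.1)
  rw [← this]
  have := Polynomial.aeval_map_algebraMap π.κ (AdjoinRoot.root q'.1) (minpoly K (AdjoinRoot.root q'.1))
  exact this

theorem descent {K : Type} [Field K] (π : MI K) (S : Finset π.κ) (g : π.κ → (π.κ →+* π.κ))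
    (hg1 : ∀ θ ∈ S, ∀ a, g θ (AdjoinRoot.of π.1 a) = AdjoinRoot.of π.1 a)
    (hg2 : ∀ θ ∈ S, g θ (AdjoinRoot.root π.1) = θ)
    (hS : π.1.map (AdjoinRoot.of π.1) = ∏ θ ∈ S, (X - Polynomial.C θ)) {n : ℕ} {x : MK π.κ}
    (hx : x ∈ dg π.κ n) :
    ∃ W ∈ dg K n, mp (AdjoinRoot.of π.1) W = ∑ θ ∈ S, mp (g θ) x := by
  classical
  obtain ⟨ζ, hζ, hζ1, hζ2⟩ := M2 π hx
  refine ⟨-(dinf K).r ζ, neg_mem ((dinf K).r_mem hζ), ?_⟩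
  set φ := AdjoinRoot.of π.1
  set ζ' := mp (rmap φ) ζ - ∑ θ ∈ S, sy (cc (ptMI θ).1) * mp RatFunc.C (mp (g θ) x) with hζ'
  have hres : ∀ q' : MI π.κ, q'.d.r ζ' = 0 := by
    intro q'
    obtain ⟨q, hq⟩ := exists_below π q'
    obtain ⟨e, ψ, h1, h2, h3⟩ := natural_place φ q q' hq
    have hsum : ∀ θ, q' ≠ ptMI θ → q'.d.r (sy (cc (ptMI θ).1) * mp RatFunc.C (mp (g θ) x)) = 0 := by
      intro θ hne
      rw [q'.d.r_sy_mul (cc_ne (ptMI θ).prime.ne_zero), (q'.const _).2,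
        (q'.d_unit (q'.not_dvd _ hne)).1]
      simp
    rw [hζ', map_sub, h2, map_sum]
    by_cases hqπ : q = π
    · subst hqπ
      rw [hS] at hq
      obtain ⟨θ, hθ, hdv⟩ := (q'.prime.dvd_finset_prod_iff _).1 hq
      have he : q' = ptMI θ := by
        by_contra hne
        exact q'.not_dvd (ptMI θ) hne hdv
      subst he
      have e1 : e = 1 := by
        apply h3 (∏ θ' ∈ S.erase θ, (X - Polynomial.C θ'))
        · rw [hS, ← Finset.mul_prod_erase _ _ hθ]; rfl
        · intro hd
          obtain ⟨θ', hθ', hdv'⟩ := ((ptMI θ).prime.dvd_finset_prod_iff _).1 hd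
          have := (ptMI θ).not_dvd (ptMI θ') (fun h => by
            have h5 := congrArg (fun t : MI q.κ => t.1.coeff 0) h
            simp [ptMI] at h5
            exact (Finset.mem_erase.1 hθ').1 h5.symm)
          exact this hdv'
      rw [e1, one_smul, hζ1, Finset.sum_eq_single θ]
      · rw [(ptMI θ).d.r_sy_mul (cc_ne (ptMI θ).prime.ne_zero), ((ptMI θ).const _).2,
          ((ptMI θ).const _).1, (ptMI θ).d_self.1, one_smul, mul_zero, add_zero, mp_mp, sub_eq_zero]
        apply mp_congr
        have hhom : ψ = (AdjoinRoot.of (ptMI θ).1).comp (g θ) := by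
          apply Ideal.Quotient.ringHom_ext
          apply Polynomial.ringHom_ext
          · intro a
            have e3 := h1 (Polynomial.C a)
            rw [Polynomial.map_C] at e3
            exact e3.trans (congrArg (AdjoinRoot.of (ptMI θ).1) (hg1 θ hθ a)).symm
          · have e3 := h1 Polynomial.X
            rw [Polynomial.map_X] at e3
            refine e3.trans ?_
            have e4 : AdjoinRoot.mk (ptMI θ).1 X = AdjoinRoot.mk (ptMI θ).1 (Polynomial.C θ) := by
              rw [AdjoinRoot.mk_eq_mk]; exact dvd_rfl
            rw [e4]
            exact (congrArg (AdjoinRoot.of (ptMI θ).1) (hg2 θ hθ)).symm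
        intro y
        rw [hhom, RingHom.comp_apply]
      · intro θ' _ hne
        apply hsum
        intro h
        have h5 := congrArg (fun t : MI q.κ => t.1.coeff 0) h
        simp [ptMI] at h5
        exact hne h5.symm
      · intro h; exact absurd hθ h
    · rw [hζ2 q hqπ, map_zero, smul_zero, zero_sub, neg_eq_zero]
      apply Finset.sum_eq_zero
      intro θ hθ
      apply hsum
      rintro rfl
      have hd2 : (ptMI θ).1 ∣ π.1.map φ := by
        rw [hS]; exact Finset.dvd_prod_of_mem (fun θ => X - Polynomial.C θ) hθ
      have h1 : IsCoprime q.1 π.1 := (q.2.2.coprime_iff_not_dvd).2 (q.not_dvd π hqπ)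
      have h2 := h1.map (Polynomial.mapRingHom φ)
      exact (ptMI θ).prime.not_unit (h2.isUnit_of_dvd' hq hd2)
  obtain ⟨γ, hγ⟩ := M1 hres
  have h4 := congrArg (dinf π.κ).r hγ
  rw [(dinf_const γ).2, hζ', map_sub, natural_inf, map_sum, sub_eq_zero] at h4
  rw [map_neg, h4, ← Finset.sum_neg_distrib]
  apply Finset.sum_congr rfl
  intro θ _
  rw [(dinf π.κ).r_sy_mul (cc_ne (ptMI θ).prime.ne_zero), (dinf_const _).2, (dinf_const _).1,
    dinf_v (ptMI θ).prime.ne_zero]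
  simp [ptMI]

end Izh

namespace Izh

section wedge
variable {ι : Type} {R : Type} [CommRing R]

/-- Left wedge with a covector. -/
def wg (lam : ι → R) : (List ι → R) → List ι → R
  | _, [] => 0
  | ω, i :: L => lam i * ω L - wg lam (fun J => ω (i :: J)) L

@[simp] theorem wg_nil (lam : ι → R) (ω : List ι → R) : wg lam ω [] = 0 := by simp [wg]
theorem wg_cons (lam : ι → R) (ω : List ι → R) (i : ι) (L : List ι) :
    wg lam ω (i :: L) = lam i * ω L - wg lam (fun J => ω (i :: J)) L := by rw [wg]

theorem wg_add (lam : ι → R) (ω η : List ι → R) : wg lam (ω + η) = wg lam ω + wg lam η := by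
  funext L
  induction L generalizing ω η with
  | nil => simp
  | cons i L ih =>
    have := ih (fun J => ω (i :: J)) (fun J => η (i :: J))
    simp only [Pi.add_apply, wg_cons] at this ⊢
    have e : (fun J => ω (i :: J) + η (i :: J)) = (fun J => ω (i :: J)) + fun J => η (i :: J) := rfl
    rw [e, this]; ring

theorem wg_add_left (lam mu : ι → R) (ω : List ι → R) :
    wg (lam + mu) ω = wg lam ω + wg mu ω := by
  funext L
  induction L generalizing ω with
  | nil => simp
  | cons i L ih =>
    have := ih (fun J => ω (i :: J))
    simp only [Pi.add_apply, wg_cons] at this ⊢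
    rw [this]; ring

theorem wg_smul (lam : ι → R) (c : R) (ω : List ι → R) : wg lam (c • ω) = c • wg lam ω := by
  funext L
  induction L generalizing ω with
  | nil => simp
  | cons i L ih =>
    have := ih (fun J => ω (i :: J))
    simp only [Pi.smul_apply, smul_eq_mul, wg_cons] at this ⊢
    have e : (fun J => c * ω (i :: J)) = c • (fun J => ω (i :: J)) := rfl
    rw [e, this]; ring

theorem wg_smul_left (lam : ι → R) (c : R) (ω : List ι → R) : wg (c • lam) ω = c • wg lam ω := by
  funext L
  induction L generalizing ω with
  | nil => simp
  | cons i L ih =>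
    have := ih (fun J => ω (i :: J))
    simp only [Pi.smul_apply, smul_eq_mul, wg_cons] at this ⊢
    rw [this]; ring

theorem wg_zero (lam : ι → R) : wg lam 0 = 0 := by
  have := wg_smul lam 0 0
  simpa using this

theorem wg_zero_left (ω : List ι → R) : wg (0 : ι → R) ω = 0 := by
  have := wg_smul_left (0 : ι → R) 0 ω
  simpa using this

theorem wg_neg (lam : ι → R) (ω : List ι → R) : wg lam (-ω) = - wg lam ω := by
  have := wg_smul lam (-1) ω
  simpa using this

theorem wg_sub (lam : ι → R) (ω η : List ι → R) : wg lam (ω - η) = wg lam ω - wg lam η := by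
  rw [sub_eq_add_neg, wg_add, wg_neg, sub_eq_add_neg]

theorem wg_wg_cons (lam mu : ι → R) (ω : List ι → R) (i : ι) (L : List ι) :
    wg lam (wg mu ω) (i :: L) = lam i * wg mu ω L - mu i * wg lam ω L +
      wg lam (wg mu (fun J => ω (i :: J))) L := by
  rw [wg_cons]
  have : (fun J => wg mu ω (i :: J)) = mu i • ω - wg mu (fun J => ω (i :: J)) := by
    funext J; rw [wg_cons]; rfl
  rw [this, wg_sub, wg_smul]
  simp only [Pi.sub_apply, Pi.smul_apply, smul_eq_mul]; ring

theorem wg_self (lam : ι → R) (ω : List ι → R) : wg lam (wg lam ω) = 0 := by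
  funext L
  induction L generalizing ω with
  | nil => simp
  | cons i L ih => rw [wg_wg_cons, ih]; simp

/-- Wedge as an endomorphism. -/
def wgE (lam : ι → R) : AddMonoid.End (List ι → R) where
  toFun := wg lam
  map_zero' := wg_zero lam
  map_add' := wg_add lam

/-- The vacuum. -/
def vac : List ι → R
  | [] => 1
  | _ :: _ => 0

/-- Alternating form. -/
def Alt (ω : List ι → R) : Prop := ∀ (A : List ι) (i j : ι) (B : List ι),
  ω (A ++ i :: j :: B) = - ω (A ++ j :: i :: B) ∧ ω (A ++ i :: i :: B) = 0

theorem Alt.cons {ω : List ι → R} (h : Alt ω) (i : ι) : Alt (fun J => ω (i :: J)) :=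
  fun A => h (i :: A)

theorem Alt.wg {ω : List ι → R} (h : Alt ω) (lam : ι → R) : Alt (wg lam ω) := by
  intro A i j B
  induction A generalizing ω with
  | nil =>
    have h1 : (fun J => ω (i :: j :: J)) = - (fun J => ω (j :: i :: J)) := by
      funext J; exact (h [] i j J).1
    have h2 : (fun J => ω (i :: i :: J)) = 0 := by
      funext J; exact (h [] i j J).2
    simp only [List.nil_append, wg_cons]
    rw [h1, h2, wg_neg, wg_zero]
    simp only [Pi.neg_apply, Pi.zero_apply]
    constructor <;> ring
  | cons a A ih =>
    have := ih (h.cons a)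
    simp only [List.cons_append, wg_cons]
    rw [this.1, this.2, (h A i j B).1, (h A i j B).2]
    constructor <;> ring

theorem Alt.vac : Alt (vac : List ι → R) := by
  intro A i j B
  cases A <;> simp [Izh.vac]

theorem Alt.perm {L L' : List ι} (hp : L.Perm L') {ω : List ι → R} (h : Alt ω) :
    ω L = ω L' ∨ ω L = - ω L' := by
  induction hp generalizing ω with
  | nil => exact Or.inl rfl
  | cons x _ ih => exact ih (h.cons x)
  | swap x y l => exact Or.inr (h [] y x l).1
  | trans _ _ h1 h2 =>
    rcases h1 h with e1 | e1 <;> rcases h2 h with e2 | e2 <;> rw [e1, e2] <;> simp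

theorem Alt.zero_of_perm {L L' : List ι} (hp : L.Perm L') {ω : List ι → R} (h : Alt ω)
    (h0 : ω L' = 0) : ω L = 0 := by
  rcases h.perm hp with e | e <;> rw [e, h0]; simp

theorem Alt.zero_of_dup {L : List ι} (hd : ¬ L.Nodup) {ω : List ι → R} (h : Alt ω) : ω L = 0 := by
  obtain ⟨i, hi⟩ := List.exists_duplicate_iff_not_nodup.2 hd
  have hs := List.duplicate_iff_sublist.1 hi
  obtain ⟨l, hl⟩ := hs.exists_perm_append
  exact h.zero_of_perm hl (h [] i i l).2

/-- Wedge respects a subring relation. -/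
theorem wg_rel {R' : Type} [CommRing R'] (Γ : Subring (R × R')) (lam : ι → R) (lam' : ι → R')
    (hl : ∀ i, (lam i, lam' i) ∈ Γ) (ω : List ι → R) (ω' : List ι → R')
    (h : ∀ L, (ω L, ω' L) ∈ Γ) (L : List ι) : (wg lam ω L, wg lam' ω' L) ∈ Γ := by
  induction L generalizing ω ω' with
  | nil => simp only [wg_nil]; exact Γ.zero_mem
  | cons i L ih =>
    simp only [wg_cons]
    exact Γ.sub_mem (Γ.mul_mem (hl i) (h L)) (ih _ _ (fun J => h (i :: J)))

end wedge

section forms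
variable {K : Type} [Field K] {ι : Type} (D : ι → Derivation ℤ K K)

/-- Logarithmic derivative covector. -/
noncomputable def dl (x : K) : ι → K := fun i => D i x / x

theorem dl_mul {x y : K} (hx : x ≠ 0) (hy : y ≠ 0) : dl D (x * y) = dl D x + dl D y := by
  funext i
  simp only [dl, Pi.add_apply, Derivation.leibniz, smul_eq_mul]
  field_simp; ring

/-- Forms representation. -/
noncomputable def fmE : MK K →+* AddMonoid.End (List ι → K) :=
  lift (fun x => wgE (dl D x))
    (by
      ext ω L
      have : dl D (0 : K) = 0 := by funext i; simp [dl]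
      change wg (dl D 0) ω L = 0
      rw [this, wg_zero_left]; rfl)
    (by
      intro x y hx hy
      ext ω L
      change wg (dl D (x * y)) ω L = wg (dl D x) ω L + wg (dl D y) ω L
      rw [dl_mul D hx hy, wg_add_left]; rfl)
    (by
      intro x y hx hy h
      ext ω L
      change wg (dl D x) (wg (dl D y) ω) L = 0
      have : dl D y = (-(x / y)) • dl D x := by
        funext i
        have h1 : y = 1 - x := by rw [← h]; ring
        have h2 : D i y = - D i x := by rw [h1, map_sub, Derivation.map_one_eq_zero, zero_sub]
        simp only [dl, Pi.smul_apply, smul_eq_mul, h2]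
        field_simp
      rw [this, wg_smul_left, wg_smul, wg_self]
      simp)

/-- The form of an element. -/
noncomputable def fm (z : MK K) : List ι → K := fmE D z vac

theorem fm_one : fm D (1 : MK K) = vac := by simp [fm]
theorem fm_zero : fm D (0 : MK K) = 0 := by simp [fm]
theorem fm_add (a b : MK K) : fm D (a + b) = fm D a + fm D b := by
  rw [fm, map_add]; rfl
theorem fm_neg (a : MK K) : fm D (-a) = - fm D a := by
  have := fm_add D a (-a)
  rw [add_neg_cancel, fm_zero] at this
  exact (neg_eq_of_add_eq_zero_right this.symm).symm
theorem fm_sub (a b : MK K) : fm D (a - b) = fm D a - fm D b := by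
  rw [sub_eq_add_neg, fm_add, fm_neg, sub_eq_add_neg]
theorem fm_nsmul (n : ℕ) (a : MK K) : fm D (n • a) = n • fm D a := by
  induction n with
  | zero => simp [fm_zero]
  | succ n ih => rw [succ_nsmul, succ_nsmul, fm_add, ih]
theorem fm_zsmul (n : ℤ) (a : MK K) : fm D (n • a) = n • fm D a := by
  cases n with
  | ofNat n => simpa using fm_nsmul D n a
  | negSucc n => rw [negSucc_zsmul, negSucc_zsmul, fm_neg, fm_nsmul]
theorem fm_sy_mul (x : K) (a : MK K) : fm D (sy x * a) = wg (dl D x) (fm D a) := by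
  have h : fmE D (sy x) = wgE (dl D x) := by rw [fmE, lift_sy]
  rw [fm, map_mul, h]; rfl

theorem fm_alt (z : MK K) : Alt (fm D z) := by
  induction z using MK.induction with
  | h1 => rw [fm_one]; exact Alt.vac
  | ha a b h1 h2 =>
    rw [fm_add]
    intro A i j B
    simp only [Pi.add_apply, (h1 A i j B).1, (h2 A i j B).1, (h1 A i j B).2, (h2 A i j B).2]
    constructor <;> ring
  | hn a h =>
    rw [fm_neg]
    intro A i j B
    simp only [Pi.neg_apply, (h A i j B).2, neg_zero, and_true]
    rw [(h A i j B).1]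
  | hm x a h => rw [fm_sy_mul]; exact h.wg _

theorem wg_supp {n : ℕ} {R : Type} [CommRing R] {ω : List ι → R} (h : ∀ L, L.length ≠ n → ω L = 0) (lam : ι → R)
    (L : List ι) (hL : L.length ≠ n + 1) : wg lam ω L = 0 := by
  induction L generalizing ω n with
  | nil => simp
  | cons i L ih =>
    rw [List.length_cons] at hL
    have hn : L.length ≠ n := by omega
    rw [wg_cons, h L hn]
    cases n with
    | zero =>
      have : (fun J => ω (i :: J)) = 0 := by funext J; exact h _ (by simp)
      rw [this, wg_zero]; simp
    | succ n =>
      rw [ih (n := n) (fun J hJ => h _ (by simpa using hJ)) hn]; simp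

theorem fm_supp {n : ℕ} {z : MK K} (hz : z ∈ dg K n) : ∀ L, L.length ≠ n → fm D z L = 0 := by
  refine dg_rec (P := fun n z => ∀ L : List ι, L.length ≠ n → fm D z L = 0) ?_ ?_ ?_ ?_ ?_ hz
  · intro L hL
    rw [fm_one]
    cases L with
    | nil => simp at hL
    | cons => rfl
  · intro n L _; rw [fm_zero]; rfl
  · intro n a b h1 h2 L hL; rw [fm_add, Pi.add_apply, h1 L hL, h2 L hL, add_zero]
  · intro n a h1 L hL; rw [fm_neg, Pi.neg_apply, h1 L hL, neg_zero]
  · intro n x a _ h L hL; rw [fm_sy_mul]; exact wg_supp h _ L hL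

theorem fm_rel {K' : Type} [Field K'] (D' : ι → Derivation ℤ K' K') (Γ : Subring (K × K'))
    (f : MK K →+* MK K') (l : K → K') (hf : ∀ x, f (sy x) = sy (l x))
    (hl : ∀ x i, x ≠ 0 → (dl D x i, dl D' (l x) i) ∈ Γ) (z : MK K) (L : List ι) :
    (fm D z L, fm D' (f z) L) ∈ Γ := by
  induction z using MK.induction generalizing L with
  | h1 =>
    rw [map_one, fm_one, fm_one]
    cases L with
    | nil => exact Γ.one_mem
    | cons => exact Γ.zero_mem
  | ha a b h1 h2 => rw [map_add, fm_add, fm_add]; exact Γ.add_mem (h1 L) (h2 L)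
  | hn a h => rw [map_neg, fm_neg, fm_neg]; exact Γ.neg_mem (h L)
  | hm x a h =>
    by_cases hx : x = 0
    · rw [hx, sy_zero, zero_mul, map_zero, fm_zero, fm_zero]; exact Γ.zero_mem
    rw [map_mul, hf, fm_sy_mul, fm_sy_mul]
    exact wg_rel Γ _ _ (fun i => hl x i hx) _ _ h L

end forms

section subst
variable {R R' : Type} [CommRing R] [CommRing R'] {ι ι' : Type} [Fintype ι] (ψ : R →+* R')
  (c : ι' → ι → R')

/-- Substitution. -/
def tsub : (List ι → R) → List ι' → R'
  | ω, [] => ψ (ω [])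
  | ω, k :: L => ∑ i, c k i * tsub (fun J => ω (i :: J)) L

theorem tsub_nil (ω : List ι → R) : tsub ψ c ω [] = ψ (ω []) := by simp [tsub]
theorem tsub_cons (ω : List ι → R) (k : ι') (L : List ι') :
    tsub ψ c ω (k :: L) = ∑ i, c k i * tsub ψ c (fun J => ω (i :: J)) L := by rw [tsub]

theorem tsub_lin (a b : R) (ω η : List ι → R) (L : List ι') :
    tsub ψ c (a • ω + b • η) L = ψ a * tsub ψ c ω L + ψ b * tsub ψ c η L := by
  induction L generalizing ω η with
  | nil => simp [tsub_nil]
  | cons k L ih =>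
    simp only [tsub_cons, Finset.mul_sum, ← Finset.sum_add_distrib]
    apply Finset.sum_congr rfl
    intro i _
    have := ih (fun J => ω (i :: J)) (fun J => η (i :: J))
    have e : (fun J => (a • ω + b • η) (i :: J)) = a • (fun J => ω (i :: J)) + b • fun J => η (i :: J) := rfl
    rw [e, this]; ring

theorem tsub_zero : tsub ψ c (0 : List ι → R) = 0 := by
  funext L
  have := tsub_lin ψ c 0 0 0 0 L
  simpa using this

theorem tsub_wg (lam : ι → R) (lam' : ι' → R') (h : ∀ k, lam' k = ∑ i, c k i * ψ (lam i))
    (ω : List ι → R) : tsub ψ c (wg lam ω) = wg lam' (tsub ψ c ω) := by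
  funext L
  induction L generalizing ω with
  | nil => simp [tsub_nil]
  | cons k L ih =>
    rw [tsub_cons, wg_cons]
    have e0 : (fun J => tsub ψ c ω (k :: J)) = fun J => ∑ i, c k i * tsub ψ c (fun J => ω (i :: J)) J := by
      funext J; rw [tsub_cons]
    have wsum : ∀ (s : Finset ι), wg lam' (fun J => ∑ i ∈ s, c k i * tsub ψ c (fun J => ω (i :: J)) J) L =
        ∑ i ∈ s, c k i * wg lam' (tsub ψ c (fun J => ω (i :: J))) L := by
      classical
      intro s
      induction s using Finset.induction_on with
      | empty =>
        simp only [Finset.sum_empty]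
        exact congrFun (wg_zero lam') L
      | insert a s ha ih2 =>
        simp only [Finset.sum_insert ha]
        rw [← ih2]
        have e : (fun J => c k a * tsub ψ c (fun J => ω (a :: J)) J + ∑ i ∈ s, c k i * tsub ψ c (fun J => ω (i :: J)) J) =
          c k a • tsub ψ c (fun J => ω (a :: J)) + fun J => ∑ i ∈ s, c k i * tsub ψ c (fun J => ω (i :: J)) J := rfl
        rw [e, wg_add, wg_smul]; rfl
    rw [e0, wsum, h k, Finset.sum_mul, ← Finset.sum_sub_distrib]
    apply Finset.sum_congr rfl
    intro i _
    have e : (fun J => wg lam ω (i :: J)) = lam i • ω + (-1 : R) • wg lam (fun J => ω (i :: J)) := by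
      funext J; rw [wg_cons]; simp [sub_eq_add_neg]
    rw [e, tsub_lin, ih]
    simp; ring

theorem tsub_add (ω η : List ι → R) : tsub ψ c (ω + η) = tsub ψ c ω + tsub ψ c η := by
  funext L
  have := tsub_lin ψ c 1 1 ω η L
  simpa using this
theorem tsub_neg (ω : List ι → R) : tsub ψ c (-ω) = - tsub ψ c ω := by
  funext L
  have := tsub_lin ψ c (-1) 0 ω 0 L
  simpa using this

end subst

theorem fm_tsub {K K' : Type} [Field K] [Field K'] {ι ι' : Type} [Fintype ι] (ψ : K →+* K')
    (D : ι → Derivation ℤ K K) (D' : ι' → Derivation ℤ K' K') (c : ι' → ι → K')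
    (h : ∀ k x, D' k (ψ x) = ∑ i, c k i * ψ (D i x)) (z : MK K) :
    fm D' (mp ψ z) = tsub ψ c (fm D z) := by
  induction z using MK.induction with
  | h1 =>
    rw [map_one, fm_one, fm_one]
    funext L
    cases L with
    | nil => simp [tsub_nil, vac]
    | cons k L =>
      rw [tsub_cons]
      symm
      apply Finset.sum_eq_zero
      intro i _
      have : (fun J => (vac (i :: J) : K)) = 0 := rfl
      rw [this, tsub_zero]; simp
  | ha a b h1 h2 => rw [map_add, fm_add, fm_add, tsub_add, h1, h2]
  | hn a h => rw [map_neg, fm_neg, fm_neg, tsub_neg, h]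
  | hm x a ih =>
    rw [map_mul, mp_sy, fm_sy_mul, fm_sy_mul, ih, tsub_wg ψ c (dl D x) (dl D' (ψ x))]
    intro k
    simp only [dl, h, map_div₀, Finset.sum_div, mul_div_assoc]

/-- All forms vanish. -/
def InI {K : Type} [Field K] (z : MK K) : Prop := fm (id : Derivation ℤ K K → Derivation ℤ K K) z = 0

theorem fm_reindex {K : Type} [Field K] {ι ι' : Type} (D : ι → Derivation ℤ K K) (f : ι' → ι) (z : MK K)
    (L : List ι') : fm (D ∘ f) z L = fm D z (L.map f) := by
  have key : ∀ (lam : ι → K) (ω : List ι → K) (L : List ι'),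
      wg (lam ∘ f) (fun J => ω (J.map f)) L = wg lam ω (L.map f) := by
    intro lam ω L
    induction L generalizing ω with
    | nil => simp
    | cons i L ih =>
      rw [wg_cons, List.map_cons, wg_cons, ← ih]; rfl
  induction z using MK.induction generalizing L with
  | h1 => rw [fm_one, fm_one]; cases L <;> rfl
  | ha a b h1 h2 => rw [fm_add, fm_add, Pi.add_apply, Pi.add_apply, h1, h2]
  | hn a h => rw [fm_neg, fm_neg, Pi.neg_apply, Pi.neg_apply, h]
  | hm x a h =>
    rw [fm_sy_mul, fm_sy_mul, ← key]
    have : fm (D ∘ f) a = fun J => fm D a (J.map f) := by funext J; exact h J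
    rw [this]; rfl

theorem InI.fm {K : Type} [Field K] {z : MK K} (h : InI z) {ι : Type} (D : ι → Derivation ℤ K K) :
    fm D z = 0 := by
  funext L
  have := fm_reindex (id : Derivation ℤ K K → Derivation ℤ K K) D z L
  rw [h] at this
  exact this

end Izh

namespace Izh

section ext
variable {K : Type} [Field K] {ι : Type} (D : ι → Derivation ℤ K K)

/-- Exterior derivative on list forms. -/
def dx : (List ι → K) → List ι → K
  | _, [] => 0
  | ω, i :: L => D i (ω L) - dx (fun J => ω (i :: J)) L

@[simp] theorem dx_nil (ω : List ι → K) : dx D ω [] = 0 := by simp [dx]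
theorem dx_cons (ω : List ι → K) (i : ι) (L : List ι) :
    dx D ω (i :: L) = D i (ω L) - dx D (fun J => ω (i :: J)) L := by rw [dx]

theorem dx_add (ω η : List ι → K) : dx D (ω + η) = dx D ω + dx D η := by
  funext L
  induction L generalizing ω η with
  | nil => simp
  | cons i L ih =>
    have := ih (fun J => ω (i :: J)) (fun J => η (i :: J))
    simp only [Pi.add_apply, dx_cons] at this ⊢
    have e : (fun J => ω (i :: J) + η (i :: J)) = (fun J => ω (i :: J)) + fun J => η (i :: J) := rfl
    rw [e, this, map_add]; ring

theorem dx_neg (ω : List ι → K) : dx D (-ω) = - dx D ω := by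
  funext L
  induction L generalizing ω with
  | nil => simp
  | cons i L ih =>
    have := ih (fun J => ω (i :: J))
    simp only [Pi.neg_apply, dx_cons] at this ⊢
    have e : (fun J => -ω (i :: J)) = -(fun J => ω (i :: J)) := rfl
    rw [e, this, map_neg]; ring

theorem dx_sub (ω η : List ι → K) : dx D (ω - η) = dx D ω - dx D η := by
  rw [sub_eq_add_neg, dx_add, dx_neg, ← sub_eq_add_neg]

theorem dx_smul (f : K) (ω : List ι → K) :
    dx D (f • ω) = wg (fun i => D i f) ω + f • dx D ω := by
  funext L
  induction L generalizing ω with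
  | nil => simp
  | cons i L ih =>
    have := ih (fun J => ω (i :: J))
    simp only [Pi.add_apply, Pi.smul_apply, smul_eq_mul, dx_cons, wg_cons] at this ⊢
    have e : (fun J => f * ω (i :: J)) = f • (fun J => ω (i :: J)) := rfl
    rw [e, this, Derivation.leibniz]; simp only [smul_eq_mul]; ring

theorem D_wg (d : Derivation ℤ K K) (lam : ι → K) (ω : List ι → K) (L : List ι) :
    d (wg lam ω L) = wg (fun i => d (lam i)) ω L + wg lam (fun J => d (ω J)) L := by
  induction L generalizing ω with
  | nil => simp
  | cons i L ih =>
    simp only [wg_cons, map_sub, Derivation.leibniz, smul_eq_mul, ih]; ring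

theorem dx_wg (lam : ι → K) (hl : ∀ i j, D i (lam j) = D j (lam i)) (ω : List ι → K) :
    dx D (wg lam ω) = - wg lam (dx D ω) := by
  funext L
  induction L generalizing ω with
  | nil => simp
  | cons i L ih =>
    have h1 : (fun J => wg lam ω (i :: J)) = lam i • ω - wg lam (fun J => ω (i :: J)) := by
      funext J; rw [wg_cons]; rfl
    have h2 : (fun J => dx D ω (i :: J)) = (fun J => D i (ω J)) - dx D (fun J => ω (i :: J)) := by
      funext J; rw [dx_cons]; rfl
    rw [dx_cons, h1, dx_sub, dx_smul, Pi.neg_apply, wg_cons, h2, wg_sub, D_wg]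
    have h3 : (fun j => D j (lam i)) = fun j => D i (lam j) := by funext j; exact hl j i
    simp only [Pi.sub_apply, Pi.add_apply, Pi.smul_apply, smul_eq_mul, ih, h3, Pi.neg_apply]
    ring

theorem dx_const (ω : List ι → K) (h : ∀ i L, D i (ω L) = 0) : dx D ω = 0 := by
  funext L
  induction L generalizing ω with
  | nil => simp
  | cons i L ih =>
    rw [dx_cons, h, ih _ (fun j J => h j (i :: J))]; simp

theorem dl_closed (hc : ∀ i j x, D i (D j x) = D j (D i x)) (x : K) (i j : ι) :
    D i (dl D x j) = D j (dl D x i) := by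
  by_cases hx : x = 0
  · simp [dl, hx]
  simp only [dl, Derivation.leibniz_div, smul_eq_mul, hc i j]
  field_simp

theorem fm_closed (hc : ∀ i j x, D i (D j x) = D j (D i x)) (z : MK K) : dx D (fm D z) = 0 := by
  induction z using MK.induction with
  | h1 =>
    rw [fm_one]; apply dx_const
    intro i L; cases L <;> simp [vac]
  | ha a b h1 h2 => rw [fm_add, dx_add, h1, h2, add_zero]
  | hn a h => rw [fm_neg, dx_neg, h, neg_zero]
  | hm x a h =>
    rw [fm_sy_mul, dx_wg D _ (dl_closed D hc x), h, wg_zero, neg_zero]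

/-- Additive span of images of the derivations indexed by `S`. -/
def Im (S : Set ι) : AddSubgroup K := AddSubgroup.closure {y | ∃ i ∈ S, ∃ x, y = D i x}

variable {D}
theorem Im_mem {S : Set ι} {i : ι} (hi : i ∈ S) (x : K) : D i x ∈ Im D S :=
  AddSubgroup.subset_closure ⟨i, hi, x, rfl⟩

theorem Im_mono {S T : Set ι} (h : S ⊆ T) : Im D S ≤ Im D T := by
  apply AddSubgroup.closure_mono
  rintro y ⟨i, hi, x, rfl⟩
  exact ⟨i, h hi, x, rfl⟩

theorem Im_ind {S : Set ι} {K' : Type} [AddCommGroup K'] (f : K →+ K') (H : AddSubgroup K')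
    (h : ∀ i ∈ S, ∀ x, f (D i x) ∈ H) {y : K} (hy : y ∈ Im D S) : f y ∈ H := by
  have : Im D S ≤ H.comap f := by
    rw [Im, AddSubgroup.closure_le]
    rintro y ⟨i, hi, x, rfl⟩
    exact h i hi x
  exact this hy

theorem dx_mem_Im (ω : List ι → K) (L : List ι) (S : Set ι)
    (h : ∀ A k B, L = A ++ k :: B → k ∈ S ∨ ω (A ++ B) = 0) : dx D ω L ∈ Im D S := by
  induction L generalizing ω with
  | nil => rw [dx_nil]; exact zero_mem _
  | cons i L ih =>
    rw [dx_cons]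
    apply sub_mem
    · rcases h [] i L rfl with h1 | h1
      · exact Im_mem h1 _
      · simp only [List.nil_append] at h1
        rw [h1, map_zero]; exact zero_mem _
    · apply ih
      intro A k B e
      exact h (i :: A) k B (by rw [e]; rfl)

end ext

/-- p-basis derivations. -/
structure PD (p m : ℕ) (K : Type) [Field K] where
  D : Fin m → Derivation ℤ K K
  comm : ∀ i j x, D i (D j x) = D j (D i x)
  pow : ∀ i x, (D i)^[p] x = D i x
  b : Fin m → K
  b_ne : ∀ i, b i ≠ 0
  D_b : ∀ i j, D i (b j) = if i = j then b j else 0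

section jac
variable {K : Type} [Field K] {p : ℕ} [Fact p.Prime]

theorem D_frob [CharP K p] (d : Derivation ℤ K K) (x : K) : d (x ^ p) = 0 := by
  rw [Derivation.leibniz_pow]; simp

theorem D_mul_const (d : Derivation ℤ K K) {c : K} (hc : d c = 0) (x : K) : d (c * x) = c * d x := by
  simp [Derivation.leibniz, hc]

theorem D_pow_const (d : Derivation ℤ K K) {c : K} (hc : d c = 0) (n : ℕ) (x : K) :
    d^[n] (c * x) = c * d^[n] x := by
  induction n generalizing x with
  | zero => rfl
  | succ n ih => rw [Function.iterate_succ_apply, D_mul_const d hc, ih, ← Function.iterate_succ_apply]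

/-- ad of p-th power. -/
theorem ad_pow {A : Type} [Ring A] [CharP A p] (Q f : A) (g : ℕ → A) (h0 : g 0 = f)
    (hs : ∀ n, Q * g n - g n * Q = g (n + 1)) : Q ^ p * f - f * Q ^ p = g p := by
  haveI : Nontrivial A := CharP.nontrivial_of_char_ne_one (Fact.out : p.Prime).ne_one
  have hlr : Commute (LinearMap.mulLeft ℤ Q) (LinearMap.mulRight ℤ Q) :=
    LinearMap.commute_mulLeft_right Q Q
  have hB : ((p : ℕ) : Module.End ℤ A) = 0 := by
    ext x
    rw [Module.End.natCast_apply]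
    simp
  haveI : CharP (Module.End ℤ A) p :=
    (CharP.charP_iff_prime_eq_zero (Fact.out : p.Prime)).2 hB
  have key := sub_pow_expChar_of_commute (p := p) hlr
  have h2 : ∀ n, ((LinearMap.mulLeft ℤ Q - LinearMap.mulRight ℤ Q) ^ n) f = g n := by
    intro n
    induction n with
    | zero => rw [h0]; rfl
    | succ n ih =>
      rw [pow_succ', Module.End.mul_apply, ih]
      exact hs n
  have h3 := h2 p
  rw [key] at h3
  rw [← h3, LinearMap.pow_mulLeft, LinearMap.pow_mulRight]
  rfl

end jac
end Izh

namespace Izh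
open Polynomial

/-- Derivations of a ring, with uniform instances. -/
abbrev Der (A : Type) [CommRing A] := Derivation ℤ A A

/-- Build a derivation from an additive Leibniz map. -/
def mkDer {A : Type} [CommRing A] (f : A →+ A) (h : ∀ a b, f (a * b) = a * f b + b * f a) : Der A :=
  Derivation.mk' f.toIntLinearMap h

@[simp] theorem mkDer_apply {A : Type} [CommRing A] (f : A →+ A)
    (h : ∀ a b, f (a * b) = a * f b + b * f a) (x : A) : mkDer f h x = f x := rfl

/-- Coefficientwise map. -/
noncomputable def pcoF {A : Type} [CommRing A] (d : Der A) (f : A[X]) : A[X] :=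
  ∑ i ∈ f.support, monomial i (d (f.coeff i))

theorem pcoF_coeff {A : Type} [CommRing A] (d : Der A) (f : A[X]) (i : ℕ) :
    (pcoF d f).coeff i = d (f.coeff i) := by
  rw [pcoF, finsetSum_coeff]
  simp only [coeff_monomial]
  rw [Finset.sum_ite_eq']
  split_ifs with h
  · rfl
  · rw [notMem_support_iff.1 h, map_zero]

/-- Coefficientwise derivation. -/
noncomputable def pco {A : Type} [CommRing A] (d : Der A) : Der A[X] :=
  mkDer (AddMonoidHom.mk' (pcoF d) (fun a b => by
      ext i; rw [coeff_add, pcoF_coeff, pcoF_coeff, pcoF_coeff, coeff_add, map_add]))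
    (fun a b => by
      ext i
      simp only [AddMonoidHom.mk'_apply]
      rw [pcoF_coeff, coeff_mul, coeff_add, coeff_mul, mul_comm b, coeff_mul, map_sum,
        ← Finset.sum_add_distrib]
      apply Finset.sum_congr rfl
      intro x _
      rw [Derivation.leibniz, pcoF_coeff, pcoF_coeff]
      simp [mul_comm])

theorem pco_coeff {A : Type} [CommRing A] (d : Der A) (f : A[X]) (i : ℕ) :
    (pco d f).coeff i = d (f.coeff i) := pcoF_coeff d f i

theorem pco_C {A : Type} [CommRing A] (d : Der A) (a : A) :
    pco d (C a) = C (d a) := by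
  ext i; rw [pco_coeff, coeff_C, coeff_C]; split_ifs <;> simp

theorem pco_X {A : Type} [CommRing A] (d : Der A) :
    pco d (X : A[X]) = 0 := by
  ext i; rw [pco_coeff, coeff_X]; split_ifs <;> simp

theorem pco_derivative {A : Type} [CommRing A] (d : Der A) (f : A[X]) :
    pco d (derivative f) = derivative (pco d f) := by
  ext i
  rw [pco_coeff, coeff_derivative, coeff_derivative, pco_coeff, Derivation.leibniz]
  have : d ((i : A) + 1) = 0 := by
    have := d.map_natCast (i + 1)
    push_cast at this
    exact this
  rw [this]; simp [mul_comm]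

section jac
variable {K : Type} [Field K] {p : ℕ} [hp : Fact p.Prime] [CharP K p]

theorem charP_end (A : Type) [Field A] [CharP A p] : CharP (Module.End ℤ A) p := by
  apply (CharP.charP_iff_prime_eq_zero (Fact.out : p.Prime)).2
  ext x
  rw [Module.End.natCast_apply]
  simp

theorem charP_end_poly : CharP (Module.End ℤ K[X]) p := by
  apply (CharP.charP_iff_prime_eq_zero (Fact.out : p.Prime)).2
  ext x
  rw [Module.End.natCast_apply]
  simp

/-- `d + c` as an operator. -/
noncomputable def opc {A : Type} [CommRing A] (d : Der A) (c : A) : Module.End ℤ A :=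
  (d : A →ₗ[ℤ] A) + LinearMap.mulLeft ℤ c

theorem opc_apply {A : Type} [CommRing A] (d : Der A) (c x : A) :
    opc d c x = d x + c * x := rfl

theorem opc_ad {A : Type} [CommRing A] (d : Der A) (c f : A) :
    opc d c * LinearMap.mulLeft ℤ f - LinearMap.mulLeft ℤ f * opc d c = LinearMap.mulLeft ℤ (d f) := by
  apply LinearMap.ext
  intro x
  simp only [LinearMap.sub_apply, Module.End.mul_apply, LinearMap.mulLeft_apply, opc_apply,
    Derivation.leibniz, smul_eq_mul]
  ring

theorem jac_poly (d : Der K) (c : K) :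
    derivative ((opc (pco d) (C c * X) ^ p) 1) = C (d^[p - 1] c) := by
  haveI := charP_end_poly (K := K) (p := p)
  let E : Module.End ℤ K[X] := (derivative : K[X] →ₗ[K] K[X]).restrictScalars ℤ
  have hE : ∀ f, E f = derivative f := fun f => rfl
  let g : ℕ → Module.End ℤ K[X] := fun n => match n with
    | 0 => E
    | n + 1 => - LinearMap.mulLeft ℤ (C (d^[n] c))
  have key := ad_pow (p := p) (opc (pco d) (C c * X)) E g rfl (by
    intro n
    cases n with
    | zero =>
      apply LinearMap.ext
      intro f
      simp only [g, LinearMap.sub_apply, Module.End.mul_apply, LinearMap.mulLeft_apply, opc_apply,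
        hE, LinearMap.neg_apply, derivative_add, derivative_mul, derivative_C, derivative_X,
        pco_derivative, Function.iterate_zero, id]
      ring
    | succ n =>
      simp only [g]
      rw [mul_neg, neg_mul, ← neg_sub', opc_ad, pco_C, ← Function.iterate_succ_apply' (f := d)])
  obtain ⟨q, hq⟩ : ∃ q, p = q + 1 := ⟨p - 1, by have := hp.out.pos; omega⟩
  have h1 : g p = - LinearMap.mulLeft ℤ (C (d^[p - 1] c)) := by
    have : ∀ n, n = q + 1 → g n = - LinearMap.mulLeft ℤ (C (d^[n - 1] c)) := by
      rintro n rfl; rfl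
    exact this p hq
  rw [h1] at key
  have := congrArg (fun T => T (1 : K[X])) key
  simp only [LinearMap.sub_apply, Module.End.mul_apply, hE, LinearMap.neg_apply,
    LinearMap.mulLeft_apply, derivative_one, map_zero, zero_sub, mul_one] at this
  exact neg_injective this

theorem jac_one (d : Der K) (c : K) : (opc d c ^ p) 1 = d^[p - 1] c + c ^ p := by
  have hp2 := hp.out.two_le
  set q : ℕ → K[X] := fun n => (opc (pco d) (C c * X) ^ n) 1 with hq
  have q0 : q 0 = 1 := rfl
  have qs : ∀ n, q (n + 1) = pco d (q n) + X * (C c * q n) := by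
    intro n
    simp only [hq]
    rw [pow_succ', Module.End.mul_apply, opc_apply]; ring
  have c0 : ∀ n, (q (n + 1)).coeff 0 = 0 := by
    intro n
    induction n with
    | zero => rw [qs, coeff_add, pco_coeff, coeff_X_mul_zero, q0]; simp
    | succ n ih => rw [qs, coeff_add, pco_coeff, coeff_X_mul_zero, ih]; simp
  have ct : ∀ n, (q n).coeff n = c ^ n ∧ ∀ k > n, (q n).coeff k = 0 := by
    intro n
    induction n with
    | zero =>
      rw [q0]
      refine ⟨by simp, fun k hk => ?_⟩
      rw [coeff_one, if_neg (by omega)]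
    | succ n ih =>
      have : ∀ k, (q (n + 1)).coeff (k + 1) = d ((q n).coeff (k + 1)) + c * (q n).coeff k := by
        intro k
        rw [qs, coeff_add, pco_coeff, coeff_X_mul, coeff_C_mul]
      refine ⟨?_, fun k hk => ?_⟩
      · rw [this, ih.2 _ (by omega), ih.1]; simp [pow_succ']
      · obtain ⟨k, rfl⟩ : ∃ j, k = j + 1 := ⟨k - 1, by omega⟩
        rw [this, ih.2 _ (by omega), ih.2 _ (by omega)]; simp
  have hev : ∀ n, (q n).eval 1 = (opc d c ^ n) 1 := by
    have hd : ∀ f : K[X], (pco d f).eval 1 = d (f.eval 1) := by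
      intro f
      induction f using Polynomial.induction_on' with
      | add f g hf hg => simp only [map_add, eval_add, hf, hg]
      | monomial n a =>
        have : pco d (monomial n a) = monomial n (d a) := by
          ext i; rw [pco_coeff, coeff_monomial, coeff_monomial]; split_ifs <;> simp
        rw [this]; simp
    intro n
    induction n with
    | zero => simp [q0]
    | succ n ih => rw [qs, pow_succ', Module.End.mul_apply, opc_apply, ← ih]; simp [hd]
  have hqp : q p = C (d^[p - 1] c) * X + C (c ^ p) * X ^ p := by
    have hder := jac_poly (p := p) d c
    change derivative (q p) = _ at hder
    ext k
    rw [coeff_add, coeff_C_mul, coeff_C_mul, coeff_X, coeff_X_pow]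
    rcases Nat.eq_zero_or_pos k with rfl | hk
    · have := c0 (p - 1)
      rw [show p - 1 + 1 = p by omega] at this
      rw [this]
      rw [if_neg (by omega), if_neg (by omega)]; simp
    · obtain ⟨k, rfl⟩ : ∃ j, k = j + 1 := ⟨k - 1, by omega⟩
      have h1 := congrArg (fun f => f.coeff k) hder
      simp only [coeff_derivative, coeff_C] at h1
      rcases lt_trichotomy (k + 1) p with h | h | h
      · rcases Nat.eq_zero_or_pos k with rfl | hk0
        · rw [if_neg (show ¬ (0 + 1 = p) by omega)]; simpa using h1
        · rw [if_neg (by omega)] at h1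
          rw [if_neg (by omega), if_neg (by omega)]
          have hne : ((k : K) + 1) ≠ 0 := by
            have : ((k + 1 : ℕ) : K) ≠ 0 := by
              rw [Ne, CharP.cast_eq_zero_iff K p]
              exact fun hd => absurd (Nat.le_of_dvd (by omega) hd) (by omega)
            exact_mod_cast this
          rcases mul_eq_zero.1 h1 with h2 | h2
          · rw [h2]; simp
          · exact absurd h2 hne
      · rw [if_neg (by omega), if_pos h, ← (ct p).1, h]; simp
      · rw [(ct p).2 _ h, if_neg (by omega), if_neg (by omega)]; simp
  rw [← hev, hqp]; simp

/-- Jacobson's formula. -/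
theorem jacobson (d : Der K) (c x : K) :
    (opc d c ^ p) x = d^[p] x + (d^[p - 1] c + c ^ p) * x := by
  haveI := charP_end (p := p) K
  have key := ad_pow (p := p) (opc d c) (LinearMap.mulLeft ℤ x)
    (fun n => LinearMap.mulLeft ℤ (d^[n] x)) rfl (by
      intro n
      rw [opc_ad, ← Function.iterate_succ_apply' (f := d)])
  have := congrArg (fun T => T (1 : K)) key
  simp only [LinearMap.sub_apply, Module.End.mul_apply, LinearMap.mulLeft_apply, mul_one,
    jac_one] at this
  rw [sub_eq_iff_eq_add] at this
  rw [this]; ring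

/-- Logarithmic derivative identity. -/
theorem dlog_pow (d : Der K) (hd : ∀ x, d^[p] x = d x) {x c : K} (hx : x ≠ 0)
    (h : d x = c * x) : c - d^[p - 1] c = c ^ p := by
  have h0 : ∀ y, x * opc d c y = d (x * y) := by
    intro y
    rw [opc_apply, Derivation.leibniz, h]; simp only [smul_eq_mul]; ring
  have h1 : ∀ n y, x * (opc d c ^ n) y = d^[n] (x * y) := by
    intro n
    induction n with
    | zero => intro y; rfl
    | succ n ih =>
      intro y
      rw [pow_succ, Module.End.mul_apply, ih, h0, ← Function.iterate_succ_apply]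
  have h2 := h1 p 1
  rw [jac_one, mul_one, hd, h] at h2
  have : d^[p - 1] c + c ^ p = c := by
    apply mul_left_cancel₀ hx; rw [h2]; ring
  linear_combination -this

end jac
end Izh

namespace Izh
open Polynomial

section pr
variable {K : Type} [Field K] (p : ℕ) [hp : Fact p.Prime]

/-- Projector. -/
def prj (d : Der K) : K →+ K :=
  AddMonoidHom.mk' (fun x => x - d^[p - 1] x) (fun x y => by
    have : ∀ n, d^[n] (x + y) = d^[n] x + d^[n] y := by
      intro n
      induction n with
      | zero => rfl
      | succ n ih => rw [Function.iterate_succ_apply', ih, map_add, ← Function.iterate_succ_apply' d,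
          ← Function.iterate_succ_apply' d]
    simp only [this]; ring)

theorem prj_apply (d : Der K) (x : K) : prj p d x = x - d^[p - 1] x := rfl

theorem iter_p (d : Der K) (x : K) : d^[p - 1] (d x) = d^[p] x := by
  rw [← Function.iterate_succ_apply, show (p - 1).succ = p by have := hp.out.pos; omega]

theorem iter_p' (d : Der K) (x : K) : d (d^[p - 1] x) = d^[p] x := by
  rw [← Function.iterate_succ_apply' d, show (p - 1).succ = p by have := hp.out.pos; omega]

theorem D_prj {d : Der K} (hd : ∀ x, d^[p] x = d x) (x : K) : d (prj p d x) = 0 := by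
  rw [prj_apply, map_sub, iter_p', hd, sub_self]

theorem prj_D {d : Der K} (hd : ∀ x, d^[p] x = d x) (x : K) : prj p d (d x) = 0 := by
  rw [prj_apply, iter_p, hd, sub_self]

theorem prj_const_mul {d : Der K} {c : K} (hc : d c = 0) (x : K) : prj p d (c * x) = c * prj p d x := by
  rw [prj_apply, prj_apply, D_pow_const d hc]; ring

theorem iter_const {d : Der K} {c : K} (hc : d c = 0) : d^[p - 1] c = 0 := by
  have h2 := hp.out.two_le
  rw [show p - 1 = (p - 2) + 1 by omega, Function.iterate_succ_apply, hc]
  exact Function.iterate_fixed (map_zero d) _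

theorem prj_const {d : Der K} {c : K} (hc : d c = 0) : prj p d c = c := by
  rw [prj_apply, iter_const p hc, sub_zero]

theorem iter_comm {d e : Der K} (h : ∀ x, d (e x) = e (d x)) (n : ℕ) (x : K) :
    d (e^[n] x) = e^[n] (d x) := by
  induction n generalizing x with
  | zero => rfl
  | succ n ih => rw [Function.iterate_succ_apply, ih, h, ← Function.iterate_succ_apply]

theorem prj_comm {d e : Der K} (h : ∀ x, d (e x) = e (d x)) (x : K) :
    d (prj p e x) = prj p e (d x) := by
  rw [prj_apply, map_sub, iter_comm h, prj_apply]

end pr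

namespace PD
variable {K : Type} [Field K] {p m : ℕ} [hp : Fact p.Prime] (𝒟 : PD p m K)

/-- Composite projector. -/
def prL : List (Fin m) → K →+ K
  | [] => AddMonoidHom.id K
  | i :: L => (prj p (𝒟.D i)).comp (prL L)

theorem prL_comm (L : List (Fin m)) (i : Fin m) (x : K) : 𝒟.D i (𝒟.prL L x) = 𝒟.prL L (𝒟.D i x) := by
  induction L with
  | nil => rfl
  | cons j L ih =>
    change 𝒟.D i (prj p (𝒟.D j) (𝒟.prL L x)) = prj p (𝒟.D j) (𝒟.prL L (𝒟.D i x))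
    rw [prj_comm p (𝒟.comm i j), ih]

theorem prL_D {L : List (Fin m)} {i : Fin m} (hi : i ∈ L) (x : K) : 𝒟.prL L (𝒟.D i x) = 0 := by
  induction L with
  | nil => simp at hi
  | cons j L ih =>
    change prj p (𝒟.D j) (𝒟.prL L (𝒟.D i x)) = 0
    rcases List.mem_cons.1 hi with rfl | h
    · rw [← prL_comm, prj_D p (𝒟.pow i)]
    · rw [ih h, map_zero]

theorem prL_const {L : List (Fin m)} {x : K} (h : ∀ i ∈ L, 𝒟.D i x = 0) : 𝒟.prL L x = x := by
  induction L with
  | nil => rfl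
  | cons j L ih =>
    change prj p (𝒟.D j) (𝒟.prL L x) = x
    rw [ih (fun i hi => h i (List.mem_cons_of_mem _ hi)), prj_const p (h j List.mem_cons_self)]

theorem prL_Im {L : List (Fin m)} {x : K} (h : x ∈ Im 𝒟.D {i | i ∈ L}) : 𝒟.prL L x = 0 := by
  have := Im_ind (𝒟.prL L) ⊥ (fun i hi x => by rw [𝒟.prL_D hi]; exact zero_mem _) h
  simpa using this

theorem Im_const {L : List (Fin m)} {x : K} (h : x ∈ Im 𝒟.D {i | i ∈ L})
    (hc : ∀ i ∈ L, 𝒟.D i x = 0) : x = 0 := by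
  rw [← 𝒟.prL_const hc, 𝒟.prL_Im h]

theorem exact_of_closed (η : Fin m → K) (hc : ∀ i j, 𝒟.D i (η j) = 𝒟.D j (η i))
    (hP : ∀ i, (𝒟.D i)^[p - 1] (η i) = η i) : ∃ g, ∀ i, 𝒟.D i g = η i := by
  have h2 := hp.out.two_le
  have key : ∀ l : List (Fin m), ∃ g, ∀ i ∈ l, 𝒟.D i g = η i := by
    intro l
    induction l with
    | nil => exact ⟨0, by simp⟩
    | cons k l ih =>
      obtain ⟨g, hg⟩ := ih
      refine ⟨g + (𝒟.D k)^[p - 2] (η k - 𝒟.D k g), fun i hi => ?_⟩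
      by_cases hk : i ∈ l
      · rw [map_add, iter_comm (𝒟.comm i k), map_sub, 𝒟.comm i k, hg i hk, hc i k, sub_self,
          Function.iterate_fixed (map_zero _), add_zero]
      · obtain rfl : i = k := by
          rcases List.mem_cons.1 hi with h | h
          · exact h
          · exact absurd h hk
        rw [map_add, ← Function.iterate_succ_apply' (𝒟.D i), show (p - 2).succ = p - 1 by omega]
        have : prj p (𝒟.D i) (η i - 𝒟.D i g) = 0 := by
          rw [map_sub, prj_D p (𝒟.pow i), prj_apply, hP]; simp
        rw [prj_apply, sub_eq_zero] at this
        rw [← this]; ring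
  obtain ⟨g, hg⟩ := key (List.finRange m)
  exact ⟨g, fun i => hg i (List.mem_finRange i)⟩

variable [CharP K p]

theorem dl_frob (x : K) : ∃ g, ∀ i, 𝒟.D i g = dl 𝒟.D x i ^ p - dl 𝒟.D x i := by
  by_cases hx : x = 0
  · have := hp.out.ne_zero
    exact ⟨0, fun i => by simp [dl, hx, this]⟩
  have h : ∀ i, dl 𝒟.D x i ^ p - dl 𝒟.D x i = - (𝒟.D i)^[p - 1] (dl 𝒟.D x i) := by
    intro i
    have := dlog_pow (p := p) (𝒟.D i) (𝒟.pow i) hx (c := dl 𝒟.D x i) (by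
      simp only [dl]; field_simp)
    rw [← this]; ring
  apply 𝒟.exact_of_closed
  · intro i j
    rw [map_sub, map_sub, D_frob, D_frob, dl_closed 𝒟.D 𝒟.comm]
  · intro i
    have h2 := hp.out.two_le
    have : prj p (𝒟.D i) (- (𝒟.D i)^[p - 1] (dl 𝒟.D x i)) = 0 := by
      rw [map_neg, show p - 1 = (p - 2) + 1 by omega, Function.iterate_succ_apply',
        prj_D p (𝒟.pow i), neg_zero]
    rw [← h, prj_apply, sub_eq_zero] at this
    exact this.symm

theorem fm_frob (z : MK K) : ∃ η, (fun L => fm 𝒟.D z L ^ p) = fm 𝒟.D z + dx 𝒟.D η := by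
  have h0 := hp.out.ne_zero
  induction z using MK.induction with
  | h1 =>
    refine ⟨0, ?_⟩
    rw [fm_one, dx_const _ _ (by simp), add_zero]
    funext L; cases L <;> simp [vac, h0]
  | ha a b h1 h2 =>
    obtain ⟨η, h1⟩ := h1
    obtain ⟨θ, h2⟩ := h2
    refine ⟨η + θ, ?_⟩
    rw [fm_add, dx_add]
    funext L
    have e1 := congrFun h1 L
    have e2 := congrFun h2 L
    simp only [Pi.add_apply] at e1 e2 ⊢
    rw [add_pow_char, e1, e2]; ring
  | hn a h =>
    obtain ⟨η, h⟩ := h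
    refine ⟨-η, ?_⟩
    rw [fm_neg, dx_neg]
    funext L
    have e1 := congrFun h L
    simp only [Pi.add_apply, Pi.neg_apply] at e1 ⊢
    have := sub_pow_expChar (p := p) (R := K) 0 (fm 𝒟.D a L)
    rw [zero_pow h0, zero_sub, zero_sub] at this
    rw [this, e1]; ring
  | hm x a h =>
    obtain ⟨η, h⟩ := h
    obtain ⟨g, hg⟩ := 𝒟.dl_frob x
    set Φ := fun L => fm 𝒟.D a L ^ p with hΦ
    refine ⟨g • Φ - wg (dl 𝒟.D x) η, ?_⟩
    have h1 : (fun L => fm 𝒟.D (sy x * a) L ^ p) = wg (fun i => dl 𝒟.D x i ^ p) Φ := by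
      funext L
      have key : ∀ (L : List (Fin m)) (lam : Fin m → K) (ω : List (Fin m) → K),
          wg lam ω L ^ p = wg (fun i => lam i ^ p) (fun L => ω L ^ p) L := by
        intro L
        induction L with
        | nil => intro lam ω; simp [h0]
        | cons i L ih =>
          intro lam ω
          rw [wg_cons, wg_cons, sub_pow_char, mul_pow, ih]
      rw [fm_sy_mul, key]
    rw [h1, dx_sub, dx_smul, dx_const 𝒟.D Φ (fun i L => D_frob _ _), smul_zero, add_zero,
      dx_wg _ _ (dl_closed 𝒟.D 𝒟.comm x), sub_neg_eq_add]
    have h2 : (fun i => dl 𝒟.D x i ^ p) = dl 𝒟.D x + fun i => 𝒟.D i g := by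
      funext i; rw [Pi.add_apply, hg]; ring
    rw [h2, wg_add_left, fm_sy_mul, h, wg_add]
    rw [← h]
    abel

/-- Solving `D x = c x`. -/
theorem solve (i : Fin m) {c : K} (hc : c - (𝒟.D i)^[p - 1] c = c ^ p) :
    ∃ x, x ≠ 0 ∧ 𝒟.D i x = c * x ∧ (∀ l, l ≠ i → 𝒟.D l c = 0 → 𝒟.D l x = 0) ∧
      ∀ A : AddSubgroup K, c ∈ A → (∀ y ∈ A, 𝒟.D i y ∈ A) → (∀ y ∈ A, c * y ∈ A) → 1 ∉ A →
        x - 1 ∈ A := by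
  have h2 := hp.out.two_le
  set Q := opc (𝒟.D i) (-c) with hQ
  have hneg : ∀ y : K, (-y) ^ p = - y ^ p := by
    intro y
    have := sub_pow_expChar (p := p) (R := K) 0 y
    rwa [zero_pow hp.out.ne_zero, zero_sub, zero_sub] at this
  have hitn : ∀ n y, (𝒟.D i)^[n] (-y) = - (𝒟.D i)^[n] y := by
    intro n y
    induction n generalizing y with
    | zero => rfl
    | succ n ih => rw [Function.iterate_succ_apply, map_neg, ih, ← Function.iterate_succ_apply]
  have hQp : Q ^ p = Q := by
    apply LinearMap.ext
    intro y
    rw [hQ, jacobson, 𝒟.pow, hneg, hitn, ← hc, opc_apply]; ring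
  have hker : ∀ l, l ≠ i → 𝒟.D l c = 0 → ∀ y, 𝒟.D l y = 0 → 𝒟.D l (Q y) = 0 := by
    intro l hl hlc y hy
    rw [hQ, opc_apply, map_add, 𝒟.comm, hy, Derivation.leibniz, map_neg, hlc, hy]; simp
  have hker2 : ∀ l, l ≠ i → 𝒟.D l c = 0 → ∀ n y, 𝒟.D l y = 0 → 𝒟.D l ((Q ^ n) y) = 0 := by
    intro l hl hlc n
    induction n with
    | zero => intro y hy; exact hy
    | succ n ih => intro y hy; rw [pow_succ', Module.End.mul_apply]; exact hker l hl hlc _ (ih y hy)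
  have hA : ∀ A : AddSubgroup K, c ∈ A → (∀ y ∈ A, 𝒟.D i y ∈ A) → (∀ y ∈ A, c * y ∈ A) →
      (Q ^ (p - 1)) 1 ∈ A := by
    intro A h1 h3 h4
    have : ∀ n, (Q ^ (n + 1)) 1 ∈ A := by
      intro n
      induction n with
      | zero => rw [zero_add, pow_one, hQ, opc_apply]; simpa using h1
      | succ n ih =>
        rw [pow_succ', Module.End.mul_apply, hQ, opc_apply, neg_mul]
        exact A.add_mem (h3 _ ih) (A.neg_mem (h4 _ ih))
    have := this (p - 2)
    rwa [show p - 2 + 1 = p - 1 by omega] at this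
  by_cases hx : 1 - (Q ^ (p - 1)) 1 = 0
  · -- zero case
    haveI := charP_end (p := p) K
    letI : Algebra (ZMod p) (Module.End ℤ K) := ZMod.algebra _ p
    have hprod : (Finset.univ.toList.map (fun a : ZMod p => Q - algebraMap (ZMod p) _ a)).prod = 0 := by
      have h5 : (∏ a : ZMod p, (X - C a) : (ZMod p)[X]) = X ^ p - X := by
        have hr := FiniteField.roots_X_pow_card_sub_X (ZMod p)
        rw [ZMod.card] at hr
        have hm : (X ^ p - X : (ZMod p)[X]).Monic := by
          apply monic_X_pow_sub
          rw [degree_X]; exact_mod_cast h2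
        have := prod_multiset_X_sub_C_of_monic_of_roots_card_eq hm (by
          rw [hr, FiniteField.X_pow_card_sub_X_natDegree_eq _ h2]
          change Fintype.card (ZMod p) = p
          exact ZMod.card p)
        rw [hr] at this
        exact this
      have h6 := congrArg (aeval Q) h5
      rw [map_sub, map_pow, aeval_X, hQp, sub_self, ← Finset.prod_map_toList, map_list_prod, List.map_map] at h6
      rw [← h6]
      congr 1
      apply List.map_congr_left
      intro a _
      simp
    have hex : ∀ l : List (ZMod p), (l.map (fun a : ZMod p => Q - algebraMap (ZMod p) _ a)).prod 1 = 0 →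
        ∃ y : K, y ≠ 0 ∧ (∀ l, l ≠ i → 𝒟.D l c = 0 → 𝒟.D l y = 0) ∧
          ∃ j : ℕ, Q y = (j : K) * y := by
      intro l
      induction l with
      | nil => intro h; exact absurd h one_ne_zero
      | cons a l ih =>
        intro h
        by_cases h0 : (l.map (fun a : ZMod p => Q - algebraMap (ZMod p) _ a)).prod 1 = 0
        · exact ih h0
        · refine ⟨_, h0, ?_, a.val, ?_⟩
          · intro r hr hrc
            clear h h0 ih
            induction l with
            | nil => exact (𝒟.D r).map_one_eq_zero
            | cons e l ih =>
              rw [List.map_cons, List.prod_cons, Module.End.mul_apply, LinearMap.sub_apply, map_sub,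
                hker r hr hrc _ ih]
              have : (algebraMap (ZMod p) (Module.End ℤ K) e) = ((e.val : ℕ) : Module.End ℤ K) := by
                conv_lhs => rw [← ZMod.natCast_zmod_val e, map_natCast]
              rw [this, Module.End.natCast_apply, map_nsmul, ih]; simp
          · rw [List.map_cons, List.prod_cons, Module.End.mul_apply, LinearMap.sub_apply, sub_eq_zero] at h
            rw [h]
            have : (algebraMap (ZMod p) (Module.End ℤ K) a) = ((a.val : ℕ) : Module.End ℤ K) := by
              conv_lhs => rw [← ZMod.natCast_zmod_val a, map_natCast]
            rw [this, Module.End.natCast_apply, nsmul_eq_mul]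
    obtain ⟨y, hy, hyl, j, hj⟩ := hex _ (by rw [hprod]; rfl)
    rw [hQ, opc_apply] at hj
    obtain ⟨n, hn⟩ : ∃ n : ℕ, (n : K) = - j := by
      obtain ⟨q, rfl⟩ : ∃ q, p = q + 1 := ⟨p - 1, by omega⟩
      refine ⟨q * j, ?_⟩
      have : ((q + 1 : ℕ) : K) = 0 := CharP.cast_eq_zero K _
      push_cast at this ⊢
      linear_combination (j : K) * this
    have hbn : ∀ l, 𝒟.D l (𝒟.b i ^ n) = if l = i then (n : K) * 𝒟.b i ^ n else 0 := by
      intro l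
      rw [Derivation.leibniz_pow, 𝒟.D_b]
      split_ifs
      · cases n with
        | zero => simp
        | succ n => simp [pow_succ]
      · simp
    refine ⟨𝒟.b i ^ n * y, mul_ne_zero (pow_ne_zero _ (𝒟.b_ne i)) hy, ?_, ?_, ?_⟩
    · rw [Derivation.leibniz, hbn, if_pos rfl, hn]
      simp only [smul_eq_mul]
      linear_combination (𝒟.b i ^ n) * hj
    · intro l hl hlc
      rw [Derivation.leibniz, hbn, if_neg hl, hyl l hl hlc]; simp
    · intro A h1 h3 h4 h5
      exfalso
      have := hA A h1 h3 h4
      rw [← sub_eq_zero.1 hx] at this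
      exact h5 this
  · refine ⟨_, hx, ?_, ?_, ?_⟩
    · have : Q (1 - (Q ^ (p - 1)) 1) = 0 := by
        rw [map_sub, ← Module.End.mul_apply Q, ← pow_succ', show p - 1 + 1 = p by omega, hQp, sub_self]
      rw [hQ, opc_apply] at this
      rw [← hQ] at this
      linear_combination this
    · intro l hl hlc
      rw [map_sub, hker2 l hl hlc _ _ (𝒟.D l).map_one_eq_zero]; simp
    · intro A h1 h3 h4 h5
      have := A.neg_mem (hA A h1 h3 h4)
      rwa [sub_sub_cancel_left]

end PD
end Izh

namespace Izh

section lead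
variable {m : ℕ} {R : Type} [CommRing R]

/-- Decreasing lists. -/
abbrev Dec (L : List (Fin m)) : Prop := L.Pairwise (· > ·)

/-- Vanishing above `L`. -/
def Above (L : List (Fin m)) (ω : List (Fin m) → R) : Prop :=
  ∀ J, Dec J → J.length = L.length → L < J → ω J = 0

theorem wg_eq_zero {ι : Type} (lam : ι → R) (ω : List ι → R) (L : List ι)
    (h : ∀ A k B, L = A ++ k :: B → lam k = 0 ∨ ω (A ++ B) = 0) : wg lam ω L = 0 := by
  induction L generalizing ω with
  | nil => simp
  | cons i L ih =>
    rw [wg_cons, ih _ (fun A k B e => h (i :: A) k B (by rw [e]; rfl))]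
    rcases h [] i L rfl with h1 | h1
    · rw [h1]; simp
    · simp only [List.nil_append] at h1
      rw [h1]; simp

theorem insert_dec (l k : Fin m) (A B : List (Fin m)) (hL : Dec (A ++ k :: B)) (hk : k < l)
    (hl : l ∉ A ++ k :: B) :
    ∃ M : List (Fin m), M.Perm (l :: (A ++ B)) ∧ Dec M ∧ (A ++ k :: B) < M := by
  induction A with
  | nil =>
    refine ⟨l :: B, List.Perm.refl _, ?_, ?_⟩
    · rw [List.nil_append, Dec, List.pairwise_cons] at hL
      rw [Dec, List.pairwise_cons]
      exact ⟨fun a ha => lt_trans (hL.1 a ha) hk, hL.2⟩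
    · rw [List.nil_append, List.cons_lt_cons_iff]; exact Or.inl hk
  | cons a A ih =>
    rw [List.cons_append, Dec, List.pairwise_cons] at hL
    rw [List.cons_append, List.mem_cons, not_or] at hl
    rcases lt_or_gt_of_ne hl.1 with h | h
    · obtain ⟨M, hM, hd, hlt⟩ := ih hL.2 hl.2
      refine ⟨a :: M, (hM.cons a).trans (List.Perm.swap _ _ _), ?_, ?_⟩
      · rw [Dec, List.pairwise_cons]
        refine ⟨fun b hb => ?_, hd⟩
        rcases List.mem_cons.1 (hM.subset hb) with rfl | h1
        · exact h
        · apply hL.1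
          rcases List.mem_append.1 h1 with h2 | h2
          · exact List.mem_append_left _ h2
          · exact List.mem_append_right _ (List.mem_cons_of_mem _ h2)
      · rw [List.cons_append, List.cons_lt_cons_iff]; exact Or.inr ⟨rfl, hlt⟩
    · refine ⟨l :: (a :: A ++ B), List.Perm.refl _, ?_, ?_⟩
      · rw [Dec, List.pairwise_cons]
        have hsub : (a :: A ++ B).Sublist (a :: (A ++ k :: B)) := by
          rw [List.cons_append]
          apply List.Sublist.cons_cons
          exact List.Sublist.append (List.Sublist.refl _) (List.sublist_cons_self _ _)
        have hd : Dec (a :: (A ++ k :: B)) := List.pairwise_cons.2 hL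
        refine ⟨fun b hb => ?_, List.Pairwise.sublist hsub hd⟩
        rcases List.mem_cons.1 (hsub.subset hb) with rfl | h1
        · exact h
        · exact lt_trans (hL.1 b h1) h
      · rw [List.cons_append, List.cons_lt_cons_iff]; exact Or.inl h

theorem above_aux {i : Fin m} {L' A B : List (Fin m)} {k j : Fin m} {ω : List (Fin m) → R}
    (hA : Above L' ω) (hd : Dec (i :: L')) (hij : i ≤ j) (hJ : Dec (j :: (A ++ k :: B)))
    (hlen : (A ++ k :: B).length = L'.length) : ω (j :: (A ++ B)) = 0 := by
  apply hA
  · refine List.Pairwise.sublist ?_ hJ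
    apply List.Sublist.cons_cons
    exact List.Sublist.append (List.Sublist.refl _) (List.sublist_cons_self _ _)
  · simp at hlen ⊢; omega
  · cases L' with
    | nil => simp at hlen
    | cons h T =>
      rw [List.cons_lt_cons_iff]
      left
      rw [Dec, List.pairwise_cons] at hd
      exact lt_of_lt_of_le (hd.1 h List.mem_cons_self) hij

theorem wg_lead {i : Fin m} {L' : List (Fin m)} {lam : Fin m → R} {ω : List (Fin m) → R}
    (hA : Above L' ω) (hd : Dec (i :: L')) : wg lam ω (i :: L') = lam i * ω L' := by
  rw [wg_cons, wg_eq_zero, sub_zero]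
  intro A k B e
  right
  subst e
  exact above_aux hA hd le_rfl hd rfl

theorem wg_above {i : Fin m} {L' : List (Fin m)} {lam : Fin m → R} {ω : List (Fin m) → R}
    (hA : Above L' ω) (hd : Dec (i :: L')) (hl : ∀ l, i < l → lam l = 0) :
    Above (i :: L') (wg lam ω) := by
  intro J hJ hlen hlt
  cases J with
  | nil => simp at hlen
  | cons j J' =>
    simp only [List.length_cons, Nat.add_right_cancel_iff] at hlen
    rw [List.cons_lt_cons_iff] at hlt
    apply wg_eq_zero
    intro A k B e
    have hij : i ≤ j := by
      rcases hlt with h | h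
      · exact h.le
      · exact h.1.le
    cases A with
    | nil =>
      simp only [List.nil_append, List.cons.injEq] at e
      obtain ⟨rfl, rfl⟩ := e
      rcases hlt with h | h
      · left; exact hl _ h
      · right
        rw [List.nil_append]
        exact hA _ (List.pairwise_cons.1 hJ).2 hlen h.2
    | cons a A =>
      simp only [List.cons_append, List.cons.injEq] at e
      obtain ⟨rfl, rfl⟩ := e
      right
      exact above_aux hA hd hij hJ hlen

end lead

namespace PD
variable {K : Type} [Field K] {p m : ℕ} [hp : Fact p.Prime] (𝒟 : PD p m K)

/-- Condition B. -/
def condB (L : List (Fin m)) (a : K) : Prop := a - a ^ p ∈ Im 𝒟.D {i | i ∈ L}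

/-- Condition T. -/
def condT (L : List (Fin m)) (a : K) : Prop :=
  ∀ l, l ∉ L → 𝒟.D l a ∈ Im 𝒟.D {k | k ∈ L ∧ l < k}

theorem fm_condB [CharP K p] (z : MK K) (L : List (Fin m)) : 𝒟.condB L (fm 𝒟.D z L) := by
  obtain ⟨η, h⟩ := 𝒟.fm_frob z
  have e := congrFun h L
  simp only [Pi.add_apply] at e
  rw [condB, e]
  have : fm 𝒟.D z L - (fm 𝒟.D z L + dx 𝒟.D η L) = - dx 𝒟.D η L := by ring
  rw [this]
  apply neg_mem
  apply dx_mem_Im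
  rintro A k B rfl
  left; simp

theorem fm_condT (z : MK K) (L : List (Fin m)) (hL : Dec L) (hA : Above L (fm 𝒟.D z)) :
    𝒟.condT L (fm 𝒟.D z L) := by
  intro l hl
  have h := congrFun (fm_closed 𝒟.D 𝒟.comm z) (l :: L)
  rw [dx_cons, Pi.zero_apply, sub_eq_zero] at h
  rw [h]
  apply dx_mem_Im
  rintro A k B rfl
  by_cases hk : l < k
  · left; exact ⟨by simp, hk⟩
  · right
    have hkl : k < l := by
      rcases lt_trichotomy k l with h1 | h1 | h1
      · exact h1
      · exact absurd (by simp [h1]) hl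
      · exact absurd h1 hk
    obtain ⟨M, hM, hd, hlt⟩ := insert_dec l k A B hL hkl hl
    apply (fm_alt 𝒟.D z).zero_of_perm hM.symm
    exact hA M hd (by rw [hM.length_eq]; simp; omega) hlt

end PD
end Izh

namespace Izh
open HahnSeries

/-- Hahn series with real exponents. -/
abbrev Hh (κ : Type) [Field κ] := HahnSeries ℝ κ

section hahn
variable {κ : Type} [Field κ]

/-- Coefficientwise derivation of Hahn series. -/
noncomputable def hd (δ : Der κ) : Der (Hh κ) :=
  mkDer (AddMonoidHom.mk' (fun f => HahnSeries.map f δ) (fun a b => by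
      ext g; simp))
    (fun a b => by
      ext g
      simp only [AddMonoidHom.mk'_apply]
      have h1 : ∀ f : Hh κ, (HahnSeries.map f δ).support ⊆ f.support := by
        intro f x hx
        simp only [mem_support, HahnSeries.map_coeff] at hx ⊢
        intro h
        rw [h, map_zero] at hx; exact hx rfl
      rw [HahnSeries.map_coeff, coeff_add, mul_comm b, coeff_mul, coeff_mul_right' b.isPWO_support (h1 b),
        coeff_mul_left' a.isPWO_support (h1 a), map_sum, ← Finset.sum_add_distrib]
      apply Finset.sum_congr rfl
      intro x _
      rw [Derivation.leibniz]
      simp [mul_comm])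

theorem hd_coeff (δ : Der κ) (f : Hh κ) (g : ℝ) : (hd δ f).coeff g = δ (f.coeff g) := rfl

theorem hd_order (δ : Der κ) (f : Hh κ) : f.orderTop ≤ (hd δ f).orderTop := by
  rw [le_orderTop_iff_forall]
  intro g hg
  rw [hd_coeff, coeff_eq_zero_of_lt_orderTop hg, map_zero]

theorem hd_C (δ : Der κ) (c : κ) : hd δ (C c) = C (δ c) := by
  ext g
  rw [hd_coeff, C_apply, C_apply, coeff_single, coeff_single]
  split_ifs <;> simp

/-- Positive order elements. -/
def hpos (κ : Type) [Field κ] : AddSubgroup (Hh κ) where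
  carrier := {f | 0 < f.orderTop}
  zero_mem' := by simp
  add_mem' := fun {a b} ha hb => by
    rw [Set.mem_setOf_eq] at ha hb ⊢
    exact lt_of_lt_of_le (lt_min ha hb) min_orderTop_le_orderTop_add
  neg_mem' := fun {a} ha => by simpa using ha

theorem mem_hpos {f : Hh κ} : f ∈ hpos κ ↔ 0 < f.orderTop := Iff.rfl

theorem hpos_mul {f g : Hh κ} (hf : f ∈ hpos κ) (hg : 0 ≤ g.orderTop) : f * g ∈ hpos κ := by
  rw [mem_hpos, orderTop_mul]
  exact add_pos_of_pos_of_nonneg hf hg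

theorem ord_C (c : κ) : 0 ≤ (C c : Hh κ).orderTop := by
  rw [C_apply]; exact orderTop_single_le

theorem ord_of_sub {f : Hh κ} {c : κ} (h : f - C c ∈ hpos κ) : 0 ≤ f.orderTop := by
  have : f = (f - C c) + C c := by ring
  rw [this]
  exact le_trans (le_min (le_of_lt h) (ord_C c)) min_orderTop_le_orderTop_add

/-- The reduction relation. -/
def hrel (κ : Type) [Field κ] : Subring (Hh κ × κ) where
  carrier := {x | x.1 - C x.2 ∈ hpos κ}
  zero_mem' := by simp [zero_mem]
  one_mem' := by simp [zero_mem]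
  add_mem' := fun {a b} ha hb => by
    have := (hpos κ).add_mem ha hb
    simp only [Set.mem_setOf_eq, Prod.fst_add, Prod.snd_add, map_add]
    convert this using 1; ring
  neg_mem' := fun {a} ha => by
    have := (hpos κ).neg_mem ha
    simp only [Set.mem_setOf_eq, Prod.fst_neg, Prod.snd_neg, map_neg]
    convert this using 1; ring
  mul_mem' := fun {a b} ha hb => by
    have h1 := hpos_mul ha (ord_of_sub hb)
    have h2 := hpos_mul hb (ord_C a.2)
    have := (hpos κ).add_mem h1 h2
    simp only [Set.mem_setOf_eq, Prod.fst_mul, Prod.snd_mul, map_mul]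
    convert this using 1; ring

theorem mem_hrel {f : Hh κ} {c : κ} : (f, c) ∈ hrel κ ↔ f - C c ∈ hpos κ := Iff.rfl

theorem C_pos {c : κ} (h : (C c : Hh κ) ∈ hpos κ) : c = 0 := by
  by_contra hc
  rw [mem_hpos, C_apply, orderTop_single hc] at h
  exact lt_irrefl _ h

theorem hrel_unique {f : Hh κ} {c c' : κ} (h : (f, c) ∈ hrel κ) (h' : (f, c') ∈ hrel κ) : c = c' := by
  have := (hpos κ).sub_mem (mem_hrel.1 h') (mem_hrel.1 h)
  have e : f - C c' - (f - C c) = C (c - c') := by rw [map_sub]; ring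
  rw [e] at this
  exact sub_eq_zero.1 (C_pos this)

theorem hrel_zero {f : Hh κ} : (f, (0 : κ)) ∈ hrel κ ↔ 0 < f.orderTop := by
  rw [mem_hrel, map_zero, sub_zero]; rfl

/-- Leading coefficient as a monoid hom. -/
noncomputable def hlc : Hh κ →*₀ κ where
  toFun := leadingCoeff
  map_zero' := leadingCoeff_zero
  map_one' := leadingCoeff_one
  map_mul' := fun x y => leadingCoeff_mul x y

theorem hlc_apply (f : Hh κ) : hlc f = f.leadingCoeff := rfl

theorem hlc_pos {f : Hh κ} (h : f - 1 ∈ hpos κ) : hlc f = 1 := by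
  have : f = 1 + (f - 1) := by ring
  rw [this, hlc_apply, leadingCoeff_add_eq_left, leadingCoeff_one]
  rw [orderTop_one]; exact h

theorem hlc_rel {f : Hh κ} {c : κ} (h : (f, c) ∈ hrel κ) (hc : c ≠ 0) : hlc f = c := by
  have : f = C c + (f - C c) := by ring
  rw [this, hlc_apply, leadingCoeff_add_eq_left, C_apply, leadingCoeff_of_single]
  rw [C_apply, orderTop_single hc]; exact h

theorem hlc_st (x y : Hh κ) (hx : x ≠ 0) (hy : y ≠ 0) (h : x + y = 1) :
    hlc x = 1 ∨ hlc y = 1 ∨ hlc x + hlc y = 1 ∨ hlc x + hlc y = 0 := by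
  by_cases h1 : x ∈ hpos κ
  · right; left
    apply hlc_pos
    have : y - 1 = -x := by rw [← h]; ring
    rw [this]; exact neg_mem h1
  by_cases h2 : y ∈ hpos κ
  · left
    apply hlc_pos
    have : x - 1 = -y := by rw [← h]; ring
    rw [this]; exact neg_mem h2
  rw [mem_hpos, not_lt] at h1 h2
  by_cases h3 : x.orderTop = 0
  · have h4 : y.orderTop = 0 := by
      apply le_antisymm h2
      have : y = 1 - x := by rw [← h]; ring
      rw [this]
      refine le_trans (le_min ?_ ?_) min_orderTop_le_orderTop_sub
      · rw [orderTop_one]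
      · rw [h3]
    right; right; left
    have e1 : x.order = 0 := by
      have := order_eq_orderTop_of_ne_zero hx
      rw [h3] at this; exact_mod_cast this
    have e2 : y.order = 0 := by
      have := order_eq_orderTop_of_ne_zero hy
      rw [h4] at this; exact_mod_cast this
    rw [hlc_apply, hlc_apply, leadingCoeff_eq, leadingCoeff_eq, e1, e2, ← coeff_add, h]
    simp
  · have h3 : x.orderTop < 0 := lt_of_le_of_ne h1 h3
    right; right; right
    have : y = (-x) + 1 := by rw [← h]; ring
    rw [this, hlc_apply, hlc_apply, leadingCoeff_add_eq_left, leadingCoeff_neg, add_neg_cancel]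
    rw [orderTop_neg, orderTop_one]; exact h3

/-- Coefficientwise ring hom. -/
noncomputable def hmap {κ' : Type} [Field κ'] (φ : κ →+* κ') : Hh κ →+* Hh κ' where
  toFun f := HahnSeries.map f φ
  map_zero' := by ext g; simp
  map_one' := by
    ext g
    rw [HahnSeries.map_coeff, coeff_one, coeff_one]; split_ifs <;> simp
  map_add' a b := by ext g; simp
  map_mul' a b := by
    ext g
    have h1 : ∀ f : Hh κ, (HahnSeries.map f φ).support = f.support := by
      intro f; ext x
      simp only [mem_support, HahnSeries.map_coeff, ne_eq, map_eq_zero]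
    rw [HahnSeries.map_coeff, coeff_mul, coeff_mul_left' a.isPWO_support (h1 a).le, map_sum]
    have : ∀ (s : Set ℝ) (hs : s.IsPWO), s = b.support →
      ∑ x ∈ Finset.addAntidiagonal a.isPWO_support b.isPWO_support g, φ (a.coeff x.1 * b.coeff x.2) =
      ∑ x ∈ Finset.addAntidiagonal a.isPWO_support hs g,
        (HahnSeries.map a φ).coeff x.1 * (HahnSeries.map b φ).coeff x.2 := by
      rintro s hs rfl
      apply Finset.sum_congr rfl
      intro x _
      rw [map_mul]; rfl
    exact this _ _ (h1 b)

theorem hmap_coeff {κ' : Type} [Field κ'] (φ : κ →+* κ') (f : Hh κ) (g : ℝ) :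
    (hmap φ f).coeff g = φ (f.coeff g) := rfl

theorem hmap_C {κ' : Type} [Field κ'] (φ : κ →+* κ') (c : κ) : hmap φ (C c) = C (φ c) := by
  ext g
  rw [hmap_coeff, C_apply, C_apply, coeff_single, coeff_single]
  split_ifs <;> simp

theorem hmap_ord {κ' : Type} [Field κ'] (φ : κ →+* κ') (f : Hh κ) :
    (hmap φ f).orderTop = f.orderTop := by
  apply le_antisymm
  · rw [le_orderTop_iff_forall]
    intro g hg
    have := coeff_eq_zero_of_lt_orderTop hg
    rw [hmap_coeff, map_eq_zero] at this
    exact this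
  · rw [le_orderTop_iff_forall]
    intro g hg
    rw [hmap_coeff, coeff_eq_zero_of_lt_orderTop hg, map_zero]

theorem hmap_lc {κ' : Type} [Field κ'] (φ : κ →+* κ') (f : Hh κ) : hlc (hmap φ f) = φ (hlc f) := by
  by_cases hf : f = 0
  · simp [hf]
  have h2 : hmap φ f ≠ 0 := by
    rw [Ne, map_eq_zero_iff _ (hmap φ).injective]; exact hf
  have h3 : (hmap φ f).order = f.order := by
    have e1 := order_eq_orderTop_of_ne_zero hf
    have e2 := order_eq_orderTop_of_ne_zero h2
    rw [hmap_ord, ← e1] at e2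
    exact_mod_cast e2
  rw [hlc_apply, hlc_apply, leadingCoeff_eq, leadingCoeff_eq, h3, hmap_coeff]

theorem hd_hmap {κ' : Type} [Field κ'] (φ : κ →+* κ') (δ : Der κ) (δ' : Der κ')
    (h : ∀ c, δ' (φ c) = φ (δ c)) (f : Hh κ) : hd δ' (hmap φ f) = hmap φ (hd δ f) := by
  ext g; rw [hd_coeff, hmap_coeff, hmap_coeff, hd_coeff, h]

theorem hd_log (δ : Der κ) {f : Hh κ} (hf : f ≠ 0) :
    (hd δ f / f, δ (hlc f) / hlc f) ∈ hrel κ := by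
  have hc : hlc f ≠ 0 := leadingCoeff_ne_zero.2 hf
  set c := δ (hlc f) / hlc f with hcdef
  rw [mem_hrel, mem_hpos]
  have h1 : (hd δ f / f - C c) * f = hd δ f - C c * f := by field_simp
  have e1 := order_eq_orderTop_of_ne_zero hf
  have h2 : f.orderTop < (hd δ f - C c * f).orderTop := by
    rw [← e1]
    by_contra hle
    rw [not_lt] at hle
    have hle2 : ((f.order : ℝ) : WithTop ℝ) ≤ (hd δ f - C c * f).orderTop := by
      rw [e1]
      refine le_trans (le_min (hd_order δ f) ?_) min_orderTop_le_orderTop_sub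
      rw [orderTop_mul]
      exact le_add_of_nonneg_left (ord_C c)
    have h3 := coeff_orderTop_ne (le_antisymm hle hle2)
    apply h3
    rw [coeff_sub, hd_coeff, C_mul_eq_smul, coeff_smul, smul_eq_mul, ← leadingCoeff_eq, ← hlc_apply,
      hcdef]
    field_simp; ring
  rw [← h1, orderTop_mul, ← e1] at h2
  by_contra h0
  rw [not_lt] at h0
  have := add_le_add_left h0 (f.order : WithTop ℝ)
  rw [zero_add] at this
  exact absurd h2 (not_lt.2 this)

end hahn

/-- Places. -/
structure Pl {K : Type} [Field K] {ι : Type} (D : ι → Der K) where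
  κ : Type
  [fld : Field κ]
  δ : ι → Der κ
  E : K →+* Hh κ
  hE : ∀ i x, E (D i x) = hd (δ i) (E x)

attribute [instance] Pl.fld

/-- Leading coefficient map of a hom. -/
noncomputable def lcE {K κ : Type} [Field K] [Field κ] (E : K →+* Hh κ) : MK K →+* MK κ :=
  spc (hlc.comp E.toMonoidWithZeroHom) (by
    intro x y hx hy h
    exact hlc_st (E x) (E y) (by simpa using hx) (by simpa using hy) (by rw [← map_add, h, map_one]))

theorem lcE_sy {K κ : Type} [Field K] [Field κ] (E : K →+* Hh κ) (x : K) :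
    lcE E (sy x) = sy (hlc (E x)) := spc_sy _ _ x

theorem lcE_homog {K κ : Type} [Field K] [Field κ] (E : K →+* Hh κ) : Homog (lcE E) := spc_homog _ _

theorem lcE_mp {K K' κ : Type} [Field K] [Field K'] [Field κ] (E : K →+* Hh κ) (φ : K' →+* K) (z : MK K') :
    lcE E (mp φ z) = lcE (E.comp φ) z := by
  have : (lcE E).comp (mp φ) = lcE (E.comp φ) := by
    apply MK.hom_ext
    intro x
    rw [RingHom.comp_apply, mp_sy, lcE_sy, lcE_sy]; rfl
  rw [← this]; rfl

theorem lcE_hmap {K κ κ' : Type} [Field K] [Field κ] [Field κ'] (E : K →+* Hh κ) (φ : κ →+* κ') (z : MK K) :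
    lcE ((hmap φ).comp E) z = mp φ (lcE E z) := by
  have : (mp φ).comp (lcE E) = lcE ((hmap φ).comp E) := by
    apply MK.hom_ext
    intro x
    rw [RingHom.comp_apply, lcE_sy, mp_sy, lcE_sy, ← hmap_lc]; rfl
  rw [← this]; rfl

/-- Lemma R. -/
theorem Pl.red {K : Type} [Field K] {ι : Type} {D : ι → Der K} (P : Pl D) (z : MK K) (L : List ι) :
    (P.E (fm D z L), fm P.δ (lcE P.E z) L) ∈ hrel P.κ := by
  have := fm_rel D P.δ ((hrel P.κ).comap (RingHom.prodMap P.E (RingHom.id P.κ))) (lcE P.E)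
    (fun x => hlc (P.E x)) (lcE_sy P.E) (by
      intro x i hx
      rw [Subring.mem_comap]
      show (P.E (D i x / x), P.δ i (hlc (P.E x)) / hlc (P.E x)) ∈ hrel P.κ
      rw [map_div₀, P.hE]
      exact hd_log _ (by simpa using hx)) z L
  exact this

end Izh

namespace Izh
open Polynomial

theorem der_desc {A B : Type} [CommRing A] [CommRing B] (μ : A →+* B) (hμ : Function.Surjective μ)
    (δ : Der A) (h : ∀ q, μ q = 0 → μ (δ q) = 0) : ∃ d : Der B, ∀ q, d (μ q) = μ (δ q) := by
  have sj : ∀ b, μ (Function.surjInv hμ b) = b := Function.surjInv_eq hμ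
  have key : ∀ q x, μ q = x → μ (δ (Function.surjInv hμ x)) = μ (δ q) := by
    intro q x hx
    rw [← sub_eq_zero, ← map_sub, ← map_sub]
    apply h
    rw [map_sub, sj, hx, sub_self]
  refine ⟨mkDer (AddMonoidHom.mk' (fun x => μ (δ (Function.surjInv hμ x))) ?_) ?_, ?_⟩
  · intro a b
    rw [key (Function.surjInv hμ a + Function.surjInv hμ b) (a + b)
      (by rw [map_add, sj, sj]), map_add, map_add]
  · intro a b
    simp only [AddMonoidHom.mk'_apply]
    rw [key (Function.surjInv hμ a * Function.surjInv hμ b) (a * b)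
      (by rw [map_mul, sj, sj]), Derivation.leibniz]
    simp only [smul_eq_mul, map_add, map_mul, sj]
  · intro q
    exact key q _ rfl

section kum
variable {K : Type} [Field K] {p : ℕ} [hp : Fact p.Prime] [CharP K p]

theorem kroot {e : K} {π : MI K} (h : π.1 ∣ X ^ (p - 1) - C e) :
    (AdjoinRoot.root π.1) ^ (p - 1) = AdjoinRoot.of π.1 e := by
  have := AdjoinRoot.mk_eq_zero.2 h
  rw [map_sub, map_pow, AdjoinRoot.mk_X, AdjoinRoot.mk_C, sub_eq_zero] at this
  exact this

theorem cast_pred : ((p - 1 : ℕ) : K) = -1 := by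
  rw [Nat.cast_sub hp.out.one_le, CharP.cast_eq_zero]; simp

theorem kd_dvd {e : K} (he : e ≠ 0) {π : MI K} (h : π.1 ∣ X ^ (p - 1) - C e) (d : Der K) :
    π.1 ∣ pco d π.1 + (-(X * C (d e / e))) * derivative π.1 := by
  have hp2 := hp.out.two_le
  set δ : K[X] → K[X] := fun f => pco d f + (-(X * C (d e / e))) * derivative f with hδ
  have hmul : ∀ f g, δ (f * g) = f * δ g + g * δ f := by
    intro f g
    simp only [hδ, Derivation.leibniz, smul_eq_mul, derivative_mul]
    ring
  have hX : X * derivative (X ^ (p - 1) - C e) = -(X ^ (p - 1) : K[X]) := by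
    rw [derivative_sub, derivative_C, sub_zero, derivative_X_pow, cast_pred]
    obtain ⟨q, hq⟩ : ∃ q, p = q + 2 := ⟨p - 2, by omega⟩
    have e1 : p - 1 = q + 1 := by omega
    rw [e1]
    simp [pow_succ]
    ring
  have hG : δ (X ^ (p - 1) - C e) = C (d e / e) * (X ^ (p - 1) - C e) := by
    simp only [hδ]
    rw [neg_mul, mul_comm X, mul_assoc, hX, map_sub, Derivation.leibniz_pow, pco_X, pco_C]
    have : C (d e) = C (d e / e) * C e := by rw [← C_mul]; congr 1; field_simp
    rw [this]; simp only [smul_zero, zero_sub]; ring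
  obtain ⟨g, hg⟩ := h
  have h1 : π.1 ∣ g * δ π.1 := by
    have : g * δ π.1 = δ (π.1 * g) - π.1 * δ g := by rw [hmul]; ring
    rw [this, ← hg, hG, hg]
    exact dvd_sub ((Dvd.intro _ rfl).mul_left _) (Dvd.intro _ rfl)
  rcases π.prime.dvd_or_dvd h1 with h2 | h2
  · exfalso
    obtain ⟨k, hk⟩ := h2
    have h3 : π.1 ∣ derivative (X ^ (p - 1) - C e) := by
      rw [hg, hk]
      refine ⟨derivative π.1 * k + (derivative π.1 * k + π.1 * derivative k), ?_⟩
      rw [derivative_mul, derivative_mul]; ring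
    have h4 : π.1 ∣ C e := by
      have : C e = -(X * derivative (X ^ (p - 1) - C e)) - (X ^ (p - 1) - C e) := by
        rw [hX]; ring
      rw [this]
      exact dvd_sub ((h3.mul_left _).neg_right) ⟨g, hg⟩
    exact π.2.2.not_isUnit (isUnit_of_dvd_unit h4 (isUnit_C.2 (isUnit_iff_ne_zero.2 he)))
  · exact h2

theorem exists_kder {e : K} (he : e ≠ 0) {π : MI K} (h : π.1 ∣ X ^ (p - 1) - C e) (d : Der K) :
    ∃ d' : Der π.κ, ∀ a, d' (AdjoinRoot.of π.1 a) = AdjoinRoot.of π.1 (d a) := by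
  obtain ⟨d', hd⟩ := der_desc (AdjoinRoot.mk π.1) AdjoinRoot.mk_surjective
    (mkDer (AddMonoidHom.mk' (fun f : K[X] => pco d f + (-(X * C (d e / e))) * derivative f)
      (by intro a b; rw [map_add, derivative_add]; ring))
      (by
        intro f g
        simp only [AddMonoidHom.mk'_apply, Derivation.leibniz, smul_eq_mul, derivative_mul]
        ring)) (by
      intro q hq
      rw [AdjoinRoot.mk_eq_zero] at hq ⊢
      obtain ⟨g, rfl⟩ := hq
      rw [Derivation.leibniz]
      refine dvd_add (Dvd.intro _ rfl) (Dvd.dvd.mul_left ?_ _)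
      exact kd_dvd he h d)
  refine ⟨d', fun a => ?_⟩
  rw [← AdjoinRoot.mk_C, hd, mkDer_apply, AddMonoidHom.mk'_apply, pco_C, derivative_C, mul_zero, add_zero,
    AdjoinRoot.mk_C]

theorem kroot_ne {e : K} (he : e ≠ 0) {π : MI K} (h : π.1 ∣ X ^ (p - 1) - C e) :
    AdjoinRoot.root π.1 ≠ 0 := by
  intro h0
  have := kroot h
  rw [h0, zero_pow (by have := hp.out.two_le; omega)] at this
  exact he ((map_eq_zero _).1 this.symm)

theorem kuniq {e : K} (he : e ≠ 0) {π : MI K} (h : π.1 ∣ X ^ (p - 1) - C e) {L : Type} [Field L]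
    (φ : π.κ →+* L) (Δ1 Δ2 : π.κ → L) (ha1 : ∀ x y, Δ1 (x + y) = Δ1 x + Δ1 y)
    (ha2 : ∀ x y, Δ2 (x + y) = Δ2 x + Δ2 y)
    (h1 : ∀ x y, Δ1 (x * y) = φ x * Δ1 y + φ y * Δ1 x)
    (h2 : ∀ x y, Δ2 (x * y) = φ x * Δ2 y + φ y * Δ2 x)
    (hK : ∀ a, Δ1 (AdjoinRoot.of π.1 a) = Δ2 (AdjoinRoot.of π.1 a)) (x) : Δ1 x = Δ2 x := by
  set Δ : π.κ → L := fun x => Δ1 x - Δ2 x with hΔ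
  have ha : ∀ x y, Δ (x + y) = Δ x + Δ y := by
    intro x y; simp only [hΔ, ha1, ha2]; ring
  have hm : ∀ x y, Δ (x * y) = φ x * Δ y + φ y * Δ x := by
    intro x y; simp only [hΔ, h1, h2]; ring
  have h0 : ∀ a, Δ (AdjoinRoot.of π.1 a) = 0 := by
    intro a; simp only [hΔ, hK, sub_self]
  have hpow : ∀ (n : ℕ) x, Δ (x ^ (n + 1)) = (n + 1) * φ x ^ n * Δ x := by
    intro n x
    induction n with
    | zero => simp
    | succ n ih => rw [pow_succ, hm, ih, map_pow]; push_cast; ring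
  have hL : CharP L p := charP_of_injective_ringHom (φ.comp (AdjoinRoot.of π.1)).injective p
  have hr : Δ (AdjoinRoot.root π.1) = 0 := by
    obtain ⟨q, hq⟩ : ∃ q, p = q + 2 := ⟨p - 2, by have := hp.out.two_le; omega⟩
    have e1 : p - 1 = q + 1 := by omega
    have := hpow q (AdjoinRoot.root π.1)
    rw [← e1, kroot h, h0] at this
    have e2 : ((q : L) + 1) = -1 := by
      have := cast_pred (K := L) (p := p)
      rw [e1] at this; exact_mod_cast this
    rw [e2] at this
    have e3 : φ (AdjoinRoot.root π.1) ≠ 0 := by simpa using kroot_ne he h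
    have := this.symm
    rw [mul_eq_zero] at this
    exact this.resolve_left (mul_ne_zero (neg_ne_zero.2 one_ne_zero) (pow_ne_zero _ e3))
  have hr2 : ∀ n, Δ (AdjoinRoot.root π.1 ^ n) = 0 := by
    intro n
    cases n with
    | zero => rw [pow_zero, ← map_one (AdjoinRoot.of π.1)]; exact h0 1
    | succ n => rw [hpow, hr, mul_zero]
  have : Δ x = 0 := by
    obtain ⟨f, rfl⟩ := AdjoinRoot.mk_surjective x
    induction f using Polynomial.induction_on' with
    | add f g hf hg => rw [map_add, ha, hf, hg, add_zero]
    | monomial n a =>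
      rw [← C_mul_X_pow_eq_monomial, map_mul, map_pow, AdjoinRoot.mk_C, AdjoinRoot.mk_X, hm, h0, hr2]
      simp
  exact sub_eq_zero.1 this

theorem iter_leib (d : Der K) (x y : K) : d^[p] (x * y) = x * d^[p] y + y * d^[p] x := by
  haveI : CharP (Module.End ℤ K) p := by
    have hK : ∀ n : ℕ, ((n : Module.End ℤ K) = 0) ↔ (n : K) = 0 := by
      intro n
      constructor
      · intro h
        have := congrArg (fun T => T (1 : K)) h
        simpa using this
      · intro h
        apply LinearMap.ext
        intro x
        simp [h]
    exact ⟨fun n => by rw [hK, CharP.cast_eq_zero_iff K p]⟩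
  have key := ad_pow (p := p) (opc d 0) (LinearMap.mulLeft ℤ x) (fun n => LinearMap.mulLeft ℤ (d^[n] x)) rfl (by
    intro n
    rw [opc_ad, ← Function.iterate_succ_apply' (f := d)])
  have h1 : ∀ n z, (opc d 0 ^ n) z = d^[n] z := by
    intro n
    induction n with
    | zero => intro z; rfl
    | succ n ih =>
      intro z
      rw [pow_succ, Module.End.mul_apply, ih, opc_apply, zero_mul, add_zero, Function.iterate_succ_apply]
  have := congrArg (fun T => T y) key
  simp only [LinearMap.sub_apply, Module.End.mul_apply, LinearMap.mulLeft_apply, h1] at this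
  rw [sub_eq_iff_eq_add] at this
  rw [this]; ring

theorem kPD {m : ℕ} (𝒟 : PD p m K) {e : K} (he : e ≠ 0) {π : MI K} (h : π.1 ∣ X ^ (p - 1) - C e) :
    ∃ 𝒟' : PD p m π.κ, ∀ i a, 𝒟'.D i (AdjoinRoot.of π.1 a) = AdjoinRoot.of π.1 (𝒟.D i a) := by
  choose D' hD' using fun i => exists_kder he h (𝒟.D i)
  haveI : CharP π.κ p := charP_of_injective_ringHom (AdjoinRoot.of π.1).injective p
  have hit : ∀ i n a, (D' i)^[n] (AdjoinRoot.of π.1 a) = AdjoinRoot.of π.1 ((𝒟.D i)^[n] a) := by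
    intro i n a
    induction n generalizing a with
    | zero => rfl
    | succ n ih => rw [Function.iterate_succ_apply, Function.iterate_succ_apply, hD', ih]
  refine ⟨⟨D', ?_, ?_, fun i => AdjoinRoot.of π.1 (𝒟.b i), ?_, ?_⟩, hD'⟩
  · intro i j x
    have := kuniq he h (RingHom.id _) (fun x => D' i (D' j x) - D' j (D' i x)) (fun x => 0)
      (by intro x y; simp only [map_add]; ring) (by intros; simp)
      (by intro x y; simp only [Derivation.leibniz, map_add, smul_eq_mul, RingHom.id_apply]; ring)
      (by intros; simp)
      (by intro a; simp only [hD', 𝒟.comm i j, sub_self]) x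
    exact sub_eq_zero.1 this
  · intro i x
    refine kuniq he h (RingHom.id _) (fun x => (D' i)^[p] x) (fun x => D' i x) ?_ ?_ ?_ ?_ ?_ x
    · intro x y; exact iterate_map_add (D' i) p x y
    · intro x y; simp
    · intro x y; exact iter_leib (D' i) x y
    · intro x y; simp
    · intro a; simp only [hit, hD', 𝒟.pow]
  · intro i; simpa using 𝒟.b_ne i
  · intro i j
    rw [hD', 𝒟.D_b]; split_ifs <;> simp

open Classical in
theorem ksplit {L : Type} [Field L] [CharP L p] {ρ : L} (hρ : ρ ≠ 0) {e : L} (h : ρ ^ (p - 1) = e)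
    {f : L[X]} (hf : f ∣ X ^ (p - 1) - C e) (hm : f.Monic) :
    f = ∏ θ ∈ f.roots.toFinset, (X - C θ) := by
  have hp2 := hp.out.two_le
  have hG0 : (X ^ (p - 1) - C e : L[X]).Monic := monic_X_pow_sub_C e (by omega)
  letI : Algebra (ZMod p) L := ZMod.algebra L p
  have hsub : (Finset.univ : Finset (ZMod p)ˣ).image (fun u : (ZMod p)ˣ => algebraMap (ZMod p) L (u : ZMod p) * ρ) ⊆
      (X ^ (p - 1) - C e : L[X]).roots.toFinset := by
    intro x hx
    obtain ⟨u, -, rfl⟩ := Finset.mem_image.1 hx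
    rw [Multiset.mem_toFinset, mem_roots hG0.ne_zero, IsRoot.def]
    simp only [eval_sub, eval_pow, eval_X, eval_C, mul_pow, h]
    rw [← map_pow, ← Units.val_pow_eq_pow_val, ZMod.units_pow_card_sub_one_eq_one]
    simp
  have hcard := Finset.card_le_card hsub
  rw [Finset.card_image_of_injective, Finset.card_univ, ZMod.card_units] at hcard
  swap
  · intro u v huv
    have := mul_right_cancel₀ hρ huv
    exact Units.ext ((algebraMap (ZMod p) L).injective this)
  have hdeg : (X ^ (p - 1) - C e : L[X]).natDegree = p - 1 := natDegree_X_pow_sub_C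
  have h1 : (X ^ (p - 1) - C e : L[X]).roots.toFinset.card ≤ (X ^ (p - 1) - C e : L[X]).roots.card :=
    Multiset.toFinset_card_le _
  have h2 := (X ^ (p - 1) - C e : L[X]).card_roots'
  rw [hdeg] at h2
  have hnd : (X ^ (p - 1) - C e : L[X]).roots.Nodup := by
    rw [← Multiset.dedup_eq_self]
    apply Multiset.eq_of_le_of_card_le (Multiset.dedup_le _)
    show _ ≤ (X ^ (p - 1) - C e : L[X]).roots.toFinset.card
    omega
  have hs : (X ^ (p - 1) - C e : L[X]).Splits := by
    rw [splits_iff_card_roots, hdeg]; omega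
  have hfs : f.Splits := hs.of_dvd hG0.ne_zero hf
  have hfn : f.roots.Nodup := Multiset.nodup_of_le (roots.le_of_dvd hG0.ne_zero hf) hnd
  conv_lhs => rw [hfs.eq_prod_roots, hm.leadingCoeff, C_1, one_mul]
  rw [Finset.prod, Multiset.toFinset_val, hfn.dedup]

end kum
end Izh

namespace Izh
open Polynomial

theorem exists_kfac {K : Type} [Field K] {p : ℕ} [hp : Fact p.Prime] (e : K) :
    ∃ π : MI K, π.1 ∣ X ^ (p - 1) - C e := by
  have hp2 := hp.out.two_le
  have h1 : ¬ IsUnit (X ^ (p - 1) - C e : K[X]) := by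
    apply not_isUnit_of_natDegree_pos
    rw [natDegree_X_pow_sub_C]; omega
  obtain ⟨g, hm, hi, hd⟩ := exists_monic_irreducible_factor _ h1
  exact ⟨⟨g, hm, hi⟩, hd⟩

theorem kdeg {K : Type} [Field K] {p : ℕ} [hp : Fact p.Prime] {e : K} {π : MI K}
    (h : π.1 ∣ X ^ (p - 1) - C e) : π.1.natDegree ∣ (p - 1).factorial := by
  have hp2 := hp.out.two_le
  apply Nat.dvd_factorial
  · exact π.2.2.natDegree_pos
  · have := natDegree_le_of_dvd h (monic_X_pow_sub_C e (by omega)).ne_zero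
    rwa [natDegree_X_pow_sub_C] at this

theorem kNR {K : Type} [Field K] {p : ℕ} [hp : Fact p.Prime] {e : K} {π : MI K}
    (h : π.1 ∣ X ^ (p - 1) - C e) {β : MK K} (hb : mp (AdjoinRoot.of π.1) β = 0) :
    (p - 1).factorial • β = 0 := by
  obtain ⟨k, hk⟩ := kdeg h
  rw [hk, mul_comm, mul_smul, NR π hb, smul_zero]

section hahn2
open HahnSeries
variable {κ : Type} [Field κ]

theorem charP_hh {p : ℕ} [CharP κ p] : CharP (Hh κ) p :=
  charP_of_injective_ringHom (HahnSeries.C : κ →+* Hh κ).injective p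

theorem charP_of_place {K : Type} [Field K] {p : ℕ} [CharP K p] (E : K →+* Hh κ) : CharP κ p := by
  haveI : CharP (Hh κ) p := charP_of_injective_ringHom E.injective p
  exact (RingHom.charP_iff (HahnSeries.C : κ →+* Hh κ) (RingHom.injective _) p).2 this

theorem hpos_of {u : Hh κ} (h0 : u.orderTop = 0) (h1 : hlc u = 1) : u - 1 ∈ hpos κ := by
  rw [mem_hpos]
  have hu : u ≠ 0 := by rintro rfl; simp at h0
  have e1 : u.order = 0 := by
    have := order_eq_orderTop_of_ne_zero hu
    rw [h0] at this; exact_mod_cast this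
  have hle : 0 ≤ (u - 1).orderTop := by
    refine le_trans (le_min ?_ ?_) min_orderTop_le_orderTop_sub
    · rw [h0]
    · rw [orderTop_one]
  refine lt_of_le_of_ne hle ?_
  intro h
  apply coeff_orderTop_ne (x := u - 1) (g := (0 : ℝ)) (by rw [← h]; rfl)
  rw [hlc_apply, leadingCoeff_eq, e1] at h1
  rw [HahnSeries.coeff_sub, h1]; simp

theorem hroot {p : ℕ} [hp : Fact p.Prime] [CharP κ p] {u : Hh κ} (hu : u - 1 ∈ hpos κ) :
    ∃ v : Hh κ, v ^ (p - 1) = u := by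
  have hp2 := hp.out.two_le
  have hunit : IsUnit ((p - 1 : ℕ) : ℤ_[p]) := by
    rw [Nat.cast_sub hp.out.one_le]
    have : IsUnit (-(1 - ((p : ℕ) : ℤ_[p]))) := by
      apply IsUnit.neg
      apply IsLocalRing.isUnit_one_sub_self_of_mem_nonunits
      exact (PadicInt.prime_p (p := p)).not_unit
    simpa using this
  obtain ⟨r, hr⟩ := hunit.exists_right_inv
  have hps : ∃ f : PowerSeries ℤ_[p], f ^ (p - 1) = 1 + PowerSeries.X := by
    refine ⟨PowerSeries.binomialSeries ℤ_[p] r, ?_⟩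
    have : ∀ n : ℕ, PowerSeries.binomialSeries ℤ_[p] r ^ n = PowerSeries.binomialSeries ℤ_[p] ((n : ℤ_[p]) * r) := by
      intro n
      induction n with
      | zero => simp
      | succ n ih =>
        rw [pow_succ, ih, ← PowerSeries.binomialSeries_add]; congr 1; push_cast; ring
    rw [this, hr]
    have := PowerSeries.binomialSeries_nat (R := ℤ_[p]) (A := ℤ_[p]) 1
    simpa using this
  obtain ⟨f, hf⟩ := hps
  let ψ : ℤ_[p] →+* κ := (ZMod.castHom (dvd_refl p) κ).comp PadicInt.toZMod
  have h2 : (PowerSeries.map ψ f) ^ (p - 1) = 1 + PowerSeries.X := by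
    rw [← map_pow, hf, map_add, map_one, PowerSeries.map_X]
  refine ⟨PowerSeries.heval (u - 1) (PowerSeries.map ψ f), ?_⟩
  rw [← map_pow, h2, map_add, map_one, PowerSeries.heval_X _ hu]
  ring

end hahn2

section ext
variable {K : Type} [Field K] {p : ℕ} [hp : Fact p.Prime] [CharP K p] {m : ℕ}

theorem place_ext (𝒟 : PD p m K) {e : K} (he : e ≠ 0) {π : MI K} (h : π.1 ∣ X ^ (p - 1) - C e)
    (𝒟' : PD p m π.κ) (h𝒟 : ∀ i a, 𝒟'.D i (AdjoinRoot.of π.1 a) = AdjoinRoot.of π.1 (𝒟.D i a))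
    (P : Pl 𝒟.D) : ∃ (P' : Pl 𝒟'.D) (φ : P.κ →+* P'.κ),
      (∀ z, mp φ z = 0 → (p - 1).factorial • z = 0) ∧
      ∀ x, P'.E (AdjoinRoot.of π.1 x) = hmap φ (P.E x) := by
  have hp2 := hp.out.two_le
  haveI := charP_of_place (p := p) P.E
  have hEe : P.E e ≠ 0 := by simpa using he
  set ε := hlc (P.E e) with hε
  have hε0 : ε ≠ 0 := HahnSeries.leadingCoeff_ne_zero.2 hEe
  obtain ⟨π₁, hπ₁⟩ := exists_kfac (p := p) ε
  set φ : P.κ →+* π₁.κ := AdjoinRoot.of π₁.1 with hφ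
  haveI : CharP π₁.κ p := charP_of_injective_ringHom φ.injective p
  haveI : CharP (Hh π₁.κ) p := charP_hh
  choose δ' hδ' using fun i => exists_kder hε0 hπ₁ (P.δ i)
  set γ := (P.E e).order with hγ
  set E₁ : K →+* Hh π₁.κ := (hmap φ).comp P.E with hE₁
  have hτ : ∃ τ : Hh π₁.κ, τ ^ (p - 1) = E₁ e := by
    have hu : E₁ e * HahnSeries.single (-γ) ((φ ε)⁻¹) - 1 ∈ hpos π₁.κ := by
      apply hpos_of
      · have h1 : (φ ε)⁻¹ ≠ 0 := inv_ne_zero (by simpa using hε0)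
        rw [HahnSeries.orderTop_mul, HahnSeries.orderTop_single h1, hE₁, RingHom.comp_apply, hmap_ord,
          ← HahnSeries.order_eq_orderTop_of_ne_zero hEe, ← hγ, ← WithTop.coe_add, add_neg_cancel]
        rfl
      · rw [map_mul, hE₁, RingHom.comp_apply, hmap_lc, ← hε, hlc_apply, HahnSeries.leadingCoeff_of_single]
        exact mul_inv_cancel₀ (by simpa using hε0)
    obtain ⟨v, hv⟩ := hroot (p := p) hu
    refine ⟨HahnSeries.single (γ / ((p - 1 : ℕ) : ℝ)) (AdjoinRoot.root π₁.1) * v, ?_⟩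
    rw [mul_pow, hv, HahnSeries.single_pow, kroot hπ₁, nsmul_eq_mul, mul_div_cancel₀, mul_comm, mul_assoc,
      HahnSeries.single_mul_single, neg_add_cancel, inv_mul_cancel₀ (by simpa using hε0)]
    · simp
    · have : p - 1 ≠ 0 := by omega
      exact_mod_cast this
  obtain ⟨τ, hτ⟩ := hτ
  have hτ0 : τ ≠ 0 := by
    rintro rfl
    rw [zero_pow (by omega)] at hτ
    have : e = 0 := by simpa using hτ.symm
    exact he this
  classical
  have hsp := ksplit (p := p) hτ0 hτ (f := π.1.map E₁) (by
    obtain ⟨g, hg⟩ := h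
    refine ⟨g.map E₁, ?_⟩
    rw [← Polynomial.map_mul, ← hg]; simp) (π.2.1.map E₁)
  have hroot : ∃ τ', (π.1.map E₁).IsRoot τ' := by
    by_contra hno
    push Not at hno
    have hemp : (π.1.map E₁).roots.toFinset = ∅ := by
      rw [Finset.eq_empty_iff_forall_notMem]
      intro x hx
      rw [Multiset.mem_toFinset] at hx
      exact hno x (isRoot_of_mem_roots hx)
    have h1 : (π.1.map E₁).natDegree = 0 := by
      rw [hsp]
      convert natDegree_one (R := Hh π₁.κ)
      convert Finset.prod_empty
    rw [π.2.1.natDegree_map] at h1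
    have := π.2.2.natDegree_pos
    omega
  obtain ⟨τ', hτ'⟩ := hroot
  let E' : π.κ →+* Hh π₁.κ := AdjoinRoot.lift E₁ τ' (by
    rw [IsRoot.def, eval_map] at hτ'; exact hτ')
  have hE' : ∀ x, E' (AdjoinRoot.of π.1 x) = E₁ x := fun x => AdjoinRoot.lift_of _
  refine ⟨⟨π₁.κ, δ', E', ?_⟩, φ, ?_, hE'⟩
  · intro i x
    refine kuniq he h E' (fun x => E' (𝒟'.D i x)) (fun x => hd (δ' i) (E' x)) ?_ ?_ ?_ ?_ ?_ x
    · intro x y; simp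
    · intro x y; simp
    · intro x y; simp [Derivation.leibniz]
    · intro x y; simp [Derivation.leibniz]
    · intro a
      simp only [h𝒟, hE', hE₁, RingHom.comp_apply, P.hE]
      exact (hd_hmap _ _ _ (hδ' i) _).symm
  · intro z hz
    exact kNR hπ₁ hz

end ext
end Izh

namespace Izh
open Polynomial

theorem fm_mp {K K' : Type} [Field K] [Field K'] {ι : Type} (D : ι → Der K) (D' : ι → Der K')
    (ψ : K →+* K') (h : ∀ i x, D' i (ψ x) = ψ (D i x)) (z : MK K) (L : List ι) :
    fm D' (mp ψ z) L = ψ (fm D z L) := by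
  let Γ : Subring (K × K') := RingHom.eqLocus (RingHom.snd K K') (ψ.comp (RingHom.fst K K'))
  exact fm_rel D D' Γ (mp ψ) ψ (mp_sy ψ) (by
    intro x i hx
    show D' i (ψ x) / ψ x = ψ (D i x / x)
    rw [h, map_div₀]) z L

theorem Im_cmul {K : Type} [Field K] {ι : Type} {D : ι → Der K} {S : Set ι} {c : K}
    (hc : ∀ i ∈ S, D i c = 0) {x : K} (hx : x ∈ Im D S) : c * x ∈ Im D S := by
  refine Im_ind (AddMonoidHom.mulLeft c) (Im D S) ?_ hx
  intro i hi x
  rw [AddMonoidHom.coe_mulLeft, ← D_mul_const _ (hc i hi)]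
  exact Im_mem hi _

theorem Im_map {K K' : Type} [Field K] [Field K'] {ι : Type} {D : ι → Der K} {D' : ι → Der K'}
    (ψ : K →+* K') (h : ∀ i x, D' i (ψ x) = ψ (D i x)) {S : Set ι} {x : K} (hx : x ∈ Im D S) :
    ψ x ∈ Im D' S := by
  refine Im_ind ψ.toAddMonoidHom (Im D' S) ?_ hx
  intro i hi x
  show ψ (D i x) ∈ _
  rw [← h]
  exact Im_mem hi _

theorem Im_empty {K : Type} [Field K] {ι : Type} {D : ι → Der K} {S : Set ι} (hS : S = ∅) {x : K}
    (hx : x ∈ Im D S) : x = 0 := by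
  have := Im_ind (AddMonoidHom.id K) ⊥ (fun i hi _ => by simp [hS] at hi) hx
  simpa using this

section ord
variable {K : Type} [Field K] {p m : ℕ} [hp : Fact p.Prime] (𝒟 : PD p m K) (P : Pl 𝒟.D)

theorem ord_iter (i : Fin m) (n : ℕ) (x : K) : (P.E x).orderTop ≤ (P.E ((𝒟.D i)^[n] x)).orderTop := by
  induction n generalizing x with
  | zero => rfl
  | succ n ih =>
    rw [Function.iterate_succ_apply]
    refine le_trans ?_ (ih _)
    rw [P.hE]
    exact hd_order _ _

theorem ord_prj (i : Fin m) (x : K) : (P.E x).orderTop ≤ (P.E (prj p (𝒟.D i) x)).orderTop := by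
  rw [prj_apply, map_sub]
  exact le_trans (le_min le_rfl (ord_iter 𝒟 P i _ x)) HahnSeries.min_orderTop_le_orderTop_sub

theorem ord_prL (L : List (Fin m)) (x : K) : (P.E x).orderTop ≤ (P.E (𝒟.prL L x)).orderTop := by
  induction L with
  | nil => rfl
  | cons i L ih => exact le_trans ih (ord_prj 𝒟 P i _)

theorem ord_nonneg_of_pow {x y : K} (hx : x ≠ 0) (h : (P.E x).orderTop ≤ (P.E y).orderTop) (hy : y = x ^ p) :
    0 ≤ (P.E x).orderTop := by
  have hE : P.E x ≠ 0 := by simpa using hx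
  have e1 := HahnSeries.order_eq_orderTop_of_ne_zero hE
  have hE2 : P.E x ^ p ≠ 0 := pow_ne_zero _ hE
  have e2 := HahnSeries.order_eq_orderTop_of_ne_zero hE2
  rw [hy, map_pow, ← e1, ← e2, HahnSeries.order_pow] at h
  have h1 : (P.E x).order ≤ p • (P.E x).order := by exact_mod_cast h
  rw [nsmul_eq_mul] at h1
  rw [← e1]
  have h2 : (1 : ℝ) < p := by exact_mod_cast hp.out.one_lt
  have : 0 ≤ (P.E x).order := by nlinarith
  exact_mod_cast this

end ord

set_option maxHeartbeats 1000000 in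
theorem facW {p m : ℕ} [hp : Fact p.Prime] (L : List (Fin m)) : ∀ (K : Type) [Field K] [CharP K p]
    (𝒟 : PD p m K) (a : K), a ≠ 0 → Dec L → 𝒟.condB L a → 𝒟.condT L a →
    ∃ W ∈ dg K L.length, ∃ N M : ℕ, N.Coprime p ∧ M.Coprime p ∧ Above L (fm 𝒟.D W) ∧
      fm 𝒟.D W L = M * a ∧ ∀ P : Pl 𝒟.D, 0 < (P.E a).orderTop → N • lcE P.E W = 0 := by
  induction L with
  | nil =>
    intro K _ _ 𝒟 a ha _ hB _
    have h1 : a - a ^ p = 0 := Im_empty (by ext; simp) hB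
    have h2 : a ∈ (⊥ : Subfield K) := (Subfield.mem_bot_iff_pow_eq_self K p).2 (sub_eq_zero.1 h1).symm
    rw [← ZMod.fieldRange_castHom_eq_bot p] at h2
    obtain ⟨u, hu⟩ := h2
    obtain ⟨n, rfl⟩ := ZMod.natCast_zmod_surjective u
    rw [map_natCast] at hu
    refine ⟨n • 1, AddSubgroup.nsmul_mem _ one_mem_dg n, 1, 1, Nat.coprime_one_left _, Nat.coprime_one_left _, ?_, ?_, ?_⟩
    · intro J _ hJ hlt
      rw [List.length_eq_zero_iff.1 hJ] at hlt
      exact absurd hlt (lt_irrefl _)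
    · rw [fm_nsmul, fm_one]
      simp [vac, hu]
    · intro P hP
      exfalso
      have hc : P.E a = HahnSeries.C (n : P.κ) := by rw [← hu, map_natCast, map_natCast]
      rw [hc] at hP
      have := C_pos hP
      rw [this, map_zero] at hc
      exact ha (by simpa using hc)
  | cons i L' ih =>
    intro K _ _ 𝒟 a ha hL hB hT
    have hp2 := hp.out.two_le
    have hLi : ∀ k ∈ L', k < i := fun k hk => (List.pairwise_cons.1 hL).1 k hk
    have hL' : Dec L' := (List.pairwise_cons.1 hL).2
    have hcomm : ∀ i j x, 𝒟.D i (𝒟.D j x) = 𝒟.D j (𝒟.D i x) := 𝒟.comm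
    set a0 := prj p (𝒟.D i) a with ha0
    have hconst : prj p (𝒟.D i) (a ^ p) = a ^ p := prj_const p (D_frob _ _)
    have B0 : a0 - a ^ p ∈ Im 𝒟.D {k | k ∈ L'} := by
      have := Im_ind (S := {k | k ∈ i :: L'}) (y := a - a ^ p) (prj p (𝒟.D i)) (Im 𝒟.D {k | k ∈ L'}) (by
        intro k hk x
        rcases List.mem_cons.1 hk with rfl | hk
        · rw [prj_D p (𝒟.pow k)]; exact zero_mem _
        · rw [← prj_comm p (hcomm k i)]; exact Im_mem (D := 𝒟.D) (S := {k | k ∈ L'}) (i := k) (by exact hk) _) hB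
      rwa [map_sub, hconst] at this
    have a0ne : a0 ≠ 0 := by
      intro h0
      rw [h0, zero_sub] at B0
      have := 𝒟.Im_const B0 (by intro j _; rw [map_neg, D_frob, neg_zero])
      rw [neg_eq_zero] at this
      exact ha (pow_eq_zero_iff hp.out.ne_zero |>.1 this)
    have Da : ∀ l, i < l → 𝒟.D l a = 0 := by
      intro l hl
      refine Im_empty ?_ (hT l ?_)
      · ext k
        simp only [Set.mem_setOf_eq, Set.mem_empty_iff_false, iff_false, not_and, not_lt]
        intro hk
        rcases List.mem_cons.1 hk with rfl | hk
        · exact hl.le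
        · exact ((hLi k hk).trans hl).le
      · intro hk
        rcases List.mem_cons.1 hk with rfl | hk
        · exact lt_irrefl _ hl
        · exact lt_asymm hl (hLi l hk)
    have T0 : ∀ l, l ∉ L' → 𝒟.D l a0 ∈ Im 𝒟.D {k | k ∈ L' ∧ l < k} := by
      intro l hl
      rcases eq_or_ne l i with rfl | hli
      · rw [ha0, D_prj p (𝒟.pow l)]; exact zero_mem _
      · rw [ha0, prj_comm p (hcomm l i)]
        refine Im_ind (prj p (𝒟.D i)) _ ?_ (hT l (by simp [hli, hl]))
        rintro k ⟨hk, hlk⟩ x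
        rcases List.mem_cons.1 hk with rfl | hk
        · rw [prj_D p (𝒟.pow k)]; exact zero_mem _
        · rw [← prj_comm p (hcomm k i)]; exact Im_mem (D := 𝒟.D) (S := {k | k ∈ L' ∧ l < k}) (i := k) (by exact ⟨hk, hlk⟩) _
    have Da0 : ∀ l, i ≤ l → 𝒟.D l a0 = 0 := by
      intro l hl
      rcases hl.eq_or_lt with rfl | hl
      · exact D_prj p (𝒟.pow i) _
      · rw [ha0, prj_comm p (hcomm l i), Da l hl, map_zero]
    set e := a ^ p / a0 with he
    have hene : e ≠ 0 := div_ne_zero (pow_ne_zero _ ha) a0ne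
    obtain ⟨π, hπ⟩ := exists_kfac (p := p) e
    obtain ⟨𝒟', h𝒟⟩ := kPD 𝒟 hene hπ
    haveI : CharP π.κ p := charP_of_injective_ringHom (AdjoinRoot.of π.1).injective p
    set ι := AdjoinRoot.of π.1 with hι
    set ρ := AdjoinRoot.root π.1 with hρ
    have hρ0 : ρ ≠ 0 := kroot_ne hene hπ
    have hρp : ρ ^ (p - 1) = ι e := kroot hπ
    set c := ι a / ρ with hc
    have hιa : ι a ≠ 0 := by simpa using ha
    have hc0 : c ≠ 0 := div_ne_zero hιa hρ0
    have hcp : ι a0 = c ^ p * ρ := by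
      have h1 : ρ ^ p = ι e * ρ := by
        rw [← hρp, ← pow_succ]; congr 1; omega
      rw [hc, div_pow, h1, he, map_div₀, map_pow]
      have : ι a0 ≠ 0 := by simpa using a0ne
      field_simp
    have hρa : ρ = (c⁻¹) ^ p * ι a0 := by
      rw [hcp, inv_pow]; field_simp
    have hDρ : ∀ l, 𝒟'.D l ρ = (c⁻¹) ^ p * ι (𝒟.D l a0) := by
      intro l
      conv_lhs => rw [hρa]
      rw [D_mul_const _ (D_frob _ _), h𝒟]
    have B' : 𝒟'.condB L' ρ := by
      have : ρ - ρ ^ p = (c⁻¹) ^ p * ι (a0 - a ^ p) := by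
        rw [map_sub, map_pow, mul_sub, ← hρa, hc, inv_pow, div_pow]
        field_simp
      rw [PD.condB, this]
      exact Im_cmul (fun j _ => D_frob _ _) (Im_map ι h𝒟 B0)
    have T' : 𝒟'.condT L' ρ := by
      intro l hl
      rw [hDρ]
      exact Im_cmul (fun j _ => D_frob _ _) (Im_map ι h𝒟 (T0 l hl))
    have Diρ : 𝒟'.D i ρ = 0 := by rw [hDρ, Da0 i le_rfl, map_zero, mul_zero]
    have haρ : ι a = ρ * c := by rw [hc]; field_simp
    have hprjι : prj p (𝒟'.D i) (ι a) = ι a0 := by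
      have hit : ∀ n x, (𝒟'.D i)^[n] (ι x) = ι ((𝒟.D i)^[n] x) := by
        intro n
        induction n with
        | zero => intro x; rfl
        | succ n ih => intro x; rw [Function.iterate_succ_apply, h𝒟, ih, ← Function.iterate_succ_apply]
      rw [prj_apply, hit, ha0, prj_apply, map_sub]
    have hcprj : prj p (𝒟'.D i) c = c ^ p := by
      rw [haρ, prj_const_mul p Diρ, hcp, mul_comm ρ] at hprjι
      exact mul_right_cancel₀ hρ0 hprjι
    have Dc : ∀ l, i < l → 𝒟'.D l c = 0 := by
      intro l hl
      have h1 : 𝒟'.D l ρ = 0 := by rw [hDρ, Da0 l hl.le, map_zero, mul_zero]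
      have h2 : 𝒟'.D l (ι a) = 0 := by rw [h𝒟, Da l hl, map_zero]
      rw [haρ, D_mul_const _ h1] at h2
      exact (mul_eq_zero.1 h2).resolve_left hρ0
    obtain ⟨W', hW', N, M, hN, hM, hAb, hfm, hpl⟩ := ih π.κ 𝒟' ρ hρ0 hL' B' T'
    obtain ⟨x, hx0, hxi, hxl, hxA⟩ := 𝒟'.solve i hcprj
    set Xx := sy x * W' with hXx
    have hXmem : Xx ∈ dg π.κ (L'.length + 1) := sy_mul_mem _ hW'
    have hdl : ∀ l, i < l → dl 𝒟'.D x l = 0 := by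
      intro l hl
      rw [dl, hxl l hl.ne' (Dc l hl), zero_div]
    have hXabove : Above (i :: L') (fm 𝒟'.D Xx) := by
      rw [hXx, fm_sy_mul]; exact wg_above hAb hL hdl
    have hXlead : fm 𝒟'.D Xx (i :: L') = M * ι a := by
      rw [hXx, fm_sy_mul, wg_lead hAb hL, hfm, dl, hxi, haρ]; field_simp
    -- places
    have hplX : ∀ Q : Pl 𝒟'.D, 0 < (Q.E (ι a)).orderTop → N • lcE Q.E Xx = 0 := by
      intro Q hQ
      have hcnn : 0 ≤ (Q.E c).orderTop := ord_nonneg_of_pow 𝒟' Q hc0 (ord_prj 𝒟' Q i c) hcprj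
      have hρnn : 0 ≤ (Q.E ρ).orderTop := by
        refine ord_nonneg_of_pow 𝒟' Q hρ0 (ord_prL 𝒟' Q L' ρ) ?_
        have := 𝒟'.prL_Im B'
        rw [map_sub, 𝒟'.prL_const (x := ρ ^ p) (fun j _ => D_frob _ _)] at this
        exact sub_eq_zero.1 this
      rw [hXx, map_mul]
      by_cases hρpos : 0 < (Q.E ρ).orderTop
      · rw [← mul_smul_comm, hpl Q hρpos, mul_zero]
      · have hρz : (Q.E ρ).orderTop = 0 := le_antisymm (not_lt.1 hρpos) hρnn
        have hcpos : 0 < (Q.E c).orderTop := by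
          rw [haρ, map_mul, HahnSeries.orderTop_mul, hρz, zero_add] at hQ; exact hQ
        have hx1 := hxA ((hpos Q.κ).comap Q.E.toAddMonoidHom) hcpos
          (by
            intro y hy
            show 0 < (Q.E (𝒟'.D i y)).orderTop
            rw [Q.hE]
            exact lt_of_lt_of_le hy (hd_order _ _))
          (by
            intro y hy
            show Q.E (c * y) ∈ hpos Q.κ
            rw [map_mul]
            exact hpos_mul hcpos (le_of_lt hy))
          (by
            intro h1
            have h2 : Q.E 1 ∈ hpos Q.κ := h1
            rw [map_one, mem_hpos, HahnSeries.orderTop_one] at h2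
            exact lt_irrefl _ h2)
        have hx2 : Q.E (x - 1) ∈ hpos Q.κ := hx1
        rw [map_sub, map_one] at hx2
        rw [lcE_sy, hlc_pos hx2, sy_one, zero_mul, smul_zero]
    -- descent
    classical
    set S := (π.1.map ι).roots.toFinset with hS
    have hsp : π.1.map ι = ∏ θ ∈ S, (X - C θ) := by
      have := ksplit (p := p) hρ0 hρp (f := π.1.map ι) (by
        obtain ⟨g, hg⟩ := hπ
        refine ⟨g.map ι, ?_⟩
        rw [← Polynomial.map_mul, ← hg]; simp) (π.2.1.map ι)
      rw [this, hS]
    have hroots : ∀ θ ∈ S, π.1.eval₂ ι θ = 0 := by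
      intro θ hθ
      rw [hS, Multiset.mem_toFinset] at hθ
      have := isRoot_of_mem_roots hθ
      rwa [IsRoot.def, eval_map] at this
    let g : π.κ → (π.κ →+* π.κ) := fun θ =>
      if h : π.1.eval₂ ι θ = 0 then AdjoinRoot.lift ι θ h else RingHom.id _
    have hg1 : ∀ θ ∈ S, ∀ b, g θ (ι b) = ι b := by
      intro θ hθ b
      simp only [g, dif_pos (hroots θ hθ)]
      exact AdjoinRoot.lift_of _
    have hg2 : ∀ θ ∈ S, g θ ρ = θ := by
      intro θ hθ
      simp only [g, dif_pos (hroots θ hθ)]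
      exact AdjoinRoot.lift_root _
    obtain ⟨W, hW, hWs⟩ := descent π S g hg1 hg2 hsp hXmem
    have hgD : ∀ θ ∈ S, ∀ j y, 𝒟'.D j (g θ y) = g θ (𝒟'.D j y) := by
      intro θ hθ j y
      refine kuniq hene hπ (g θ) (fun y => 𝒟'.D j (g θ y)) (fun y => g θ (𝒟'.D j y)) ?_ ?_ ?_ ?_ ?_ y
      · intro x y; simp
      · intro x y; simp
      · intro x y; simp [Derivation.leibniz]
      · intro x y; simp [Derivation.leibniz]
      · intro b
        show 𝒟'.D j (g θ (ι b)) = g θ (𝒟'.D j (ι b))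
        rw [hg1 θ hθ, h𝒟, hg1 θ hθ]
    have hfmW : ∀ J, ι (fm 𝒟.D W J) = ∑ θ ∈ S, g θ (fm 𝒟'.D Xx J) := by
      intro J
      rw [← fm_mp 𝒟.D 𝒟'.D ι h𝒟, hWs]
      have : ∀ T : Finset π.κ, T ⊆ S → fm 𝒟'.D (∑ θ ∈ T, mp (g θ) Xx) J = ∑ θ ∈ T, g θ (fm 𝒟'.D Xx J) := by
        intro T
        induction T using Finset.induction_on with
        | empty => intro _; simp [fm_zero]
        | insert θ T hθ ih2 =>
          intro hT
          rw [Finset.sum_insert hθ, Finset.sum_insert hθ, fm_add, Pi.add_apply,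
            ih2 (fun t ht => hT (Finset.mem_insert_of_mem ht)),
            fm_mp 𝒟'.D 𝒟'.D (g θ) (hgD θ (hT (Finset.mem_insert_self _ _)))]
      exact this S (Finset.Subset.refl _)
    have hcard : S.card = π.1.natDegree := by
      have := congrArg natDegree hsp
      rw [natDegree_prod_of_monic _ _ (fun θ _ => monic_X_sub_C θ), π.2.1.natDegree_map] at this
      simp at this
      exact this.symm
    have hfc : ((p - 1).factorial).Coprime p := by
      rw [Nat.coprime_comm, Nat.Prime.coprime_iff_not_dvd hp.out, hp.out.dvd_factorial]
      omega
    refine ⟨W, hW, (p - 1).factorial * N, S.card * M, hfc.mul_left hN, ?_, ?_, ?_, ?_⟩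
    · rw [hcard]
      exact (Nat.Coprime.coprime_dvd_left (kdeg hπ) hfc).mul_left hM
    · intro J hJ hlen hlt
      have := hfmW J
      rw [hXabove J hJ hlen hlt] at this
      simpa using this
    · apply ι.injective
      rw [hfmW, hXlead]
      have : ∀ θ ∈ S, g θ ((M : π.κ) * ι a) = M * ι a := by
        intro θ hθ; rw [map_mul, map_natCast, hg1 θ hθ]
      rw [Finset.sum_congr rfl this, Finset.sum_const, nsmul_eq_mul, map_mul, map_natCast]
      push_cast; ring
    · intro P hP
      obtain ⟨P', φ, hφ, hP'⟩ := place_ext 𝒟 hene hπ 𝒟' h𝒟 P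
      rw [mul_smul]
      apply hφ
      rw [map_nsmul, ← lcE_hmap]
      have h1 : (hmap φ).comp P.E = P'.E.comp ι := by
        ext1 y; exact (hP' y).symm
      rw [h1, ← lcE_mp, hWs, map_sum, Finset.smul_sum]
      apply Finset.sum_eq_zero
      intro θ hθ
      rw [lcE_mp]
      exact hplX ⟨P'.κ, P'.δ, P'.E.comp (g θ), by
        intro j y
        rw [RingHom.comp_apply, RingHom.comp_apply, ← P'.hE, hgD θ hθ]⟩ (by
        show 0 < (P'.E (g θ (ι a))).orderTop
        rw [hg1 θ hθ, hP', hmap_ord]; exact hP)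

end Izh

namespace Izh

theorem fm_zero_of_dec {K : Type} [Field K] {m : ℕ} (D : Fin m → Der K) {n : ℕ} {z : MK K} (hz : z ∈ dg K n)
    (h : ∀ J, Dec J → J.length = n → fm D z J = 0) : fm D z = 0 := by
  funext L
  by_cases hn : L.length = n
  · by_cases hd : L.Nodup
    · have hperm : (L.mergeSort (fun a b => decide (a ≥ b))).Perm L := List.mergeSort_perm _ _
      refine (fm_alt D z).zero_of_perm hperm.symm (h _ ?_ ?_)
      · have h1 : (L.mergeSort (fun a b => decide (a ≥ b))).Pairwise (fun a b => a ≥ b) := by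
          have := List.pairwise_mergeSort (le := fun a b : Fin m => decide (a ≥ b)) (by
            intro a b c; simp; omega) (by intro a b; simp; omega) L
          simpa using this
        have h2 : (L.mergeSort (fun a b => decide (a ≥ b))).Nodup := hperm.nodup_iff.2 hd
        exact (h1.and h2).imp (fun {a b} hab => lt_of_le_of_ne hab.1 (Ne.symm hab.2))
      · rw [hperm.length_eq, hn]
    · exact (fm_alt D z).zero_of_dup hd
  · exact fm_supp D hz L hn

theorem smul_coprime {K : Type} [Field K] {p : ℕ} [hp : Fact p.Prime] [CharP K p] {N : ℕ} (hN : N.Coprime p)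
    : (N : K) ≠ 0 := by
  intro h
  rw [CharP.cast_eq_zero_iff K p] at h
  exact hp.out.one_lt.ne' (Nat.dvd_one.1 (by
    rw [← Nat.Coprime.gcd_eq_one hN]; exact Nat.dvd_gcd h dvd_rfl))

theorem fm_coprime {K : Type} [Field K] {p : ℕ} [hp : Fact p.Prime] [CharP K p] {ι : Type} (D : ι → Der K)
    {N : ℕ} (hN : N.Coprime p) {z : MK K} (h : N • z = 0) : fm D z = 0 := by
  have h1 := congrArg (fm D) h
  rw [fm_nsmul, fm_zero] at h1
  funext L
  have := congrFun h1 L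
  rw [Pi.smul_apply, Pi.zero_apply, nsmul_eq_mul, mul_eq_zero] at this
  exact this.resolve_left (smul_coprime hN)

theorem lemS {p m : ℕ} [hp : Fact p.Prime] {K : Type} [Field K] [CharP K p] (𝒟 : PD p m K)
    (Ps : Pl 𝒟.D → Prop) {n : ℕ} {z : MK K} (hz : z ∈ dg K n)
    (h : ∀ P, Ps P → fm P.δ (lcE P.E z) = 0) :
    ∃ w ∈ dg K n, fm 𝒟.D w = fm 𝒟.D z ∧ ∃ N : ℕ, N.Coprime p ∧ ∀ P, Ps P → N • lcE P.E w = 0 := by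
  have hfin : {J : List (Fin m) | Dec J ∧ J.length = n}.Finite :=
    (List.finite_length_eq (Fin m) n).subset (fun J hJ => hJ.2)
  set T : MK K → Set (List (Fin m)) := fun z =>
    {J | (Dec J ∧ J.length = n) ∧ ∃ J', (Dec J' ∧ J'.length = n) ∧ J ≤ J' ∧ fm 𝒟.D z J' ≠ 0} with hT
  have hTf : ∀ z, (T z).Finite := fun z => hfin.subset (fun J hJ => hJ.1)
  generalize hk : (T z).ncard = k
  induction k using Nat.strong_induction_on generalizing z with
  | _ k IH =>
    by_cases h0 : ∀ J, Dec J → J.length = n → fm 𝒟.D z J = 0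
    · refine ⟨0, zero_mem _, ?_, 1, Nat.coprime_one_left _, fun P _ => by simp⟩
      rw [fm_zero_of_dec 𝒟.D hz h0, fm_zero]
    push Not at h0
    obtain ⟨J0, hJ0, hJ0n, hJ0z⟩ := h0
    have hSf : {J | (Dec J ∧ J.length = n) ∧ fm 𝒟.D z J ≠ 0}.Finite := hfin.subset (fun J hJ => hJ.1)
    obtain ⟨L, ⟨⟨hLd, hLn⟩, hLz⟩, hLmax⟩ :=
      hSf.exists_maximalFor id _ ⟨J0, ⟨hJ0, hJ0n⟩, hJ0z⟩
    have hLmax' : ∀ J, Dec J → J.length = n → L < J → fm 𝒟.D z J = 0 := by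
      intro J hJ hJn hlt
      by_contra hne
      exact absurd (hLmax ⟨⟨hJ, hJn⟩, hne⟩ hlt.le) (not_le.2 hlt)
    have hAb : Above L (fm 𝒟.D z) := fun J hJ hJn hlt => hLmax' J hJ (hJn.trans hLn) hlt
    obtain ⟨W, hW, N1, M, hN1, hM, hWA, hWL, hWP⟩ := facW L K 𝒟 (fm 𝒟.D z L) hLz hLd
      (𝒟.fm_condB z L) (𝒟.fm_condT z L hLd hAb)
    rw [hLn] at hW
    have hlcW : ∀ P, Ps P → N1 • lcE P.E W = 0 := by
      intro P hP
      apply hWP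
      have := P.red z L
      rw [h P hP] at this
      exact hrel_zero.1 this
    obtain ⟨q, hq⟩ : ∃ q : ℕ, (q : K) * M = 1 := by
      have hu : IsUnit (M : ZMod p) := (ZMod.isUnit_iff_coprime M p).2 hM
      obtain ⟨u, hu⟩ := hu.exists_left_inv
      obtain ⟨q, rfl⟩ := ZMod.natCast_zmod_surjective u
      refine ⟨q, ?_⟩
      have := congrArg (ZMod.castHom (dvd_refl p) K) hu
      simpa using this
    set z1 := z - q • W with hz1
    have hz1m : z1 ∈ dg K n := sub_mem hz (AddSubgroup.nsmul_mem _ hW q)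
    have hfz1 : ∀ J, fm 𝒟.D z1 J = fm 𝒟.D z J - q * fm 𝒟.D W J := by
      intro J
      rw [hz1, fm_sub, fm_nsmul]; simp
    have hge : ∀ J, Dec J → J.length = n → L ≤ J → fm 𝒟.D z1 J = 0 := by
      intro J hJ hJn hle
      rw [hfz1]
      rcases hle.eq_or_lt with rfl | hlt
      · rw [hWL, ← mul_assoc, hq, one_mul, sub_self]
      · rw [hLmax' J hJ hJn hlt, hWA J hJ (hJn.trans hLn.symm) hlt]; simp
    have hss : T z1 ⊂ T z := by
      rw [Set.ssubset_iff_of_subset]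
      · refine ⟨L, ⟨⟨hLd, hLn⟩, L, ⟨hLd, hLn⟩, le_rfl, hLz⟩, ?_⟩
        rintro ⟨-, J', ⟨hJ', hJ'n⟩, hle, hne⟩
        exact hne (hge J' hJ' hJ'n hle)
      · rintro J ⟨hJ, J', ⟨hJ', hJ'n⟩, hle, hne⟩
        refine ⟨hJ, L, ⟨hLd, hLn⟩, ?_, hLz⟩
        by_contra hlt
        exact hne (hge J' hJ' hJ'n ((not_le.1 hlt).le.trans hle))
    obtain ⟨w1, hw1, hfw1, N2, hN2, hP2⟩ := IH (T z1).ncard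
      (by rw [← hk]; exact Set.ncard_lt_ncard hss (hTf z)) hz1m (by
        intro P hP
        haveI := charP_of_place (p := p) P.E
        rw [hz1, map_sub, map_nsmul, fm_sub, fm_nsmul, h P hP, fm_coprime (p := p) _ hN1 (hlcW P hP)]
        simp) rfl
    refine ⟨w1 + q • W, add_mem hw1 (AddSubgroup.nsmul_mem _ hW q), ?_, N1 * N2, hN1.mul_left hN2, ?_⟩
    · rw [fm_add, hfw1, hz1, fm_sub, fm_nsmul]; abel
    · intro P hP
      rw [map_add, map_nsmul, smul_add, mul_smul, hP2 P hP, smul_zero, zero_add, mul_comm, mul_smul,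
        smul_comm N1, hlcW P hP, smul_zero, smul_zero]

end Izh

namespace Izh
open Polynomial

/-- Finitely generated over p-th powers. -/
def FG (p : ℕ) (F : Type) [Field F] : Prop :=
  ∃ S : Finset F, Subfield.closure (Set.range (fun x : F => x ^ p) ∪ (S : Set F)) = ⊤

theorem FG.ext {p : ℕ} {F K : Type} [Field F] [Field K] (φ : F →+* K) (h : FG p F) (T : Finset K)
    (hT : Subfield.closure (Set.range φ ∪ (T : Set K)) = ⊤) : FG p K := by
  classical
  obtain ⟨S, hS⟩ := h
  refine ⟨S.image φ ∪ T, ?_⟩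
  rw [eq_top_iff, ← hT, Subfield.closure_le]
  set M := Subfield.closure (Set.range (fun x : K => x ^ p) ∪ ((S.image φ ∪ T : Finset K) : Set K)) with hM
  have hsub : ∀ x ∈ (Set.range (fun x : K => x ^ p) ∪ ((S.image φ ∪ T : Finset K) : Set K)), x ∈ M :=
    fun x hx => Subfield.subset_closure hx
  rintro x (⟨y, rfl⟩ | hx)
  · have : (⊤ : Subfield F) ≤ M.comap φ := by
      rw [← hS, Subfield.closure_le]
      rintro z (⟨w, rfl⟩ | hz)
      · rw [SetLike.mem_coe, Subfield.mem_comap, map_pow]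
        exact hsub _ (Or.inl ⟨φ w, rfl⟩)
      · apply hsub
        right
        simp only [Finset.coe_union, Finset.coe_image]
        exact Or.inl ⟨z, hz, rfl⟩
    exact this trivial
  · apply hsub
    right
    simp only [Finset.coe_union, Finset.coe_image]
    exact Or.inr hx

/-- Uniqueness of derivations along a hom. -/
theorem der_uniq {K L : Type} [Field K] [Field L] (φ : K →+* L) (Δ1 Δ2 : K → L)
    (ha1 : ∀ x y, Δ1 (x + y) = Δ1 x + Δ1 y) (ha2 : ∀ x y, Δ2 (x + y) = Δ2 x + Δ2 y)
    (h1 : ∀ x y, Δ1 (x * y) = φ x * Δ1 y + φ y * Δ1 x)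
    (h2 : ∀ x y, Δ2 (x * y) = φ x * Δ2 y + φ y * Δ2 x)
    {S : Set K} (hS : Subfield.closure S = ⊤) (h : ∀ x ∈ S, Δ1 x = Δ2 x) (x : K) : Δ1 x = Δ2 x := by
  set Δ : K → L := fun x => Δ1 x - Δ2 x with hΔ
  have ha : ∀ x y, Δ (x + y) = Δ x + Δ y := by
    intro x y; simp only [hΔ, ha1, ha2]; ring
  have hm : ∀ x y, Δ (x * y) = φ x * Δ y + φ y * Δ x := by
    intro x y; simp only [hΔ, h1, h2]; ring
  have h0 : Δ 0 = 0 := by have := ha 0 0; simpa using this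
  have h1 : Δ 1 = 0 := by have := hm 1 1; simpa using this
  have : (⊤ : Subfield K) ≤
      { carrier := {x | Δ x = 0}
        zero_mem' := h0
        one_mem' := h1
        add_mem' := fun {a b} (ha' : Δ a = 0) (hb : Δ b = 0) => by
          show Δ (a + b) = 0
          rw [ha, ha', hb, add_zero]
        mul_mem' := fun {a b} (ha' : Δ a = 0) (hb : Δ b = 0) => by
          show Δ (a * b) = 0
          rw [hm, ha', hb]; simp
        neg_mem' := fun {a} (ha' : Δ a = 0) => by
          show Δ (-a) = 0
          have := ha a (-a)
          rw [add_neg_cancel, h0, ha', zero_add] at this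
          exact this.symm
        inv_mem' := fun a (ha' : Δ a = 0) => by
          show Δ a⁻¹ = 0
          by_cases hz : a = 0
          · rw [hz, inv_zero, h0]
          · have := hm a a⁻¹
            rw [mul_inv_cancel₀ hz, h1, ha', mul_zero, add_zero] at this
            exact (mul_eq_zero.1 this.symm).resolve_left (by simpa using hz) } := by
    rw [← hS, Subfield.closure_le]
    intro y hy
    show Δ y = 0
    simp only [hΔ, h y hy, sub_self]
  have h3 : Δ x = 0 := this (show x ∈ (⊤ : Subfield K) from trivial)
  exact sub_eq_zero.1 h3

section der
variable {F : Type} [Field F] {p : ℕ} [hp : Fact p.Prime] [CharP F p]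

theorem min_eq (M : Subfield F) (hM : ∀ x : F, x ^ p ∈ M) {c : F} (hc : c ∉ M) :
    minpoly M c = X ^ p - C (⟨c ^ p, hM c⟩ : M) := by
  haveI : CharP M p := (RingHom.charP_iff M.subtype M.subtype.injective p).2 inferInstance
  have hirr : Irreducible (X ^ p - C (⟨c ^ p, hM c⟩ : M)) := by
    apply X_pow_sub_C_irreducible_of_prime hp.out
    intro b hb
    have h1 : (b : F) ^ p = c ^ p := congrArg Subtype.val hb
    have h2 : ((b : F) - c) ^ p = 0 := by rw [sub_pow_expChar (p := p), h1, sub_self]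
    have h3 := pow_eq_zero_iff hp.out.ne_zero |>.1 h2
    rw [sub_eq_zero] at h3
    exact hc (h3 ▸ b.2)
  symm
  apply minpoly.eq_of_irreducible_of_monic hirr
  · simp
    exact sub_eq_zero.2 rfl
  · exact monic_X_pow_sub_C _ hp.out.ne_zero

theorem exists_der (M : Subfield F) (hM : ∀ x : F, x ^ p ∈ M) {c : F} (hc : c ∉ M)
    (hgen : Subfield.closure ((M : Set F) ∪ {c}) = ⊤) :
    ∃ D : Der F, (∀ x ∈ M, D x = 0) ∧ D c = c := by
  haveI : CharP M p := (RingHom.charP_iff M.subtype M.subtype.injective p).2 inferInstance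
  have hmin : minpoly M c = X ^ p - C (⟨c ^ p, hM c⟩ : M) := min_eq M hM hc
  set μ : M[X] →+* F := (aeval c : M[X] →ₐ[M] F).toRingHom with hμ
  have hμX : μ X = c := aeval_X c
  have hμC : ∀ a : M, μ (C a) = a := fun a => aeval_C c a
  have hsurj : Function.Surjective μ := by
    have hle : (⊤ : Subfield F) ≤
        { μ.range with
          inv_mem' := by
            rintro x ⟨q, rfl⟩
            by_cases h0 : μ q = 0
            · rw [h0, inv_zero]; exact ⟨0, map_zero _⟩
            · refine ⟨C (⟨((μ q)⁻¹) ^ p, hM _⟩ : M) * q ^ (p - 1), ?_⟩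
              rw [map_mul, map_pow, hμC]
              obtain ⟨r, hr⟩ : ∃ r, p = r + 1 := ⟨p - 1, by have := hp.out.pos; omega⟩
              have : p - 1 = r := by omega
              simp only [this]
              simp only [hr]
              rw [pow_succ, inv_pow]
              field_simp } := by
      rw [← hgen, Subfield.closure_le]
      rintro x (hx | hx)
      · exact ⟨C ⟨x, hx⟩, hμC _⟩
      · rw [Set.mem_singleton_iff] at hx
        subst hx
        exact ⟨X, hμX⟩
    intro x
    exact hle (show x ∈ (⊤ : Subfield F) from trivial)
  obtain ⟨D, hD⟩ := der_desc μ hsurj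
    (mkDer (AddMonoidHom.mk' (fun f : M[X] => X * derivative f) (by
      intro a b; rw [derivative_add]; ring)) (by
      intro a b; simp only [AddMonoidHom.mk'_apply, derivative_mul]; ring)) (by
    intro q hq
    rw [mkDer_apply, AddMonoidHom.mk'_apply]
    have h1 : minpoly M c ∣ q := minpoly.dvd M c hq
    obtain ⟨g, hg⟩ := h1
    have h2 : derivative (minpoly M c) = 0 := by
      rw [hmin, derivative_sub, derivative_C, derivative_X_pow, CharP.cast_eq_zero, C_0]; simp
    have h3 : μ (minpoly M c) = 0 := minpoly.aeval M c
    rw [hg, derivative_mul, h2, zero_mul, zero_add, map_mul, map_mul, h3]; ring)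
  refine ⟨D, ?_, ?_⟩
  · intro x hx
    have := hD (C ⟨x, hx⟩)
    rw [hμC, mkDer_apply, AddMonoidHom.mk'_apply, derivative_C, mul_zero, map_zero] at this
    exact this
  · have := hD X
    rwa [mkDer_apply, AddMonoidHom.mk'_apply, derivative_X, mul_one, hμX] at this

theorem exists_PD (h : FG p F) : ∃ (m : ℕ) (𝒟 : PD p m F),
    Subfield.closure (Set.range (fun x : F => x ^ p) ∪ Set.range 𝒟.b) = ⊤ := by
  classical
  obtain ⟨S, hS, hmin⟩ : ∃ S : Finset F,
      Subfield.closure (Set.range (fun x : F => x ^ p) ∪ (S : Set F)) = ⊤ ∧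
      ∀ T : Finset F, Subfield.closure (Set.range (fun x : F => x ^ p) ∪ (T : Set F)) = ⊤ → S.card ≤ T.card := by
    obtain ⟨S, hS, hm⟩ := exists_minimalFor_of_wellFoundedLT
      (fun S : Finset F => Subfield.closure (Set.range (fun x : F => x ^ p) ∪ (S : Set F)) = ⊤) Finset.card h
    exact ⟨S, hS, fun T hT => by
      by_contra hlt
      have := hm hT (not_le.1 hlt).le
      omega⟩
  set M : F → Subfield F := fun b =>
    Subfield.closure (Set.range (fun x : F => x ^ p) ∪ ((S.erase b : Finset F) : Set F)) with hMdef
  have hMp : ∀ b x, x ^ p ∈ M b := fun b x => Subfield.subset_closure (Or.inl ⟨x, rfl⟩)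
  have hMe : ∀ b x, x ∈ S → x ≠ b → x ∈ M b := fun b x hx hne =>
    Subfield.subset_closure (Or.inr (by simp [hx, hne]))
  have hgen : ∀ b ∈ S, Subfield.closure ((M b : Set F) ∪ {b}) = ⊤ := by
    intro b hb
    rw [eq_top_iff, ← hS, Subfield.closure_le]
    rintro x (⟨y, rfl⟩ | hx)
    · exact Subfield.subset_closure (Or.inl (hMp b y))
    · by_cases hxb : x = b
      · exact Subfield.subset_closure (Or.inr hxb)
      · exact Subfield.subset_closure (Or.inl (hMe b x hx hxb))
  have hnot : ∀ b ∈ S, b ∉ M b := by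
    intro b hb hbM
    have h1 : M b = ⊤ := by
      rw [eq_top_iff, ← hgen b hb, Subfield.closure_le]
      rintro x (hx | hx)
      · exact hx
      · rw [Set.mem_singleton_iff] at hx; subst hx; exact hbM
    have := hmin _ h1
    have := Finset.card_erase_lt_of_mem hb
    omega
  let b : Fin S.card → F := fun i => (S.equivFin.symm i : F)
  have hb : ∀ i, b i ∈ S := fun i => (S.equivFin.symm i).2
  have hbinj : Function.Injective b := Subtype.val_injective.comp S.equivFin.symm.injective
  have hrange : Set.range b = (S : Set F) := by
    ext x
    constructor
    · rintro ⟨i, rfl⟩; exact hb i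
    · intro hx; exact ⟨S.equivFin ⟨x, hx⟩, by simp [b]⟩
  choose D hD1 hD2 using fun i => exists_der (M (b i)) (hMp (b i)) (hnot (b i) (hb i)) (hgen (b i) (hb i))
  have hDb : ∀ i j, D i (b j) = if i = j then b j else 0 := by
    intro i j
    split_ifs with hij
    · subst hij; exact hD2 i
    · exact hD1 i _ (hMe _ _ (hb j) (fun hh => hij (hbinj hh).symm))
  have hS' : Subfield.closure (Set.range (fun x : F => x ^ p) ∪ Set.range b) = ⊤ := by rw [hrange]; exact hS
  refine ⟨S.card, ⟨D, ?_, ?_, b, ?_, hDb⟩, hS'⟩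
  · intro i j x
    have := der_uniq (RingHom.id F) (fun x => D i (D j x) - D j (D i x)) (fun x => 0)
      (by intro x y; simp only [map_add]; ring) (by intros; simp)
      (by intro x y; simp only [Derivation.leibniz, map_add, smul_eq_mul, RingHom.id_apply]; ring)
      (by intros; simp) hS' (by
        rintro x (⟨y, rfl⟩ | ⟨k, rfl⟩)
        · simp only [D_frob, map_zero, sub_self]
        · simp only [hDb]
          split_ifs <;> simp [hDb] <;> simp_all) x
    exact sub_eq_zero.1 this
  · intro i x
    refine der_uniq (RingHom.id F) (fun x => (D i)^[p] x) (fun x => D i x) ?_ ?_ ?_ ?_ hS' ?_ x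
    · intro x y; exact iterate_map_add (D i) p x y
    · intro x y; simp
    · intro x y; exact iter_leib (D i) x y
    · intro x y; simp
    · rintro x (⟨y, rfl⟩ | ⟨k, rfl⟩)
      · show (D i)^[p] (y ^ p) = D i (y ^ p)
        rw [← iter_p, D_frob]; exact Function.iterate_fixed (map_zero (D i)) _
      · show (D i)^[p] (b k) = D i (b k)
        rw [← iter_p, hDb]
        split_ifs with hik
        · subst hik
          exact Function.iterate_fixed (hD2 i) _
        · exact Function.iterate_fixed (map_zero (D i)) _
  · intro i h0
    exact hnot (b i) (hb i) (by have h0' : b i = 0 := h0; rw [h0']; exact zero_mem _)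

theorem exchange (M : Subfield F) (hM : ∀ x : F, x ^ p ∈ M) {c y : F} (hc : c ∉ M) (hy : y ∉ M)
    (h : c ∈ Subfield.closure ((M : Set F) ∪ {y})) : y ∈ Subfield.closure ((M : Set F) ∪ {c}) := by
  have key : ∀ d : F, d ∉ M → IsIntegral M d ∧ (minpoly M d).natDegree = p := by
    intro d hd
    have := min_eq M hM hd
    constructor
    · exact ⟨X ^ p - C (⟨d ^ p, hM d⟩ : M), monic_X_pow_sub_C _ hp.out.ne_zero, by
        simp
        exact sub_eq_zero.2 rfl⟩
    · rw [this, natDegree_X_pow_sub_C]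
  have hcl : ∀ d : F, ∀ x, x ∈ IntermediateField.adjoin M {d} ↔ x ∈ Subfield.closure ((M : Set F) ∪ {d}) := by
    intro d x
    rw [← IntermediateField.mem_toSubfield, IntermediateField.adjoin_toSubfield]
    have : Set.range (algebraMap M F) = (M : Set F) := by
      ext z; constructor
      · rintro ⟨w, rfl⟩; exact w.2
      · intro hz; exact ⟨⟨z, hz⟩, rfl⟩
    rw [this]
  have hle : IntermediateField.adjoin M {c} ≤ IntermediateField.adjoin M {y} := by
    rw [IntermediateField.adjoin_simple_le_iff, hcl]; exact h
  haveI : FiniteDimensional M (IntermediateField.adjoin M {y}) :=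
    IntermediateField.adjoin.finiteDimensional (key y hy).1
  have := IntermediateField.eq_of_le_of_finrank_eq hle (by
    rw [IntermediateField.adjoin.finrank (key c hc).1, IntermediateField.adjoin.finrank (key y hy).1,
      (key c hc).2, (key y hy).2])
  rw [← hcl, this]
  exact IntermediateField.mem_adjoin_simple_self M y

theorem exists_der_ne {c : F} (hc : ∀ x : F, x ^ p ≠ c) : ∃ D : Der F, D c ≠ 0 := by
  have hz := zorn_le_nonempty₀ {M : Subfield F | (∀ x : F, x ^ p ∈ M) ∧ c ∉ M} (by
    rintro Ch hCh hchain M0 hM0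
    refine ⟨sSup Ch, ⟨fun x => ?_, ?_⟩, fun M hM => le_sSup hM⟩
    · exact (le_sSup hM0 : M0 ≤ sSup Ch) ((hCh hM0).1 x)
    · rw [Subfield.mem_sSup_of_directedOn ⟨M0, hM0⟩ hchain.directedOn]
      rintro ⟨M, hM, hcM⟩
      exact (hCh hM).2 hcM) (frobenius F p).fieldRange ⟨fun x => ⟨x, rfl⟩, by
        rintro ⟨x, hx⟩
        exact hc x hx⟩
  obtain ⟨M, -, ⟨hM1, hM2⟩, hmax⟩ := hz
  obtain ⟨D, -, hD⟩ := exists_der M hM1 hM2 (by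
    rw [eq_top_iff]
    intro y _
    by_cases hy : y ∈ M
    · exact Subfield.subset_closure (Or.inl hy)
    · apply exchange M hM1 hM2 hy
      by_contra hcon
      have := hmax (y := Subfield.closure ((M : Set F) ∪ {y}))
        ⟨fun x => Subfield.subset_closure (Or.inl (hM1 x)), hcon⟩
        (fun x hx => Subfield.subset_closure (Or.inl hx))
      exact hy (this (Subfield.subset_closure (Or.inr rfl))))
  refine ⟨D, ?_⟩
  rw [hD]
  rintro rfl
  exact hc 0 (zero_pow hp.out.ne_zero)

end der
end Izh

namespace Izh
open Polynomial

section dual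
variable {A B : Type} [CommRing A] [CommRing B]

/-- Leibniz maps as ring homs to dual numbers. -/
def toDual (φ : A →+* B) (f : A →+ B) (h : ∀ a b, f (a * b) = φ a * f b + φ b * f a) :
    A →+* TrivSqZeroExt B B where
  toFun a := (φ a, f a)
  map_one' := by
    have h1 : f 1 = 0 := by have := h 1 1; simpa using this
    refine TrivSqZeroExt.ext ?_ ?_
    · exact map_one φ
    · exact h1
  map_mul' a b := by
    refine TrivSqZeroExt.ext ?_ ?_
    · exact map_mul φ a b
    · show f (a * b) = φ a • f b + MulOpposite.op (φ b) • f a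
      rw [h, op_smul_eq_smul]; rfl
  map_zero' := by
    refine TrivSqZeroExt.ext ?_ ?_
    · exact map_zero φ
    · exact map_zero f
  map_add' a b := by
    refine TrivSqZeroExt.ext ?_ ?_
    · exact map_add φ a b
    · exact map_add f a b

theorem toDual_fst (φ : A →+* B) (f : A →+ B) (h : ∀ a b, f (a * b) = φ a * f b + φ b * f a) (a : A) :
    (toDual φ f h a).fst = φ a := rfl
theorem toDual_snd (φ : A →+* B) (f : A →+ B) (h : ∀ a b, f (a * b) = φ a * f b + φ b * f a) (a : A) :
    (toDual φ f h a).snd = f a := rfl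

theorem ofDual (φ : A →+* B) (T : A →+* TrivSqZeroExt B B) (hT : ∀ a, (T a).fst = φ a) :
    ∃ f : A →+ B, (∀ a b, f (a * b) = φ a * f b + φ b * f a) ∧ ∀ a, f a = (T a).snd := by
  refine ⟨AddMonoidHom.mk' (fun a => (T a).snd) (fun a b => by rw [map_add]; rfl), ?_, fun a => rfl⟩
  intro a b
  show (T (a * b)).snd = φ a * (T b).snd + φ b * (T a).snd
  rw [map_mul, TrivSqZeroExt.snd_mul, hT, hT, op_smul_eq_smul]; rfl

theorem frac_der {K : Type} [Field K] [Algebra A K] [IsDomain A] [IsFractionRing A K] (f : A →+ K)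
    (h : ∀ a b, f (a * b) = algebraMap A K a * f b + algebraMap A K b * f a) :
    ∃ D : Der K, ∀ a, D (algebraMap A K a) = f a := by
  set T : K →+* TrivSqZeroExt K K := IsLocalization.lift (M := nonZeroDivisors A) (g := toDual (algebraMap A K) f h)
    (fun y => by
      rw [TrivSqZeroExt.isUnit_iff_isUnit_fst, toDual_fst]
      exact IsLocalization.map_units K y) with hT
  have hTa : ∀ a, T (algebraMap A K a) = toDual (algebraMap A K) f h a := fun a => IsLocalization.lift_eq _ a
  have hfst : (TrivSqZeroExt.fstHom K K K).toRingHom.comp T = RingHom.id K := by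
    apply IsLocalization.ringHom_ext (nonZeroDivisors A)
    ext a
    show (T (algebraMap A K a)).fst = algebraMap A K a
    rw [hTa, toDual_fst]
  obtain ⟨g, hg, hg2⟩ := ofDual (RingHom.id K) T (fun a => congrArg (fun q => q a) hfst)
  refine ⟨mkDer g hg, fun a => ?_⟩
  rw [mkDer_apply, hg2, hTa, toDual_snd]

theorem poly_der (φ : A[X] →+* B) (d : A →+ B)
    (h : ∀ a b, d (a * b) = φ (C a) * d b + φ (C b) * d a) (u : B) :
    ∃ f : A[X] →+ B, (∀ a b, f (a * b) = φ a * f b + φ b * f a) ∧ (∀ a, f (C a) = d a) ∧ f X = u := by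
  set T : A[X] →+* TrivSqZeroExt B B := eval₂RingHom (toDual (φ.comp C) d h) ((φ X, u) : TrivSqZeroExt B B) with hT
  have hC : ∀ a, T (C a) = toDual (φ.comp C) d h a := fun a => eval₂_C _ _
  have hX : T X = ((φ X, u) : TrivSqZeroExt B B) := eval₂_X _ _
  have hfst : (TrivSqZeroExt.fstHom B B B).toRingHom.comp T = φ := by
    apply Polynomial.ringHom_ext
    · intro a
      show (T (C a)).fst = _
      rw [hC]; rfl
    · show (T X).fst = _
      rw [hX]; rfl
  obtain ⟨g, hg, hg2⟩ := ofDual φ T (fun a => congrArg (fun q => q a) hfst)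
  refine ⟨g, hg, fun a => ?_, ?_⟩
  · rw [hg2, hC]; rfl
  · rw [hg2, hX]; rfl

theorem leib_ext (φ : A[X] →+* B) (f g : A[X] →+ B) (hf : ∀ a b, f (a * b) = φ a * f b + φ b * f a)
    (hg : ∀ a b, g (a * b) = φ a * g b + φ b * g a) (hC : ∀ a, f (C a) = g (C a)) (hX : f X = g X)
    (q : A[X]) : f q = g q := by
  induction q using Polynomial.induction_on with
  | C a => exact hC a
  | add a b h1 h2 => rw [map_add, map_add, h1, h2]
  | monomial n a h =>
    have : C a * X ^ (n + 1) = (C a * X ^ n) * X := by ring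
    rw [this, hf, hg, h, hX]

end dual

section res
variable {K κ : Type} [Field K] [Field κ] (d : DVD K κ) {ι : Type} (D' : ι → Der κ)
  (D : Option ι → Der K) (Γ : Subring (K × κ))

theorem wg_map {R : Type} [CommRing R] {ι ι' : Type} (f : ι' → ι) (lam : ι → R) (ω : List ι → R) (L : List ι') :
    wg lam ω (L.map f) = wg (lam ∘ f) (fun J => ω (J.map f)) L := by
  induction L generalizing ω with
  | nil => simp
  | cons i L ih => rw [List.map_cons, wg_cons, wg_cons, ih]; rfl

theorem dl_neg_one : dl D' (-1 : κ) = 0 := by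
  funext i; simp [dl]

theorem fm_res (h1 : ∀ x, x ≠ 0 → ∀ i, (dl D x (some i), dl D' (d.l x) i) ∈ Γ)
    (h2 : ∀ x, x ≠ 0 → (dl D x none, (d.v x : κ)) ∈ Γ) (z : MK K) (L : List ι) :
    (fm D z (L.map some), fm D' (d.s z) L) ∈ Γ ∧ (fm D z (none :: L.map some), fm D' (d.r z) L) ∈ Γ := by
  induction z using MK.induction generalizing L with
  | h1 =>
    rw [map_one, DVD.r_one, fm_one, fm_one, fm_zero]
    refine ⟨?_, Γ.zero_mem⟩
    cases L with
    | nil => exact Γ.one_mem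
    | cons a b => exact Γ.zero_mem
  | ha a b ha hb =>
    rw [map_add, map_add, fm_add, fm_add, fm_add]
    exact ⟨Γ.add_mem (ha L).1 (hb L).1, Γ.add_mem (ha L).2 (hb L).2⟩
  | hn a ha =>
    rw [map_neg, map_neg, fm_neg, fm_neg, fm_neg]
    exact ⟨Γ.neg_mem (ha L).1, Γ.neg_mem (ha L).2⟩
  | hm x a ha =>
    by_cases hx : x = 0
    · rw [hx, sy_zero, zero_mul, map_zero, map_zero, fm_zero, fm_zero]
      exact ⟨Γ.zero_mem, Γ.zero_mem⟩
    constructor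
    · rw [map_mul, d.s_sy, fm_sy_mul, fm_sy_mul, wg_map]
      exact wg_rel Γ _ _ (h1 x hx) _ _ (fun J => (ha J).1) L
    · rw [d.r_sy_mul hx, add_mul, neg_mul, smul_mul_assoc, fm_add, fm_zsmul, fm_add, fm_neg, fm_zsmul, fm_sy_mul,
        fm_sy_mul, fm_sy_mul, dl_neg_one, wg_zero_left, smul_zero, add_zero, ← sub_eq_add_neg, wg_cons, wg_map]
      have t1 : (dl D x none * fm D a (L.map some), (d.v x • fm D' (d.s a)) L) ∈ Γ := by
        have := Γ.mul_mem (h2 x hx) (ha L).1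
        simpa [zsmul_eq_mul] using this
      exact Γ.sub_mem t1 <| wg_rel Γ _ _ (h1 x hx) _ _ (fun J => (ha J).2) L

end res

/-- combination of derivations -/
def dsub {A : Type} [CommRing A] (a b : Der A) (c : A) : Der A := a - c • b
theorem dsub_apply {A : Type} [CommRing A] (a b : Der A) (c x : A) : dsub a b c x = a x - c * b x := rfl

section place
variable {F : Type} [Field F] (π : MI F)

theorem cc_add (a b : F[X]) : cc (a + b) = cc a + cc b := map_add _ _ _
theorem cc_neg (a : F[X]) : cc (-a) = - cc a := map_neg _ _
theorem cc_one : cc (1 : F[X]) = 1 := map_one _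

/-- The local ring relation. -/
def locrel : Subring (RatFunc F × π.κ) where
  carrier := {w | ∃ a b : F[X], ¬ π.1 ∣ b ∧ w.1 * cc b = cc a ∧ w.2 * AdjoinRoot.mk π.1 b = AdjoinRoot.mk π.1 a}
  zero_mem' := ⟨0, 1, fun h => π.prime.not_unit (isUnit_of_dvd_one h), by simp, by simp⟩
  one_mem' := ⟨1, 1, fun h => π.prime.not_unit (isUnit_of_dvd_one h), by simp, by simp⟩
  neg_mem' := by
    rintro ⟨x, y⟩ ⟨a, b, hb, h1, h2⟩
    exact ⟨-a, b, hb, by simp only [Prod.fst_neg, neg_mul] at h1 ⊢; rw [h1, cc_neg],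
      by simp only [Prod.snd_neg, neg_mul] at h2 ⊢; rw [h2, map_neg]⟩
  add_mem' := by
    rintro ⟨x, y⟩ ⟨x', y'⟩ ⟨a, b, hb, h1, h2⟩ ⟨a', b', hb', h1', h2'⟩
    refine ⟨a * b' + a' * b, b * b', fun h => (π.prime.dvd_or_dvd h).elim hb hb', ?_, ?_⟩
    · simp only [Prod.fst_add, cc_mul, cc_add] at h1 h1' ⊢; rw [← h1, ← h1']; ring
    · simp only [Prod.snd_add, map_mul, map_add] at h2 h2' ⊢; rw [← h2, ← h2']; ring
  mul_mem' := by
    rintro ⟨x, y⟩ ⟨x', y'⟩ ⟨a, b, hb, h1, h2⟩ ⟨a', b', hb', h1', h2'⟩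
    refine ⟨a * a', b * b', fun h => (π.prime.dvd_or_dvd h).elim hb hb', ?_, ?_⟩
    · simp only [Prod.fst_mul, cc_mul] at h1 h1' ⊢; rw [← h1, ← h1']; ring
    · simp only [Prod.snd_mul, map_mul] at h2 h2' ⊢; rw [← h2, ← h2']; ring

theorem mk_ne {b : F[X]} (hb : ¬ π.1 ∣ b) : AdjoinRoot.mk π.1 b ≠ 0 := by
  rwa [Ne, AdjoinRoot.mk_eq_zero]

theorem locrel_poly (a : F[X]) : (cc a, AdjoinRoot.mk π.1 a) ∈ locrel π :=
  ⟨a, 1, fun h => π.prime.not_unit (isUnit_of_dvd_one h), by simp, by simp⟩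

theorem locrel_inv {b : F[X]} (hb : ¬ π.1 ∣ b) : ((cc b)⁻¹, (AdjoinRoot.mk π.1 b)⁻¹) ∈ locrel π := by
  have h0 : b ≠ 0 := by rintro rfl; simp at hb
  exact ⟨1, b, hb, by rw [cc_one]; exact inv_mul_cancel₀ (cc_ne h0),
    by rw [map_one]; exact inv_mul_cancel₀ (mk_ne π hb)⟩

theorem locrel_div {x : RatFunc F} {y : π.κ} (h : (x, y) ∈ locrel π) {b : F[X]} (hb : ¬ π.1 ∣ b) :
    (x / cc b, y / AdjoinRoot.mk π.1 b) ∈ locrel π := by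
  rw [div_eq_mul_inv, div_eq_mul_inv]
  exact (locrel π).mul_mem h (locrel_inv π hb)

theorem locrel_zero {y : π.κ} (h : ((0 : RatFunc F), y) ∈ locrel π) : y = 0 := by
  obtain ⟨a, b, hb, h1, h2⟩ := h
  have ha : a = 0 := by
    rw [zero_mul] at h1
    by_contra h
    exact cc_ne h h1.symm
  rw [ha, map_zero] at h2
  exact (mul_eq_zero.1 h2).resolve_right (mk_ne π hb)

theorem dl_div {K ι : Type} [Field K] (D : ι → Der K) {x y : K} (hx : x ≠ 0) (hy : y ≠ 0) :
    dl D (x / y) = dl D x - dl D y := by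
  have := dl_mul D (div_ne_zero hx hy) hy
  rw [div_mul_cancel₀ _ hy] at this
  rw [this]; simp

theorem dl_loc {ι : Type} (D' : ι → Der π.κ) (D : Option ι → Der (RatFunc F))
    (h1 : ∀ i c, (D (some i) (cc c), D' i (AdjoinRoot.mk π.1 c)) ∈ locrel π)
    (h2 : ∀ i, D (some i) (cc π.1) = 0) (h3 : ∀ c, (D none (cc c), 0) ∈ locrel π)
    (h4 : D none (cc π.1) = cc π.1) {x : RatFunc F} (hx : x ≠ 0) :
    (∀ i, (dl D x (some i), dl D' (π.d.l x) i) ∈ locrel π) ∧ (dl D x none, (π.d.v x : π.κ)) ∈ locrel π := by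
  have hmul : ∀ x y : RatFunc F, x ≠ 0 → y ≠ 0 →
      ((∀ i, (dl D x (some i), dl D' (π.d.l x) i) ∈ locrel π) ∧ (dl D x none, (π.d.v x : π.κ)) ∈ locrel π) →
      ((∀ i, (dl D y (some i), dl D' (π.d.l y) i) ∈ locrel π) ∧ (dl D y none, (π.d.v y : π.κ)) ∈ locrel π) →
      ((∀ i, (dl D (x * y) (some i), dl D' (π.d.l (x * y)) i) ∈ locrel π) ∧
        (dl D (x * y) none, (π.d.v (x * y) : π.κ)) ∈ locrel π) := by
    intro x y hx hy hX hY
    rw [dl_mul D hx hy, map_mul, dl_mul D' (by simpa using hx) (by simpa using hy), π.d.v_mul x y hx hy]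
    refine ⟨fun i => (locrel π).add_mem (hX.1 i) (hY.1 i), ?_⟩
    push_cast
    exact (locrel π).add_mem hX.2 hY.2
  have hdiv : ∀ x y : RatFunc F, x ≠ 0 → y ≠ 0 →
      ((∀ i, (dl D x (some i), dl D' (π.d.l x) i) ∈ locrel π) ∧ (dl D x none, (π.d.v x : π.κ)) ∈ locrel π) →
      ((∀ i, (dl D y (some i), dl D' (π.d.l y) i) ∈ locrel π) ∧ (dl D y none, (π.d.v y : π.κ)) ∈ locrel π) →
      ((∀ i, (dl D (x / y) (some i), dl D' (π.d.l (x / y)) i) ∈ locrel π) ∧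
        (dl D (x / y) none, (π.d.v (x / y) : π.κ)) ∈ locrel π) := by
    intro x y hx hy hX hY
    rw [dl_div D hx hy, map_div₀, dl_div D' (by simpa using hx) (by simpa using hy), π.d.v_div hx hy]
    refine ⟨fun i => (locrel π).sub_mem (hX.1 i) (hY.1 i), ?_⟩
    push_cast
    exact (locrel π).sub_mem hX.2 hY.2
  have hunit : ∀ c : F[X], ¬ π.1 ∣ c →
      ((∀ i, (dl D (cc c) (some i), dl D' (π.d.l (cc c)) i) ∈ locrel π) ∧
        (dl D (cc c) none, (π.d.v (cc c) : π.κ)) ∈ locrel π) := by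
    intro c hc
    rw [(π.d_unit hc).1, (π.d_unit hc).2]
    refine ⟨fun i => locrel_div π (h1 i c) hc, ?_⟩
    have := locrel_div π (h3 c) hc
    simpa [dl] using this
  have hπ : ((∀ i, (dl D (cc π.1) (some i), dl D' (π.d.l (cc π.1)) i) ∈ locrel π) ∧
        (dl D (cc π.1) none, (π.d.v (cc π.1) : π.κ)) ∈ locrel π) := by
    rw [π.d_self.1, π.d_self.2]
    constructor
    · intro i
      simp only [dl, h2, zero_div, map_one, Derivation.map_one_eq_zero]
      exact (locrel π).zero_mem
    · simp only [dl, h4, Int.cast_one]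
      rw [div_self (cc_ne π.prime.ne_zero)]
      exact (locrel π).one_mem
  have hpoly : ∀ a : F[X], a ≠ 0 → ((∀ i, (dl D (cc a) (some i), dl D' (π.d.l (cc a)) i) ∈ locrel π) ∧
        (dl D (cc a) none, (π.d.v (cc a) : π.κ)) ∈ locrel π) := by
    intro a ha
    obtain ⟨n, c, rfl, hc⟩ := pex π.1 π.prime ha
    have hc0 : c ≠ 0 := by rintro rfl; simp at hc
    clear ha
    induction n with
    | zero => rw [pow_zero, one_mul]; exact hunit c hc
    | succ n ih =>
      have : cc (π.1 ^ (n + 1) * c) = cc π.1 * cc (π.1 ^ n * c) := by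
        rw [← map_mul]; congr 1; ring
      rw [this]
      exact hmul _ _ (cc_ne π.prime.ne_zero) (cc_ne (mul_ne_zero (pow_ne_zero _ π.prime.ne_zero) hc0)) hπ ih
  obtain ⟨a, b, hb, rfl⟩ := cc_rep x
  have ha : a ≠ 0 := by rintro rfl; simp at hx
  exact hdiv _ _ (cc_ne ha) (cc_ne hb) (hpoly a ha) (hpoly b hb)

theorem exists_transv {p : ℕ} [hp : Fact p.Prime] [CharP F p] : ∃ δ : Der F[X], ¬ π.1 ∣ δ π.1 := by
  by_cases h : derivative π.1 = 0
  · have hex : ∃ n, ∀ x : F, x ^ p ≠ π.1.coeff n := by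
      by_contra hcon
      push Not at hcon
      choose g hg using hcon
      have h1 := expand_contract p h hp.out.ne_zero
      have h2 : contract p π.1 ∈ (mapRingHom (frobenius F p)).range := by
        rw [Polynomial.mem_map_range]
        intro n
        rw [coeff_contract hp.out.ne_zero]
        exact ⟨g _, hg _⟩
      obtain ⟨r, hr⟩ := h2
      have h3 : π.1 = r ^ p := by
        rw [← h1, ← hr, coe_mapRingHom, ← Polynomial.map_expand, Polynomial.map_frobenius_expand]
      have := π.2.2
      rw [h3] at this
      exact not_irreducible_pow hp.out.ne_one this
    obtain ⟨n, hn⟩ := hex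
    obtain ⟨D, hD⟩ := exists_der_ne hn
    refine ⟨pco D, π.not_dvd_of_deg ?_ ?_⟩
    · intro h0
      apply hD
      rw [← pco_coeff, h0, coeff_zero]
    · rw [natDegree_lt_iff_degree_lt (by
        intro h0
        apply hD
        rw [← pco_coeff, h0, coeff_zero]), degree_lt_iff_coeff_zero]
      intro m hm
      rw [pco_coeff]
      rcases hm.eq_or_lt with rfl | hm
      · rw [π.2.1.coeff_natDegree, Derivation.map_one_eq_zero]
      · rw [coeff_eq_zero_of_natDegree_lt hm, map_zero]
  · refine ⟨mkDer (derivative : F[X] →ₗ[F] F[X]).toAddMonoidHom (by intro a b; simp; ring), π.not_dvd_of_deg h ?_⟩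
    exact natDegree_derivative_lt (by have := π.2.2.natDegree_pos; omega)

theorem InI.res {p : ℕ} [hp : Fact p.Prime] [CharP F p] {z : MK (RatFunc F)} (hz : InI z) : InI (π.d.r z) := by
  obtain ⟨δ, hδ⟩ := exists_transv (p := p) π
  have hδ0 : cc (δ π.1) ≠ 0 := cc_ne (by intro h; rw [h] at hδ; simp at hδ)
  obtain ⟨E, hE⟩ := frac_der (A := F[X]) (K := RatFunc F)
    (AddMonoidHom.mk' (fun a => cc π.1 * cc (δ a) / cc (δ π.1)) (by intro a b; rw [map_add, cc_add]; ring))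
    (by
      intro a b
      simp only [AddMonoidHom.mk'_apply, Derivation.leibniz, smul_eq_mul, cc_add, cc_mul]
      ring)
  have hE' : ∀ a, E (cc a) = cc π.1 * cc (δ a) / cc (δ π.1) := hE
  have hlift : ∀ D' : Der π.κ, ∃ D : Der (RatFunc F), D (cc π.1) = 0 ∧
      ∀ c, (D (cc c), D' (AdjoinRoot.mk π.1 c)) ∈ locrel π := by
    intro D'
    obtain ⟨f, hf, hC, hX⟩ := poly_der (A := F) (RingHom.id F[X])
      (AddMonoidHom.mk' (fun a => AdjoinRoot.modByMonicHom π.2.1 (D' (AdjoinRoot.of π.1 a)))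
        (by intro a b; rw [map_add, map_add, map_add]))
      (by
        intro a b
        simp only [AddMonoidHom.mk'_apply, Derivation.leibniz, smul_eq_mul, map_add, map_mul, RingHom.id_apply]
        have key : ∀ (a : F) (y : π.κ), AdjoinRoot.modByMonicHom π.2.1 (AdjoinRoot.of π.1 a * y) =
            C a * AdjoinRoot.modByMonicHom π.2.1 y := by
          intro a y
          rw [← smul_eq_C_mul, ← map_smul, Algebra.smul_def]; rfl
        rw [key, key])
      (AdjoinRoot.modByMonicHom π.2.1 (D' (AdjoinRoot.root π.1)))
    have hmk : ∀ y : π.κ, AdjoinRoot.mk π.1 (AdjoinRoot.modByMonicHom π.2.1 y) = y :=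
      AdjoinRoot.mk_leftInverse π.2.1
    have hred : ∀ c, AdjoinRoot.mk π.1 (f c) = D' (AdjoinRoot.mk π.1 c) := by
      refine leib_ext (AdjoinRoot.mk π.1) ((AdjoinRoot.mk π.1 : F[X] →+ _).comp f)
        (AddMonoidHom.mk' (fun c => D' (AdjoinRoot.mk π.1 c)) (by intro a b; rw [map_add, map_add])) ?_ ?_ ?_ ?_
      · intro a b
        simp [hf]
      · intro a b
        simp
      · intro a
        simp only [AddMonoidHom.comp_apply, AddMonoidHom.mk'_apply, AddMonoidHom.coe_coe, hC, hmk]; rfl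
      · simp only [AddMonoidHom.comp_apply, AddMonoidHom.mk'_apply, AddMonoidHom.coe_coe, hX, hmk]; rfl
    obtain ⟨h, hh⟩ : π.1 ∣ f π.1 := by
      rw [← AdjoinRoot.mk_eq_zero, hred, AdjoinRoot.mk_self, map_zero]
    obtain ⟨G, hG⟩ := frac_der (A := F[X]) (K := RatFunc F)
      (AddMonoidHom.mk' (fun a => cc (f a)) (by intro a b; rw [map_add, cc_add]))
      (by intro a b; simp only [AddMonoidHom.mk'_apply, hf, cc_add, cc_mul, RingHom.id_apply])
    have hG' : ∀ a, G (cc a) = cc (f a) := hG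
    refine ⟨dsub G E (cc h), ?_, ?_⟩
    · rw [dsub_apply, hG', hE', hh, cc_mul, mul_div_assoc, div_self hδ0]; ring
    · intro c
      rw [dsub_apply, hG', hE']
      have h1 := locrel_div π (locrel_poly π (h * (π.1 * δ c))) hδ
      have h2 := (locrel π).sub_mem (locrel_poly π (f c)) h1
      rw [hred] at h2
      simpa [mul_div_assoc] using h2
  choose lf hlf1 hlf2 using hlift
  have key := fm_res π.d (id : Der π.κ → Der π.κ) (fun o => o.elim E lf) (locrel π)
  have hloc := @dl_loc F _ π _ (id : Der π.κ → Der π.κ) (fun o => o.elim E lf) hlf2 hlf1 (by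
      intro c
      show (E (cc c), 0) ∈ _
      rw [hE']
      have h1 := locrel_div π (locrel_poly π (π.1 * δ c)) hδ
      simpa using h1) (by
      show E (cc π.1) = _
      rw [hE']; field_simp)
  funext L
  have h3 := (key (fun x hx => (hloc hx).1) (fun x hx => (hloc hx).2) z L).2
  rw [hz.fm] at h3
  exact locrel_zero π h3

end place

end Izh

namespace Izh

section ext
variable {p m : ℕ} [hp : Fact p.Prime] {F K : Type} [Field F] [Field K] [CharP F p] [CharP K p]

/-- A purely transcendental-like extension: derivations extend killing `T`. -/
structure Ex (C : F →+* K) (T : Set K) : Prop where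
  gen : Subfield.closure (Set.range C ∪ T) = ⊤
  ext : ∀ d : Der F, ∃ D : Der K, (∀ a, D (C a) = C (d a)) ∧ ∀ t ∈ T, D t = 0

/-- Compatible p-derivation data. -/
structure ExPD (C : F →+* K) (T : Set K) (𝒟 : PD p m F) (𝒟' : PD p m K) : Prop where
  DC : ∀ i a, 𝒟'.D i (C a) = C (𝒟.D i a)
  DT : ∀ i, ∀ t ∈ T, 𝒟'.D i t = 0
  b : ∀ i, 𝒟'.b i = C (𝒟.b i)

theorem Ex.pd {C : F →+* K} {T : Set K} (h : Ex C T) (𝒟 : PD p m F) : ∃ 𝒟' : PD p m K, ExPD C T 𝒟 𝒟' := by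
  choose D hD1 hD2 using fun i => h.ext (𝒟.D i)
  have hit : ∀ i n a, (D i)^[n] (C a) = C ((𝒟.D i)^[n] a) := by
    intro i n
    induction n with
    | zero => intro a; rfl
    | succ n ih => intro a; rw [Function.iterate_succ_apply, Function.iterate_succ_apply, hD1, ih]
  refine ⟨⟨D, ?_, ?_, fun i => C (𝒟.b i), ?_, ?_⟩, hD1, hD2, fun i => rfl⟩
  · intro i j x
    have := der_uniq (RingHom.id K) (fun x => D i (D j x) - D j (D i x)) (fun x => 0)
      (by intro x y; simp only [map_add]; ring) (by intros; simp)
      (by intro x y; simp only [Derivation.leibniz, map_add, smul_eq_mul, RingHom.id_apply]; ring)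
      (by intros; simp) h.gen (by
        rintro x (⟨y, rfl⟩ | hx)
        · simp only [hD1, 𝒟.comm i j, sub_self]
        · simp only [hD2 _ x hx, map_zero, sub_self]) x
    exact sub_eq_zero.1 this
  · intro i x
    refine der_uniq (RingHom.id K) (fun x => (D i)^[p] x) (fun x => D i x) ?_ ?_ ?_ ?_ h.gen ?_ x
    · intro x y; exact iterate_map_add (D i) p x y
    · intro x y; simp
    · intro x y; exact iter_leib (D i) x y
    · intro x y; simp
    · rintro x (⟨y, rfl⟩ | hx)
      · show (D i)^[p] (C y) = D i (C y)
        rw [hit, 𝒟.pow, hD1]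
      · show (D i)^[p] x = D i x
        rw [← iter_p, hD2 i x hx]
        exact Function.iterate_fixed (map_zero (D i)) _
  · intro i; simpa using 𝒟.b_ne i
  · intro i j
    rw [hD1, 𝒟.D_b]
    split_ifs <;> simp

theorem ExPD.InI {C : F →+* K} {T : Set K} (h : Ex C T) {𝒟 : PD p m F} {𝒟' : PD p m K} (hx : ExPD C T 𝒟 𝒟')
    (hb : Subfield.closure (Set.range (fun x : F => x ^ p) ∪ Set.range 𝒟.b) = ⊤)
    (ψ : K →+* K) (hψC : ∀ a, ψ (C a) = C a) (hψT : ∀ t ∈ T, ψ t = t ^ p) {u : MK K} (hu : fm 𝒟'.D u = 0) :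
    InI (mp ψ u) := by
  have hgen : Subfield.closure (C '' (Set.range (fun x : F => x ^ p) ∪ Set.range 𝒟.b) ∪ T) = ⊤ := by
    rw [eq_top_iff, ← h.gen, Subfield.closure_le]
    set M := Subfield.closure (C '' (Set.range (fun x : F => x ^ p) ∪ Set.range 𝒟.b) ∪ T) with hM
    have hsub : ∀ x ∈ (C '' (Set.range (fun x : F => x ^ p) ∪ Set.range 𝒟.b) ∪ T), x ∈ M :=
      fun x hx => Subfield.subset_closure hx
    rintro x (⟨y, rfl⟩ | hx)
    · have : (⊤ : Subfield F) ≤ M.comap C := by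
        rw [← hb, Subfield.closure_le]
        intro z hz
        exact hsub _ (Or.inl ⟨z, hz, rfl⟩)
      exact this trivial
    · exact hsub _ (Or.inr hx)
  show fm (id : Der K → Der K) (mp ψ u) = 0
  rw [fm_tsub ψ 𝒟'.D (id : Der K → Der K) (fun D i => D (C (𝒟.b i)) / C (𝒟.b i)) ?_ u, hu, tsub_zero]
  intro D x
  show D (ψ x) = _
  refine der_uniq ψ (fun x => D (ψ x)) (fun x => ∑ i, D (C (𝒟.b i)) / C (𝒟.b i) * ψ (𝒟'.D i x))
    ?_ ?_ ?_ ?_ hgen ?_ x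
  · intro x y; simp only [map_add]
  · intro x y; simp only [map_add, mul_add, Finset.sum_add_distrib]
  · intro x y; simp only [map_mul, Derivation.leibniz, smul_eq_mul]
  · intro x y
    simp only [map_mul, Derivation.leibniz, smul_eq_mul, map_add, mul_add, Finset.sum_add_distrib, Finset.mul_sum]
    congr 1 <;> exact Finset.sum_congr rfl (fun i _ => by ring)
  · rintro x (⟨y, (⟨w, rfl⟩ | ⟨j, rfl⟩), rfl⟩ | hx')
    · simp only [map_pow, D_frob, map_zero, mul_zero, Finset.sum_const_zero]
    · simp only [hψC, hx.DC, 𝒟.D_b]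
      rw [Finset.sum_eq_single j]
      · have : C (𝒟.b j) ≠ 0 := by simpa using 𝒟.b_ne j
        rw [if_pos rfl]; field_simp
      · intro i _ hij
        rw [if_neg hij, map_zero, mul_zero]
      · simp
    · simp only [hψT x hx', D_frob, hx.DT _ x hx', map_zero, mul_zero, Finset.sum_const_zero]

theorem ExPD.place {C : F →+* K} {T : Set K} (h : Ex C T) {𝒟 : PD p m F} {𝒟' : PD p m K} (hx : ExPD C T 𝒟 𝒟')
    {κ : Type} [Field κ] (φ : F →+* κ) (δ : Fin m → Der κ) (hδ : ∀ i a, δ i (φ a) = φ (𝒟.D i a))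
    (E : K →+* Hh κ) (hE : ∀ a, E (C a) = HahnSeries.C (φ a)) (hET : ∀ i, ∀ t ∈ T, hd (δ i) (E t) = 0) (i : Fin m) (x : K) :
    E (𝒟'.D i x) = hd (δ i) (E x) := by
  refine der_uniq E (fun x => E (𝒟'.D i x)) (fun x => hd (δ i) (E x)) ?_ ?_ ?_ ?_ h.gen ?_ x
  · intro x y; simp only [map_add]
  · intro x y; simp only [map_add]
  · intro x y; simp only [map_mul, Derivation.leibniz, smul_eq_mul, map_add]
  · intro x y; simp only [map_mul, Derivation.leibniz, smul_eq_mul]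
  · rintro x (⟨y, rfl⟩ | hx')
    · simp only [hx.DC, hE, hd_C, hδ]
    · simp only [hx.DT i x hx', map_zero, hET i x hx']

theorem hd_single {κ : Type} [Field κ] (δ : Der κ) (γ : ℝ) (c : κ) :
    hd δ (HahnSeries.single γ c) = HahnSeries.single γ (δ c) := by
  ext g
  rw [hd_coeff, HahnSeries.coeff_single, HahnSeries.coeff_single]
  split_ifs <;> simp

end ext

section rf
open Polynomial
variable {F : Type} [Field F]

theorem ratgen : Subfield.closure (Set.range (RatFunc.C : F →+* RatFunc F) ∪ {RatFunc.X}) = ⊤ := by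
  rw [eq_top_iff]
  set M := Subfield.closure (Set.range (RatFunc.C : F →+* RatFunc F) ∪ {RatFunc.X}) with hM
  have h1 : ∀ a : F, RatFunc.C a ∈ M := fun a => Subfield.subset_closure (Or.inl ⟨a, rfl⟩)
  have h2 : RatFunc.X ∈ M := Subfield.subset_closure (Or.inr rfl)
  have hp : ∀ f : F[X], cc f ∈ M := by
    intro f
    induction f using Polynomial.induction_on' with
    | add a b h1 h2 => rw [cc_add]; exact M.add_mem h1 h2
    | monomial n a =>
      rw [← C_mul_X_pow_eq_monomial, cc_mul, cc_C]
      refine M.mul_mem (h1 a) ?_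
      have : cc (X ^ n : F[X]) = RatFunc.X ^ n := by
        show algebraMap _ _ _ = _
        rw [map_pow, RatFunc.algebraMap_X]
      rw [this]
      exact M.pow_mem h2 n
  intro x _
  obtain ⟨a, b, hb, rfl⟩ := cc_rep x
  exact M.div_mem (hp a) (hp b)

theorem ratEx : Ex (RatFunc.C : F →+* RatFunc F) {RatFunc.X} where
  gen := ratgen
  ext := by
    intro d
    obtain ⟨D, hD⟩ := frac_der (A := F[X]) (K := RatFunc F)
      (AddMonoidHom.mk' (fun a => cc (pco d a)) (by intro a b; rw [map_add, cc_add]))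
      (by intro a b; simp only [AddMonoidHom.mk'_apply, Derivation.leibniz, smul_eq_mul, cc_add, cc_mul])
    have hD' : ∀ a, D (cc a) = cc (pco d a) := hD
    refine ⟨D, ?_, ?_⟩
    · intro a
      rw [← cc_C, hD', pco_C, cc_C]
    · rintro t rfl
      rw [← RatFunc.algebraMap_X]
      refine (hD' X).trans ?_
      rw [pco_X]; exact map_zero _

theorem ratFG {p : ℕ} (h : FG p F) : FG p (RatFunc F) :=
  h.ext RatFunc.C {RatFunc.X} (by rw [Finset.coe_singleton]; exact ratgen)

theorem adjFG {p : ℕ} (h : FG p F) (π : MI F) : FG p π.κ := by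
  refine h.ext (AdjoinRoot.of π.1) {AdjoinRoot.root π.1} ?_
  rw [eq_top_iff, Finset.coe_singleton]
  set M := Subfield.closure (Set.range (AdjoinRoot.of π.1) ∪ {AdjoinRoot.root π.1}) with hM
  have h1 : ∀ a : F, AdjoinRoot.of π.1 a ∈ M := fun a => Subfield.subset_closure (Or.inl ⟨a, rfl⟩)
  have h2 : AdjoinRoot.root π.1 ∈ M := Subfield.subset_closure (Or.inr rfl)
  intro x _
  obtain ⟨f, rfl⟩ := AdjoinRoot.mk_surjective x
  induction f using Polynomial.induction_on' with
  | add a b h1 h2 => rw [map_add]; exact M.add_mem (h1 trivial) (h2 trivial)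
  | monomial n a =>
    rw [← C_mul_X_pow_eq_monomial, map_mul, map_pow, AdjoinRoot.mk_C, AdjoinRoot.mk_X]
    exact M.mul_mem (h1 a) (M.pow_mem h2 n)

theorem rat_hom_ext {B : Type} [CommRing B] [IsDomain B] (f g : RatFunc F →+* B) (h1 : ∀ a, f (RatFunc.C a) = g (RatFunc.C a))
    (h2 : f RatFunc.X = g RatFunc.X) : f = g := by
  apply IsLocalization.ringHom_ext (nonZeroDivisors F[X])
  apply Polynomial.ringHom_ext
  · intro a
    simp only [RingHom.comp_apply, RatFunc.algebraMap_C, h1]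
  · simp only [RingHom.comp_apply, RatFunc.algebraMap_X, h2]

end rf
end Izh

namespace Izh
section rfp
open Polynomial
variable {F : Type} [Field F]

/-- Polynomial-level version of `Eg`. -/
noncomputable def Eg0 (F : Type) [Field F] (γ : ℝ) : F[X] →+* Hh F :=
  Polynomial.eval₂RingHom HahnSeries.C (HahnSeries.single γ 1)

theorem Eg0_coeff {γ : ℝ} (hγ : γ ≠ 0) (f : F[X]) (n : ℕ) : (Eg0 F γ f).coeff (n * γ) = f.coeff n := by
  induction f using Polynomial.induction_on' with
  | add a b h1 h2 => rw [map_add, HahnSeries.coeff_add, h1, h2, Polynomial.coeff_add]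
  | monomial k a =>
    rw [Eg0, Polynomial.coe_eval₂RingHom, Polynomial.eval₂_monomial, HahnSeries.single_pow, HahnSeries.C_apply,
      HahnSeries.single_mul_single, HahnSeries.coeff_single, Polynomial.coeff_monomial]
    have : ((n : ℝ) * γ = 0 + k • γ) ↔ (k = n) := by
      rw [zero_add, nsmul_eq_mul]
      constructor
      · intro h
        exact_mod_cast (mul_right_cancel₀ hγ h).symm
      · rintro rfl; rfl
    simp only [this, one_pow, mul_one]

theorem Eg0_inj {γ : ℝ} (hγ : γ ≠ 0) : Function.Injective (Eg0 F γ) := by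
  intro f g h
  ext n
  rw [← Eg0_coeff hγ, h, Eg0_coeff hγ]

/-- The place of `F(t)` sending `t` to `r^γ`. -/
noncomputable def Eg {γ : ℝ} (hγ : γ ≠ 0) : RatFunc F →+* Hh F :=
  IsFractionRing.lift (A := F[X]) (Eg0_inj (F := F) hγ)

theorem Eg_cc {γ : ℝ} (hγ : γ ≠ 0) (f : F[X]) : Eg hγ (cc f) = Eg0 F γ f :=
  IsFractionRing.lift_algebraMap (A := F[X]) (Eg0_inj (F := F) hγ) f

theorem Eg_C {γ : ℝ} (hγ : γ ≠ 0) (a : F) : Eg hγ (RatFunc.C a) = HahnSeries.C a := by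
  rw [← cc_C, Eg_cc, Eg0, Polynomial.coe_eval₂RingHom, Polynomial.eval₂_C]

theorem Eg_X {γ : ℝ} (hγ : γ ≠ 0) : Eg hγ (RatFunc.X : RatFunc F) = HahnSeries.single γ 1 := by
  rw [← RatFunc.algebraMap_X]
  refine (Eg_cc hγ X).trans ?_
  rw [Eg0, Polynomial.coe_eval₂RingHom, Polynomial.eval₂_X]

theorem lcE_C {K κ : Type} [Field K] [Field κ] (E : K →+* Hh κ) (φ : K →+* κ) (h : ∀ a, E a = HahnSeries.C (φ a)) (z : MK K) :
    lcE E z = mp φ z := by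
  have : lcE E = mp φ := by
    apply MK.hom_ext
    intro x
    rw [lcE_sy, mp_sy, h, hlc_apply, HahnSeries.C_apply, HahnSeries.leadingCoeff_of_single]
  rw [this]

theorem lcEg_C {γ : ℝ} (hγ : γ ≠ 0) (c : MK F) : lcE (Eg hγ) (mp RatFunc.C c) = c := by
  rw [lcE_mp, lcE_C _ (RingHom.id F) (fun a => Eg_C hγ a), mp_id]

/-- The rational function `(1+at)/(1+t)`. -/
noncomputable def Aa (a : F) : RatFunc F := (1 + RatFunc.C a * RatFunc.X) / (1 + RatFunc.X)

theorem hlc_pos1 {γ : ℝ} (hγ : 0 < γ) (a : F) : hlc (1 + HahnSeries.C a * HahnSeries.single γ 1 : Hh F) = 1 := by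
  apply hlc_pos
  rw [add_sub_cancel_left]
  refine mem_hpos.2 ?_
  rw [HahnSeries.C_apply, HahnSeries.single_mul_single, zero_add, mul_one]
  exact lt_of_lt_of_le (b := (γ : WithTop ℝ)) (by exact_mod_cast hγ) HahnSeries.orderTop_single_le

theorem hlc_neg1 {γ : ℝ} (hγ : γ < 0) {a : F} (ha : a ≠ 0) : hlc (1 + HahnSeries.C a * HahnSeries.single γ 1 : Hh F) = a := by
  rw [HahnSeries.C_apply, HahnSeries.single_mul_single, zero_add, mul_one, add_comm, hlc_apply,
    HahnSeries.leadingCoeff_add_eq_left, HahnSeries.leadingCoeff_of_single]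
  rw [HahnSeries.orderTop_single ha, HahnSeries.orderTop_one]
  exact_mod_cast hγ

theorem Eg_Aa {γ : ℝ} (hγ : γ ≠ 0) (a : F) : Eg hγ (Aa a) =
    (1 + HahnSeries.C a * HahnSeries.single γ 1) / (1 + HahnSeries.C 1 * HahnSeries.single γ 1) := by
  rw [Aa, map_div₀, map_add, map_add, map_mul, Eg_C, Eg_X, map_one, HahnSeries.C_one, one_mul]

theorem hlc_Aa_pos {γ : ℝ} (hγ : 0 < γ) (a : F) : hlc (Eg hγ.ne' (Aa a)) = 1 := by
  rw [Eg_Aa, map_div₀, hlc_pos1 hγ, hlc_pos1 hγ, div_one]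

theorem hlc_Aa_neg {γ : ℝ} (hγ : γ < 0) {a : F} (ha : a ≠ 0) : hlc (Eg hγ.ne (Aa a)) = a := by
  rw [Eg_Aa, map_div₀, hlc_neg1 hγ ha, hlc_neg1 hγ one_ne_zero, div_one]

theorem exists_y {n : ℕ} {α : MK F} (hα : α ∈ dg F (n + 1)) : ∃ y ∈ dg (RatFunc F) (n + 1),
    (∀ (γ : ℝ) (h : 0 < γ), lcE (Eg h.ne') y = 0) ∧ ∀ (γ : ℝ) (h : γ < 0), lcE (Eg h.ne) y = α := by
  refine dg_induction (P := fun α => ∃ y ∈ dg (RatFunc F) (n + 1),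
    (∀ (γ : ℝ) (h : 0 < γ), lcE (Eg h.ne') y = 0) ∧ ∀ (γ : ℝ) (h : γ < 0), lcE (Eg h.ne) y = α) ?_ ?_ ?_ ?_ hα
  · exact ⟨0, zero_mem _, by simp, by simp⟩
  · rintro a b ⟨y, hy, h1, h2⟩ ⟨y', hy', h1', h2'⟩
    exact ⟨y + y', add_mem hy hy', by intro γ h; rw [map_add, h1 γ h, h1' γ h, add_zero], by intro γ h; rw [map_add, h2 γ h, h2' γ h]⟩
  · rintro a ⟨y, hy, h1, h2⟩
    exact ⟨-y, neg_mem hy, by intro γ h; rw [map_neg, h1 γ h, neg_zero], by intro γ h; rw [map_neg, h2 γ h]⟩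
  · intro x a ha
    by_cases hx : x = 0
    · exact ⟨0, zero_mem _, by simp, by simp [hx, sy_zero]⟩
    refine ⟨sy (Aa x) * mp RatFunc.C a, sy_mul_mem _ ((mp_homog _).mem ha), ?_, ?_⟩
    · intro γ h
      rw [map_mul, lcE_sy, hlc_Aa_pos h, sy_one, zero_mul]
    · intro γ h
      rw [map_mul, lcE_sy, hlc_Aa_neg h hx, lcEg_C]

theorem res_div {p n : ℕ} (hI : ∀ (π : MI F) (y : MK π.κ), y ∈ dg π.κ n → InI y → ∃ z' ∈ dg π.κ n, y = p • z')
    {u : MK (RatFunc F)} (hu : u ∈ dg _ (n + 1)) (hr : ∀ π : MI F, InI (π.d.r u)) :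
    ∃ z' ∈ dg (RatFunc F) (n + 1), ∃ c, u = p • z' + mp RatFunc.C c := by
  classical
  choose y hy hyp using fun π : MI F => hI π _ (π.d.r_mem hu) (hr π)
  choose z hz hz1 hz2 using fun π : MI F => M2 π (hy π)
  obtain ⟨S, hS⟩ := finite_res u
  refine ⟨∑ π ∈ S, z π, sum_mem fun π _ => hz π, ?_⟩
  obtain ⟨c, hc⟩ := M1 (z := u - p • ∑ π ∈ S, z π) (by
    intro π
    rw [map_sub, map_nsmul, map_sum]
    by_cases hπ : π ∈ S
    · rw [Finset.sum_eq_single π (fun π' _ h => hz2 π' π (Ne.symm h)) (fun h => absurd hπ h), hz1, ← hyp, sub_self]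
    · rw [Finset.sum_eq_zero (fun π' h => hz2 π' π (by rintro rfl; exact hπ h)), hS π hπ]; simp)
  exact ⟨c, by rw [← hc]; abel⟩

theorem div_of_coprime {G : Type} [AddCommGroup G] (H : AddSubgroup G) {p N : ℕ} (hN : N.Coprime p) {a b : G} (ha : a ∈ H)
    (hb : b ∈ H) (h : N • a = p • b) : ∃ c ∈ H, a = p • c := by
  have hbz := Nat.gcd_eq_gcd_ab N p
  rw [Nat.Coprime] at hN
  rw [hN] at hbz
  refine ⟨N.gcdA p • b + N.gcdB p • a, add_mem (zsmul_mem hb _) (zsmul_mem ha _), ?_⟩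
  calc a = (1 : ℤ) • a := (one_zsmul a).symm
    _ = ((N : ℤ) * N.gcdA p + p * N.gcdB p) • a := by rw [← hbz]; simp
    _ = N.gcdA p • (N • a) + p • (N.gcdB p • a) := by
      rw [add_smul, mul_comm, mul_smul, mul_smul, natCast_zsmul, natCast_zsmul]
    _ = _ := by rw [h, smul_add, smul_comm]

end rfp

section bkg
variable {p : ℕ} [hp : Fact p.Prime]

/-- Substitution `t ↦ t^p`. -/
noncomputable def psi (F : Type) [Field F] (p : ℕ) [Fact p.Prime] : RatFunc F →+* RatFunc F :=
  IsFractionRing.lift (A := Polynomial F) (K := RatFunc F)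
    (g := (algebraMap (Polynomial F) (RatFunc F)).comp (Polynomial.expand F p).toRingHom)
    ((IsFractionRing.injective (Polynomial F) (RatFunc F)).comp (Polynomial.expand_injective (Fact.out : p.Prime).pos))

theorem psi_cc {F : Type} [Field F] (f : Polynomial F) : psi F p (cc f) = cc (Polynomial.expand F p f) :=
  IsFractionRing.lift_algebraMap (A := Polynomial F) (K := RatFunc F) _ f

theorem psi_C {F : Type} [Field F] (a : F) : psi F p (RatFunc.C a) = RatFunc.C a := by
  rw [← cc_C, psi_cc, Polynomial.expand_C]

theorem psi_X {F : Type} [Field F] : psi F p (RatFunc.X) = RatFunc.X ^ p := by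
  rw [← RatFunc.algebraMap_X]
  refine (psi_cc (p := p) (F := F) Polynomial.X).trans ?_
  rw [Polynomial.expand_X]
  exact map_pow _ _ _

theorem Eg_psi {F : Type} [Field F] {γ γ' : ℝ} (hγ : γ ≠ 0) (hγ' : γ' ≠ 0) (h : γ' = p * γ) :
    (Eg hγ).comp (psi F p) = Eg hγ' := by
  apply rat_hom_ext
  · intro a
    rw [RingHom.comp_apply, psi_C, Eg_C, Eg_C]
  · rw [RingHom.comp_apply, psi_X, map_pow, Eg_X, Eg_X, HahnSeries.single_pow, one_pow, nsmul_eq_mul, h]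

theorem BKG (n : ℕ) : ∀ (F : Type) [Field F] [CharP F p], FG p F → ∀ z ∈ dg F n, InI z → ∃ z' ∈ dg F n, z = p • z' := by
  induction n with
  | zero =>
    intro F _ _ _ z hz hI
    obtain ⟨k, rfl⟩ := AddSubgroup.mem_zmultiples_iff.1 hz
    have h1 : fm (id : Der F → Der F) (k • (1 : MK F)) [] = 0 := by rw [hI]; rfl
    rw [fm_zsmul, fm_one] at h1
    have h2 : (k : F) = 0 := by simpa [vac] using h1
    obtain ⟨j, rfl⟩ := (CharP.intCast_eq_zero_iff F p k).1 h2
    refine ⟨j • 1, zsmul_mem one_mem_dg j, ?_⟩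
    rw [mul_smul, natCast_zsmul]
  | succ n ih =>
    intro F _ _ hF α hα hI
    obtain ⟨m, 𝒟, hb⟩ := exists_PD hF
    haveI : CharP (RatFunc F) p := charP_of_injective_ringHom (RatFunc.C : F →+* RatFunc F).injective p
    obtain ⟨𝒟', hx⟩ := ratEx.pd 𝒟
    obtain ⟨y, hy, hy0, hyi⟩ := exists_y hα
    have hp0 : (0 : ℝ) < p := by exact_mod_cast hp.out.pos
    have hpl : ∀ (γ : ℝ) (h : γ ≠ 0) i x, Eg h (𝒟'.D i x) = hd (𝒟.D i) (Eg h x) := by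
      intro γ h
      refine ExPD.place ratEx hx (RingHom.id F) 𝒟.D (fun _ _ => rfl) (Eg h) (Eg_C h) ?_
      rintro i t rfl
      rw [Eg_X, hd_single, Derivation.map_one_eq_zero, HahnSeries.single_eq_zero]
    have hm0 : (-p : ℝ) < 0 := neg_lt_zero.2 hp0
    let P0 : Pl 𝒟'.D := ⟨F, 𝒟.D, Eg hp0.ne', hpl _ _⟩
    let P1 : Pl 𝒟'.D := ⟨F, 𝒟.D, Eg hm0.ne, hpl _ _⟩
    obtain ⟨w, hw, hfw, N, hN, hlw⟩ := lemS 𝒟' (fun P => P = P0 ∨ P = P1) hy (by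
      rintro P (rfl | rfl)
      · show fm 𝒟.D (lcE (Eg hp0.ne') y) = 0
        rw [hy0 _ hp0, fm_zero]
      · show fm 𝒟.D (lcE (Eg hm0.ne) y) = 0
        rw [hyi _ hm0]; exact hI.fm _)
    have hl0 : N • lcE (Eg hp0.ne') w = 0 := hlw P0 (Or.inl rfl)
    have hl1 : N • lcE (Eg hm0.ne) w = 0 := hlw P1 (Or.inr rfl)
    have hI2 : InI (mp (psi F p) (y - w)) := ExPD.InI ratEx hx hb (psi F p) psi_C
      (by rintro t rfl; exact psi_X) (by rw [fm_sub, hfw, sub_self])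
    obtain ⟨z', hz', c, hc⟩ := res_div (p := p) (n := n) (u := mp (psi F p) (y - w)) (by
        intro π y hy hI
        haveI : CharP π.κ p := charP_of_injective_ringHom (AdjoinRoot.of π.1).injective p
        exact ih π.κ (adjFG hF π) y hy hI)
      ((mp_homog _).mem (sub_mem hy hw)) (fun π => InI.res (p := p) π hI2)
    have e0 := congrArg (lcE (Eg (F := F) one_ne_zero)) hc
    have hm1 : (-1 : ℝ) ≠ 0 := by norm_num
    have e1 := congrArg (lcE (Eg (F := F) hm1)) hc
    rw [lcE_mp, Eg_psi one_ne_zero hp0.ne' (by ring), map_sub, hy0 _ hp0, map_add, map_nsmul, lcEg_C] at e0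
    rw [lcE_mp, Eg_psi hm1 hm0.ne (by ring), map_sub, hyi _ hm0, map_add, map_nsmul, lcEg_C] at e1
    have e0' := congrArg (fun q => N • q) e0
    have e1' := congrArg (fun q => N • q) e1
    simp only [smul_sub, smul_add, hl0, hl1, smul_zero, sub_zero] at e0' e1'
    refine div_of_coprime (dg F (n + 1)) hN hα (b := N • (lcE (Eg hm1) z' - lcE (Eg one_ne_zero) z'))
      (nsmul_mem (sub_mem ((lcE_homog _).mem hz') ((lcE_homog _).mem hz')) _) ?_
    rw [e1', smul_sub, smul_sub, smul_comm p N, smul_comm p N, eq_sub_iff_add_eq, add_assoc, add_comm (N • c), ← e0', add_zero]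
end bkg
end Izh

namespace Izh
section two
variable {k : Type} [Field k]

/-- Two-variable polynomial ring. -/
abbrev M2P (k : Type) [Field k] := MvPolynomial (Fin 2) k

theorem mv_der {B : Type} [CommRing B] (φ : M2P k →+* B) (d : k →+ B)
    (h : ∀ a b, d (a * b) = φ (MvPolynomial.C a) * d b + φ (MvPolynomial.C b) * d a) :
    ∃ f : M2P k →+ B, (∀ a b, f (a * b) = φ a * f b + φ b * f a) ∧ (∀ a, f (MvPolynomial.C a) = d a) ∧
      ∀ i, f (MvPolynomial.X i) = 0 := by
  set T : M2P k →+* TrivSqZeroExt B B := MvPolynomial.eval₂Hom (toDual (φ.comp MvPolynomial.C) d h)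
    (fun i => ((φ (MvPolynomial.X i), 0) : TrivSqZeroExt B B)) with hT
  have hC : ∀ a, T (MvPolynomial.C a) = toDual (φ.comp MvPolynomial.C) d h a := fun a => MvPolynomial.eval₂Hom_C _ _ _
  have hX : ∀ i, T (MvPolynomial.X i) = ((φ (MvPolynomial.X i), 0) : TrivSqZeroExt B B) :=
    fun i => MvPolynomial.eval₂Hom_X' _ _ _
  have hfst : (TrivSqZeroExt.fstHom B B B).toRingHom.comp T = φ := by
    apply MvPolynomial.ringHom_ext
    · intro a
      show (T (MvPolynomial.C a)).fst = _
      rw [hC, toDual_fst]; rfl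
    · intro i
      show (T (MvPolynomial.X i)).fst = _
      rw [hX]; rfl
  obtain ⟨g, hg, hg2⟩ := ofDual φ T (fun a => congrArg (fun q => q a) hfst)
  refine ⟨g, hg, fun a => ?_, fun i => ?_⟩
  · rw [hg2, hC]; rfl
  · rw [hg2, hX]; rfl

variable {K : Type} [Field K] [Algebra (M2P k) K] [IsFractionRing (M2P k) K]

/-- Embedding of polynomials. -/
noncomputable abbrev kk (k K : Type) [Field k] [Field K] [Algebra (M2P k) K] : M2P k →+* K := algebraMap (M2P k) K

/-- Embedding of constants. -/
noncomputable def kC (k K : Type) [Field k] [Field K] [Algebra (M2P k) K] : k →+* K := (kk k K).comp MvPolynomial.C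

/-- The set of variables. -/
def kT (k K : Type) [Field k] [Field K] [Algebra (M2P k) K] : Set K := Set.range fun i => kk k K (MvPolynomial.X i)

theorem mv_gen : Subfield.closure (Set.range (kC k K) ∪ kT k K) = ⊤ := by
  rw [eq_top_iff]
  set M := Subfield.closure (Set.range (kC k K) ∪ kT k K) with hM
  have h1 : ∀ a : k, kC k K a ∈ M := fun a => Subfield.subset_closure (Or.inl ⟨a, rfl⟩)
  have h2 : ∀ i, kk k K (MvPolynomial.X i) ∈ M := fun i => Subfield.subset_closure (Or.inr ⟨i, rfl⟩)
  have hp : ∀ f : M2P k, kk k K f ∈ M := by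
    intro f
    induction f using MvPolynomial.induction_on with
    | C a => exact h1 a
    | add a b h1 h2 => rw [map_add]; exact M.add_mem h1 h2
    | mul_X a i h => rw [map_mul]; exact M.mul_mem h (h2 i)
  intro x _
  obtain ⟨a, b, hb, rfl⟩ := IsFractionRing.div_surjective (A := M2P k) x
  exact M.div_mem (hp a) (hp b)

theorem mvEx : Ex (kC k K) (kT k K) where
  gen := mv_gen
  ext := by
    intro d
    obtain ⟨f, hf, hfC, hfX⟩ := mv_der (kk k K) (AddMonoidHom.mk' (fun a => kC k K (d a)) (by intro a b; rw [map_add, map_add]))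
      (by
        intro a b
        simp only [AddMonoidHom.mk'_apply, Derivation.leibniz, smul_eq_mul, map_add, map_mul]; rfl)
    obtain ⟨D, hD⟩ := frac_der (A := M2P k) (K := K) f hf
    refine ⟨D, ?_, ?_⟩
    · intro a
      exact (hD _).trans (hfC a)
    · rintro _ ⟨i, rfl⟩
      exact (hD _).trans (hfX i)

theorem mvFG {p : ℕ} (h : FG p k) : FG p K := by
  classical
  refine h.ext (kC k K) (Finset.univ.image fun i => kk k K (MvPolynomial.X i)) ?_
  rw [Finset.coe_image, Finset.coe_univ, Set.image_univ]
  exact mv_gen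

/-- Parameters of a place. -/
structure Par where
  α : ℝ
  β : ℝ
  m : ℕ
  n : ℕ
  h : α * n ≠ β * m

/-- weight -/
def Par.w (q : Par) (e : Fin 2 →₀ ℕ) : ℝ := q.α * e 0 + q.β * e 1
/-- exponent of the residue variable -/
def Par.N (q : Par) (e : Fin 2 →₀ ℕ) : ℕ := q.m * e 0 + q.n * e 1

theorem Par.inj (q : Par) {e e' : Fin 2 →₀ ℕ} (h1 : q.w e = q.w e') (h2 : q.N e = q.N e') : e = e' := by
  have h3 : (q.m : ℝ) * e 0 + q.n * e 1 = q.m * e' 0 + q.n * e' 1 := by exact_mod_cast h2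
  unfold Par.w at h1
  have hd : q.α * q.n - q.β * q.m ≠ 0 := sub_ne_zero.2 q.h
  have a0 : (q.α * q.n - q.β * q.m) * ((e 0 : ℝ) - e' 0) = 0 := by linear_combination q.n * h1 - q.β * h3
  have a1 : (q.α * q.n - q.β * q.m) * ((e 1 : ℝ) - e' 1) = 0 := by linear_combination q.α * h3 - q.m * h1
  have b0 := sub_eq_zero.1 ((mul_eq_zero.1 a0).resolve_left hd)
  have b1 := sub_eq_zero.1 ((mul_eq_zero.1 a1).resolve_left hd)
  ext i
  fin_cases i
  · exact_mod_cast b0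
  · exact_mod_cast b1

/-- Lexicographic comparison. -/
def Par.Less (q : Par) (σ : ℝ) (e e' : Fin 2 →₀ ℕ) : Prop := q.w e < q.w e' ∨ (q.w e = q.w e' ∧ q.N e * σ < q.N e' * σ)

theorem Par.exists_lead (q : Par) {σ : ℝ} (hσ : σ ≠ 0) {f : M2P k} (hf : f ≠ 0) :
    ∃ e ∈ f.support, ∀ e' ∈ f.support, e' ≠ e → q.Less σ e e' := by
  obtain ⟨e, he, hmin⟩ := Finset.exists_min_image f.support (fun e => toLex (q.w e, (q.N e : ℝ) * σ))
    (MvPolynomial.support_nonempty.2 hf)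
  refine ⟨e, he, fun e' he' hne => ?_⟩
  have := hmin e' he'
  rw [Prod.Lex.le_iff] at this
  rcases this with h | ⟨h, h'⟩
  · exact Or.inl h
  · refine Or.inr ⟨h, lt_of_le_of_ne h' ?_⟩
    intro h''
    exact hne (q.inj h (by exact_mod_cast mul_right_cancel₀ hσ h'')).symm

theorem hsum_coeff {κ ι : Type} [Field κ] (S : Finset ι) (w : ι → ℝ) (c : ι → κ) (g : ℝ) :
    (∑ i ∈ S, HahnSeries.single (w i) (c i) : Hh κ).coeff g = ∑ i ∈ S.filter (fun i => w i = g), c i := by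
  classical
  rw [HahnSeries.coeff_sum, Finset.sum_filter]
  refine Finset.sum_congr rfl fun i _ => ?_
  rw [HahnSeries.coeff_single]
  by_cases h : w i = g
  · rw [if_pos h, if_pos h.symm]
  · rw [if_neg h, if_neg (Ne.symm h)]

theorem hord {κ : Type} [Field κ] {x : Hh κ} {g : ℝ} (hg : x.coeff g ≠ 0) (h : ∀ g' < g, x.coeff g' = 0) :
    x.orderTop = g ∧ hlc x = x.coeff g := by
  have hx : x ≠ 0 := by rintro rfl; simp at hg
  have h1 : x.order = g := by
    apply le_antisymm
    · exact HahnSeries.order_le_of_coeff_ne_zero hg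
    · by_contra hlt
      exact HahnSeries.coeff_order_eq_zero.not.2 hx (h _ (not_le.1 hlt))
  constructor
  · rw [← h1, HahnSeries.order_eq_orderTop_of_ne_zero hx]
  · rw [hlc_apply, HahnSeries.leadingCoeff_eq, h1]

theorem hlead {κ ι : Type} [Field κ] (S : Finset ι) (w : ι → ℝ) (c : ι → κ) {g : ℝ} (hg : ∀ i ∈ S, g ≤ w i)
    (hc : ∑ i ∈ S.filter (fun i => w i = g), c i ≠ 0) :
    (∑ i ∈ S, HahnSeries.single (w i) (c i) : Hh κ).orderTop = g ∧
    hlc (∑ i ∈ S, HahnSeries.single (w i) (c i) : Hh κ) = ∑ i ∈ S.filter (fun i => w i = g), c i := by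
  rw [← hsum_coeff] at hc ⊢
  refine hord hc ?_
  intro g' hg'
  rw [hsum_coeff, Finset.sum_eq_zero]
  intro i hi
  rw [Finset.mem_filter] at hi
  exact absurd (hg i hi.1) (by rw [hi.2]; exact not_le.2 hg')

/-- Polynomial-level place. -/
noncomputable def Par.E0 (k : Type) [Field k] (q : Par) : M2P k →+* Hh (RatFunc k) :=
  MvPolynomial.eval₂Hom (HahnSeries.C.comp RatFunc.C)
    ![HahnSeries.single q.α (RatFunc.X ^ q.m), HahnSeries.single q.β (RatFunc.X ^ q.n)]

theorem Par.E0_eq (q : Par) (f : M2P k) : q.E0 k f =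
    ∑ e ∈ f.support, HahnSeries.single (q.w e) (RatFunc.C (f.coeff e) * RatFunc.X ^ q.N e) := by
  rw [Par.E0, MvPolynomial.coe_eval₂Hom, MvPolynomial.eval₂_eq']
  refine Finset.sum_congr rfl fun e _ => ?_
  rw [Fin.prod_univ_two, Matrix.cons_val_zero, Matrix.cons_val_one, Matrix.cons_val_fin_one, HahnSeries.single_pow,
    HahnSeries.single_pow, HahnSeries.single_mul_single, RingHom.comp_apply, HahnSeries.C_apply, HahnSeries.single_mul_single,
    Par.w, Par.N, pow_add, pow_mul, pow_mul, zero_add, nsmul_eq_mul, nsmul_eq_mul, mul_comm q.α, mul_comm q.β]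

theorem Par.lead (q : Par) {σ : ℝ} (hσ : σ ≠ 0) {f : M2P k} {e : Fin 2 →₀ ℕ} (he : e ∈ f.support)
    (hl : ∀ e' ∈ f.support, e' ≠ e → q.Less σ e e') :
    (q.E0 k f).orderTop = q.w e ∧ hlc (Eg hσ (hlc (q.E0 k f))) = f.coeff e := by
  classical
  set S := f.support.filter (fun e' => q.w e' = q.w e) with hS
  have heS : e ∈ S := by rw [hS, Finset.mem_filter]; exact ⟨he, rfl⟩
  have hce : f.coeff e ≠ 0 := MvPolynomial.mem_support_iff.1 he
  have e1 : Eg hσ (∑ e' ∈ S, (RatFunc.C (f.coeff e') * RatFunc.X ^ q.N e')) =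
      ∑ e' ∈ S, HahnSeries.single ((q.N e' : ℝ) * σ) (f.coeff e') := by
    rw [map_sum]
    refine Finset.sum_congr rfl fun e' _ => ?_
    rw [map_mul, map_pow, Eg_C, Eg_X, HahnSeries.single_pow, HahnSeries.C_apply, HahnSeries.single_mul_single, one_pow,
      mul_one, zero_add, nsmul_eq_mul]
  have hlt : ∀ e' ∈ S, e' ≠ e → (q.N e : ℝ) * σ < q.N e' * σ := by
    intro e' he' hne
    rw [hS, Finset.mem_filter] at he'
    rcases hl e' he'.1 hne with h | h
    · exact absurd he'.2 h.ne'
    · exact h.2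
  have hfil : S.filter (fun e' => (q.N e' : ℝ) * σ = q.N e * σ) = {e} := by
    ext e'
    rw [Finset.mem_filter, Finset.mem_singleton]
    constructor
    · rintro ⟨h1, h2⟩
      by_contra hne
      exact (hlt e' h1 hne).ne' h2
    · rintro rfl; exact ⟨heS, rfl⟩
  have h2 := hlead S (fun e' => (q.N e' : ℝ) * σ) (fun e' => f.coeff e') (g := q.N e * σ) (by
    intro e' he'
    by_cases h : e' = e
    · rw [h]
    · exact (hlt e' he' h).le) (by rw [hfil, Finset.sum_singleton]; exact hce)
  rw [hfil, Finset.sum_singleton, ← e1] at h2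
  have h3 := hlead f.support q.w (fun e' => RatFunc.C (f.coeff e') * RatFunc.X ^ q.N e') (g := q.w e) (by
    intro e' he'
    by_cases h : e' = e
    · rw [h]
    · rcases hl e' he' h with h | h
      · exact h.le
      · exact h.1.le) (by
    intro h
    rw [h, map_zero, map_zero] at h2
    exact hce h2.2.symm)
  rw [← Par.E0_eq] at h3
  refine ⟨h3.1, ?_⟩
  rw [h3.2]; exact h2.2

theorem Par.ord_le (q : Par) {f : M2P k} {e : Fin 2 →₀ ℕ} (he : e ∈ f.support) : (q.E0 k f).orderTop ≤ q.w e := by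
  have hf : f ≠ 0 := by rintro rfl; simp at he
  obtain ⟨e₀, he₀, hl⟩ := q.exists_lead one_ne_zero hf
  rw [(q.lead one_ne_zero he₀ hl).1]
  norm_cast
  by_cases h : e = e₀
  · rw [h]
  · rcases hl e he h with h | h
    · exact h.le
    · exact h.1.le

theorem Par.E0_inj (q : Par) : Function.Injective (q.E0 k) := by
  rw [injective_iff_map_eq_zero]
  intro f hf
  by_contra h0
  obtain ⟨e₀, he₀, hl⟩ := q.exists_lead one_ne_zero h0
  have := (q.lead one_ne_zero he₀ hl).1
  rw [hf, HahnSeries.orderTop_zero] at this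
  exact WithTop.top_ne_coe this

theorem Par.E0_C (q : Par) (a : k) : q.E0 k (MvPolynomial.C a) = HahnSeries.C (RatFunc.C a) :=
  MvPolynomial.eval₂Hom_C _ _ _

theorem Par.E0_X0 (q : Par) : q.E0 k (MvPolynomial.X 0) = HahnSeries.single q.α (RatFunc.X ^ q.m) :=
  MvPolynomial.eval₂Hom_X' _ _ _

theorem Par.E0_X1 (q : Par) : q.E0 k (MvPolynomial.X 1) = HahnSeries.single q.β (RatFunc.X ^ q.n) :=
  MvPolynomial.eval₂Hom_X' _ _ _

/-- The place. -/
noncomputable def Par.E (k K : Type) [Field k] [Field K] [Algebra (M2P k) K] [IsFractionRing (M2P k) K] (q : Par) : K →+* Hh (RatFunc k) :=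
  IsFractionRing.lift (A := M2P k) (K := K) (q.E0_inj (k := k))

theorem Par.E_kk (q : Par) (f : M2P k) : q.E k K (kk k K f) = q.E0 k f :=
  IsFractionRing.lift_algebraMap (A := M2P k) (K := K) q.E0_inj f

theorem Par.E_C (q : Par) (a : k) : q.E k K (kC k K a) = HahnSeries.C (RatFunc.C a) := by
  exact (q.E_kk (K := K) (MvPolynomial.C a)).trans (q.E0_C a)

theorem Par.lc_C (q : Par) (z : MK k) : lcE (q.E k K) (mp (kC k K) z) = mp RatFunc.C z := by
  rw [lcE_mp]
  refine lcE_C ((q.E k K).comp (kC k K)) RatFunc.C ?_ z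
  intro a
  rw [RingHom.comp_apply, q.E_C (K := K)]

/-- Ratio lemma. -/
theorem Par.ratio (q : Par) {f g : M2P k} {e : Fin 2 →₀ ℕ} (he : e ∈ g.support)
    (h : ∀ e' ∈ (f - g).support, q.w e < q.w e') : hlc (q.E k K (kk k K f / kk k K g)) = 1 := by
  have hg : q.E0 k g ≠ 0 := by
    rw [Ne, map_eq_zero_iff _ q.E0_inj]; rintro rfl; simp at he
  have h1 : (q.w e : WithTop ℝ) < (q.E0 k (f - g)).orderTop := by
    rw [q.E0_eq]
    refine Finset.sum_induction _ (fun x : Hh (RatFunc k) => (q.w e : WithTop ℝ) < x.orderTop) ?_ ?_ ?_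
    · intro a b ha hb
      exact lt_of_lt_of_le (lt_min ha hb) HahnSeries.min_orderTop_le_orderTop_add
    · rw [HahnSeries.orderTop_zero]; exact WithTop.coe_lt_top _
    · intro e' he'
      exact HahnSeries.lt_orderTop_single (h e' he')
  have h2 := lt_of_le_of_lt (q.ord_le he) h1
  have e1 : q.E0 k f = q.E0 k g + q.E0 k (f - g) := by rw [map_sub]; ring
  rw [map_div₀, q.E_kk, q.E_kk, map_div₀, e1, hlc_apply, hlc_apply, HahnSeries.leadingCoeff_add_eq_left h2]
  exact div_self (HahnSeries.leadingCoeff_ne_zero.2 hg)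

end two
end Izh

namespace Izh
section three
variable {k : Type} [Field k] {K : Type} [Field K] [Algebra (M2P k) K] [IsFractionRing (M2P k) K]
variable {p : ℕ} [hp : Fact p.Prime]

/-- Substitution of `p`-th powers of both variables. -/
noncomputable def psK (k K : Type) [Field k] [Field K] [Algebra (M2P k) K] [IsFractionRing (M2P k) K] (p : ℕ) [Fact p.Prime] :
    K →+* K :=
  IsFractionRing.lift (A := M2P k) (K := K) (g := (kk k K).comp (MvPolynomial.expand (σ := Fin 2) (R := k) p).toRingHom)
    ((IsFractionRing.injective (M2P k) K).comp (MvPolynomial.expand_injective (Fact.out : p.Prime).pos))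

theorem psK_kk (f : M2P k) : psK k K p (kk k K f) = kk k K (MvPolynomial.expand p f) :=
  IsFractionRing.lift_algebraMap (A := M2P k) (K := K) _ f

theorem psK_C (a : k) : psK k K p (kC k K a) = kC k K a := by
  refine (psK_kk (MvPolynomial.C a)).trans ?_
  rw [MvPolynomial.expand_C]; rfl

theorem psK_X (i : Fin 2) : psK k K p (kk k K (MvPolynomial.X i)) = kk k K (MvPolynomial.X i) ^ p := by
  rw [psK_kk, MvPolynomial.expand_X, map_pow]

/-- Scaling of parameters. -/
def Par.mul (q : Par) (p : ℕ) [hp : Fact p.Prime] : Par := ⟨p * q.α, p * q.β, p * q.m, p * q.n, by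
  have h0 : (p : ℝ) ≠ 0 := by exact_mod_cast hp.out.ne_zero
  push_cast
  intro h
  apply q.h
  have : (p : ℝ) * p * (q.α * q.n) = p * p * (q.β * q.m) := by linear_combination h
  exact mul_left_cancel₀ (mul_ne_zero h0 h0) this⟩

theorem mv_hom_ext {B : Type} [CommRing B] (f g : K →+* B) (h1 : ∀ a, f (kC k K a) = g (kC k K a))
    (h2 : ∀ i, f (kk k K (MvPolynomial.X i)) = g (kk k K (MvPolynomial.X i))) : f = g := by
  apply IsLocalization.ringHom_ext (nonZeroDivisors (M2P k))
  apply MvPolynomial.ringHom_ext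
  · intro a; exact h1 a
  · intro i; exact h2 i

theorem Par.E_X0 (q : Par) : q.E k K (kk k K (MvPolynomial.X 0)) = HahnSeries.single q.α (RatFunc.X ^ q.m) := by
  rw [q.E_kk, q.E0_X0]

theorem Par.E_X1 (q : Par) : q.E k K (kk k K (MvPolynomial.X 1)) = HahnSeries.single q.β (RatFunc.X ^ q.n) := by
  rw [q.E_kk, q.E0_X1]

theorem Par.E_psK (q : Par) : (q.E k K).comp (psK k K p) = (q.mul p).E k K := by
  apply mv_hom_ext (k := k)
  · intro a
    rw [RingHom.comp_apply, psK_C, Par.E_C, Par.E_C]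
  · intro i
    rw [RingHom.comp_apply, psK_X, map_pow]
    fin_cases i
    · simp only [Fin.zero_eta]
      rw [Par.E_X0, Par.E_X0, HahnSeries.single_pow, nsmul_eq_mul, ← pow_mul, mul_comm q.m]; rfl
    · simp only [Fin.mk_one]
      rw [Par.E_X1, Par.E_X1, HahnSeries.single_pow, nsmul_eq_mul, ← pow_mul, mul_comm q.n]; rfl

theorem filt {l : Filter ℝ} (q : ℝ → Par) {σ σ' : ℝ} (hσ : σ ≠ 0) (hσ' : σ' ≠ 0) (q' : Par)
    (h : ∀ e e', q'.Less σ' e e' → ∀ᶠ a in l, (q a).Less σ e e') (v : MK K) :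
    ∀ᶠ a in l, lcE (Eg hσ) (lcE ((q a).E k K) v) = lcE (Eg hσ') (lcE (q'.E k K) v) := by
  have hpoly : ∀ f : M2P k, f ≠ 0 → ∀ᶠ a in l, hlc (Eg hσ (hlc ((q a).E k K (kk k K f)))) =
      hlc (Eg hσ' (hlc (q'.E k K (kk k K f)))) := by
    intro f hf
    obtain ⟨e, he, hl⟩ := q'.exists_lead hσ' hf
    have : ∀ᶠ a in l, ∀ e' ∈ f.support, e' ≠ e → (q a).Less σ e e' := by
      rw [Filter.eventually_all_finset]
      intro e' he'
      by_cases hne : e' = e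
      · exact Filter.Eventually.of_forall fun a h' => absurd hne h'
      · filter_upwards [h e e' (hl e' he' hne)] with a ha _ using ha
    filter_upwards [this] with a ha
    rw [Par.E_kk, Par.E_kk, ((q a).lead hσ he ha).2, (q'.lead hσ' he hl).2]
  induction v using MK.induction with
  | h1 => exact Filter.Eventually.of_forall fun a => by simp only [map_one]
  | ha x y h1 h2 =>
    filter_upwards [h1, h2] with a h1 h2
    rw [map_add, map_add, map_add, map_add, h1, h2]
  | hn x h1 =>
    filter_upwards [h1] with a h1
    rw [map_neg, map_neg, map_neg, map_neg, h1]
  | hm x y hy =>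
    by_cases hx : x = 0
    · exact Filter.Eventually.of_forall fun a => by rw [hx, sy_zero, zero_mul, map_zero, map_zero, map_zero, map_zero]
    obtain ⟨f, g, hg, rfl⟩ := IsFractionRing.div_surjective (A := M2P k) x
    have hf : f ≠ 0 := by rintro rfl; simp at hx
    filter_upwards [hy, hpoly f hf, hpoly g (nonZeroDivisors.ne_zero hg)] with a h1 h2 h3
    rw [map_mul, map_mul, map_mul, map_mul, h1, lcE_sy, lcE_sy, lcE_sy, lcE_sy]
    congr 2
    simp only [map_div₀]
    rw [h2, h3]

/-- The places `(α, ε, 1, 0)`. -/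
def qa (ε : ℝ) (hε : ε ≠ 0) (α : ℝ) : Par := ⟨α, ε, 1, 0, by simpa using hε.symm⟩

/-- The places `(α, 0, 0, 1)`. -/
def qi (α : ℝ) (hα : α ≠ 0) : Par := ⟨α, 0, 0, 1, by simpa using hα⟩

theorem lc_const {ε : ℝ} (hε : ε ≠ 0) {h1 : (1 : ℝ) ≠ 0} {hm1 : (-1 : ℝ) ≠ 0} (v : MK K)
    (hc : ∀ α, lcE (Eg h1) (lcE ((qa ε hε α).E k K) v) = lcE (Eg hm1) (lcE ((qa ε hε α).E k K) v)) :
    lcE (Eg hε) (lcE ((qi 1 h1).E k K) v) = lcE (Eg hε) (lcE ((qi (-1) hm1).E k K) v) := by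
  set G : ℝ → MK k := fun α => lcE (Eg h1) (lcE ((qa ε hε α).E k K) v) with hG
  have hloc : IsLocallyConstant G := by
    rw [IsLocallyConstant.iff_eventually_eq]
    intro α0
    have hcont : ∀ e e' : Fin 2 →₀ ℕ, (qa ε hε α0).w e < (qa ε hε α0).w e' → ∀ᶠ a in nhds α0, (qa ε hε a).w e < (qa ε hε a).w e' := by
      intro e e' h
      have c1 : ContinuousAt (fun a => (qa ε hε a).w e) α0 := by simp only [Par.w, qa]; fun_prop
      have c2 : ContinuousAt (fun a => (qa ε hε a).w e') α0 := by simp only [Par.w, qa]; fun_prop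
      exact c1.eventually_lt c2 h
    have hR := filt (k := k) (l := nhdsWithin α0 (Set.Ioi α0)) (qa ε hε) h1 h1 (qa ε hε α0) (by
      rintro e e' (h | ⟨h, h'⟩)
      · filter_upwards [(hcont e e' h).filter_mono nhdsWithin_le_nhds] with a ha using Or.inl ha
      · filter_upwards [self_mem_nhdsWithin] with a ha
        left
        have ha' : α0 < a := ha
        simp only [Par.w, Par.N, qa] at h h' ⊢
        push_cast at h'
        nlinarith [mul_pos (sub_pos.2 ha') (sub_pos.2 h')]) v
    have hL := filt (k := k) (l := nhdsWithin α0 (Set.Iio α0)) (qa ε hε) h1 hm1 (qa ε hε α0) (by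
      rintro e e' (h | ⟨h, h'⟩)
      · filter_upwards [(hcont e e' h).filter_mono nhdsWithin_le_nhds] with a ha using Or.inl ha
      · filter_upwards [self_mem_nhdsWithin] with a ha
        left
        have ha' : a < α0 := ha
        simp only [Par.w, Par.N, qa] at h h' ⊢
        push_cast at h'
        nlinarith [mul_pos (sub_pos.2 ha') (sub_pos.2 h')]) v
    rw [← hc] at hL
    rw [← nhdsNE_sup_pure, ← nhdsLT_sup_nhdsGT, Filter.eventually_sup, Filter.eventually_sup]
    exact ⟨⟨hL, hR⟩, by simp⟩
  have hcst : ∀ a b, G a = G b := fun a b => hloc.apply_eq_of_preconnectedSpace a b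
  have aux : ∀ (c d : ℝ) (i i' : ℕ), i < i' → ∃ A : ℝ, ∀ a ≥ A, a * i + c < a * i' + d := by
    intro c d i i' h
    refine ⟨max 0 (c - d + 1), fun a ha => ?_⟩
    have h1 : (i : ℝ) + 1 ≤ i' := by exact_mod_cast h
    have h2 := le_trans (le_max_left _ _) ha
    have h3 := le_trans (le_max_right _ _) ha
    nlinarith [mul_nonneg h2 (sub_nonneg.2 h1)]
  have hT := filt (k := k) (l := Filter.atTop) (qa ε hε) h1 hε (qi 1 h1) (by
    intro e e' h
    simp only [Par.Less, Par.w, Par.N, qi, qa] at h ⊢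
    push_cast at h
    rcases h with h | ⟨h, h'⟩
    · obtain ⟨A, hA⟩ := aux (ε * e 1) (ε * e' 1) (e 0) (e' 0) (by
        have : (e 0 : ℝ) < e' 0 := by linarith
        exact_mod_cast this)
      filter_upwards [Filter.eventually_ge_atTop A] with a ha using Or.inl (hA a ha)
    · refine Filter.Eventually.of_forall fun a => Or.inl ?_
      have h0 : (e 0 : ℝ) = e' 0 := by linarith
      rw [h0]; linarith) v
  have hB := filt (k := k) (l := Filter.atBot) (qa ε hε) h1 hε (qi (-1) hm1) (by
    intro e e' h
    simp only [Par.Less, Par.w, Par.N, qi, qa] at h ⊢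
    push_cast at h
    rcases h with h | ⟨h, h'⟩
    · obtain ⟨A, hA⟩ := aux (-ε * e' 1) (-ε * e 1) (e' 0) (e 0) (by
        have : (e' 0 : ℝ) < e 0 := by linarith
        exact_mod_cast this)
      filter_upwards [Filter.eventually_le_atBot (-A)] with a ha
      left
      have := hA (-a) (by linarith)
      linarith
    · refine Filter.Eventually.of_forall fun a => Or.inl ?_
      have h0 : (e 0 : ℝ) = e' 0 := by linarith
      rw [h0]; linarith) v
  obtain ⟨a, ha⟩ := hT.exists
  obtain ⟨b, hb⟩ := hB.exists
  rw [← ha, ← hb]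
  exact hcst a b

end three
end Izh

namespace Izh
section four
variable {k : Type} [Field k] {K : Type} [Field K] [Algebra (M2P k) K] [IsFractionRing (M2P k) K]
variable {p : ℕ} [hp : Fact p.Prime]

/-- The special place. -/
noncomputable def qS (p : ℕ) [Fact p.Prime] : Par := (qi 1 one_ne_zero).mul p

/-- Nonspecial places. -/
def NS (q : Par) : Prop := q.β ≠ 0 ∨ q.α < 0

theorem qS_X1 : (qS p).E0 k (MvPolynomial.X 1) = HahnSeries.C (psi k p RatFunc.X) := by
  rw [Par.E0_X1, psi_X, HahnSeries.C_apply]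
  simp [qS, Par.mul, qi]

theorem qS_X0 : (qS p).E0 k (MvPolynomial.X 0) = HahnSeries.single (p : ℝ) 1 := by
  rw [Par.E0_X0]
  simp [qS, Par.mul, qi]

theorem qS_C (a : k) : (qS p).E0 k (MvPolynomial.C a) = HahnSeries.C (psi k p (RatFunc.C a)) := by
  rw [Par.E0_C, psi_C]

theorem qS_hlc {f : M2P k} {c : RatFunc k} (hc : c ≠ 0) (h : (qS p).E0 k f = HahnSeries.C (psi k p c) + HahnSeries.single (p : ℝ) 1) :
    hlc ((qS p).E k K (kk k K f)) = psi k p c := by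
  rw [Par.E_kk]
  apply hlc_rel
  · rw [mem_hrel, h, add_sub_cancel_left, mem_hpos, HahnSeries.orderTop_single one_ne_zero]
    exact_mod_cast hp.out.pos
  · simpa using hc

theorem psi_mp (z : MK k) : mp (psi k p) (mp RatFunc.C z) = mp RatFunc.C z := by
  rw [mp_mp]
  congr 2
  ext a
  exact psi_C a

theorem one_add_ne (a : k) : (1 + RatFunc.C a * RatFunc.X : RatFunc k) ≠ 0 := by
  intro h
  have h1 := hlc_pos1 (F := k) one_pos a
  have h2 := congrArg (Eg (F := k) one_ne_zero) h
  rw [map_add, map_mul, Eg_C, Eg_X, map_one, map_zero] at h2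
  rw [h2, map_zero] at h1
  exact zero_ne_one h1

theorem one_add_X_ne : (1 + RatFunc.X : RatFunc k) ≠ 0 := by
  have := one_add_ne (1 : k)
  rwa [map_one, one_mul] at this

theorem Aa_ne (a : k) : Aa a ≠ 0 := div_ne_zero (one_add_ne a) one_add_X_ne

/-- The subgroup of boundary classes. -/
def Yg (k K : Type) [Field k] [Field K] [Algebra (M2P k) K] [IsFractionRing (M2P k) K] (p : ℕ) [Fact p.Prime] :
    AddSubgroup (MK (RatFunc k)) where
  carrier := {y | ∃ u : MK K, (∀ q : Par, NS q → lcE (q.E k K) u = 0) ∧ lcE ((qS p).E k K) u = mp (psi k p) y}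
  zero_mem' := ⟨0, fun q _ => by rw [map_zero], by rw [map_zero, map_zero]⟩
  add_mem' := by
    rintro a b ⟨u, h1, h2⟩ ⟨u', h1', h2'⟩
    exact ⟨u + u', fun q hq => by rw [map_add, h1 q hq, h1' q hq, add_zero], by rw [map_add, h2, h2', map_add]⟩
  neg_mem' := by
    rintro a ⟨u, h1, h2⟩
    exact ⟨-u, fun q hq => by rw [map_neg, h1 q hq, neg_zero], by rw [map_neg, h2, map_neg]⟩

theorem zne (i : Fin 2) (j : ℕ) (h : j ≠ 0) : (0 : Fin 2 →₀ ℕ) ≠ Finsupp.single i j := by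
  intro h'
  exact h (by simpa using (DFunLike.congr_fun h' i).symm)

theorem supp_X1 {c : k} {e : Fin 2 →₀ ℕ} (he : e ∈ (MvPolynomial.C c * MvPolynomial.X 1 : M2P k).support) : e = Finsupp.single 1 1 := by
  classical
  rw [MvPolynomial.mem_support_iff, MvPolynomial.coeff_C_mul, MvPolynomial.coeff_X'] at he
  by_contra h
  rw [if_neg (Ne.symm h)] at he
  simp at he

theorem supp_C {c : k} {e : Fin 2 →₀ ℕ} (he : e ∈ (MvPolynomial.C c : M2P k).support) : e = 0 := by
  classical
  rw [MvPolynomial.mem_support_iff, MvPolynomial.coeff_C] at he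
  by_contra h
  rw [if_neg (Ne.symm h)] at he
  simp at he

theorem w_zero (q : Par) : q.w 0 = 0 := by simp [Par.w]
theorem w_t (q : Par) (j : ℕ) : q.w (Finsupp.single 1 j) = q.β * j := by simp [Par.w]
theorem w_s (q : Par) : q.w (Finsupp.single 0 1) = q.α := by simp [Par.w]

theorem Y1 {a b : k} (ha : a ≠ 0) (hb : b ≠ 0) (θ : MK k) :
    (sy (Aa a) + sy (Aa b) - sy (Aa (a * b))) * mp RatFunc.C θ ∈ Yg k K p := by
  classical
  set f : M2P k := (1 + MvPolynomial.C a * MvPolynomial.X 1) * (1 + MvPolynomial.C b * MvPolynomial.X 1) + MvPolynomial.X 0 with hf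
  set g : M2P k := (1 + MvPolynomial.C (a * b) * MvPolynomial.X 1) * (1 + MvPolynomial.X 1) + MvPolynomial.X 0 with hg
  set cf : RatFunc k := (1 + RatFunc.C a * RatFunc.X) * (1 + RatFunc.C b * RatFunc.X) with hcf
  set cg : RatFunc k := (1 + RatFunc.C (a * b) * RatFunc.X) * (1 + RatFunc.X) with hcg
  have hcf0 : cf ≠ 0 := mul_ne_zero (one_add_ne a) (one_add_ne b)
  have hcg0 : cg ≠ 0 := mul_ne_zero (one_add_ne _) one_add_X_ne
  have e1 : sy (Aa a) + sy (Aa b) - sy (Aa (a * b)) = sy (cf / cg) := by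
    rw [← sy_mul (Aa_ne a) (Aa_ne b), ← sy_div (mul_ne_zero (Aa_ne a) (Aa_ne b)) (Aa_ne _)]
    congr 1
    have n1 := one_add_ne a
    have n2 := one_add_ne b
    have n3 := one_add_ne (a * b)
    have n4 := one_add_X_ne (k := k)
    rw [Aa, Aa, Aa, hcf, hcg]
    field_simp
  have hsub : f - g = MvPolynomial.C (a + b - 1 - a * b) * MvPolynomial.X 1 := by
    rw [hf, hg]; simp only [map_add, map_sub, map_mul, map_one]; ring
  have hg' : g = MvPolynomial.C 1 + MvPolynomial.C (1 + a * b) * MvPolynomial.X 1 + MvPolynomial.C (a * b) * MvPolynomial.X 1 ^ 2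
      + MvPolynomial.X 0 := by
    rw [hg]; simp only [map_add, map_mul, map_one]; ring
  rw [e1]
  refine ⟨sy (kk k K f / kk k K g) * mp (kC k K) θ, ?_, ?_⟩
  · intro q hq
    have : hlc (q.E k K (kk k K f / kk k K g)) = 1 := by
      rcases lt_trichotomy q.β 0 with h | h | h
      · refine q.ratio (e := Finsupp.single 1 2) ?_ ?_
        · rw [MvPolynomial.mem_support_iff, hg']
          simp only [MvPolynomial.coeff_add, MvPolynomial.coeff_C_mul, MvPolynomial.coeff_C, MvPolynomial.coeff_X', MvPolynomial.coeff_X_pow]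
          simp [zne 1 2 two_ne_zero, zne 1 1 one_ne_zero, zne 0 1 one_ne_zero, Finsupp.single_eq_single_iff, ha, hb]
        · intro e' he'
          rw [hsub] at he'
          rw [supp_X1 he', w_t, w_t]; push_cast; linarith
      · have hα : q.α < 0 := hq.resolve_left (fun h' => h' h)
        refine q.ratio (e := Finsupp.single 0 1) ?_ ?_
        · rw [MvPolynomial.mem_support_iff, hg']
          simp only [MvPolynomial.coeff_add, MvPolynomial.coeff_C_mul, MvPolynomial.coeff_C, MvPolynomial.coeff_X', MvPolynomial.coeff_X_pow]
          simp [zne 1 2 two_ne_zero, zne 1 1 one_ne_zero, zne 0 1 one_ne_zero, Finsupp.single_eq_single_iff]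
        · intro e' he'
          rw [hsub] at he'
          rw [supp_X1 he', w_t, w_s, h]; simpa using hα
      · refine q.ratio (e := 0) ?_ ?_
        · rw [MvPolynomial.mem_support_iff, hg']
          simp only [MvPolynomial.coeff_add, MvPolynomial.coeff_C_mul, MvPolynomial.coeff_C, MvPolynomial.coeff_X', MvPolynomial.coeff_X_pow]
          simp [zne 1 2 two_ne_zero, zne 1 1 one_ne_zero, zne 0 1 one_ne_zero, Finsupp.single_eq_single_iff]
        · intro e' he'
          rw [hsub] at he'
          rw [supp_X1 he', w_t, w_zero]; simpa using h
    rw [map_mul, lcE_sy, this, sy_one, zero_mul]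
  · rw [map_mul, lcE_sy, Par.lc_C, map_mul, psi_mp, mp_sy, map_div₀, map_div₀, map_div₀,
      qS_hlc hcf0 ?_, qS_hlc hcg0 ?_]
    · rw [hg]; simp only [map_add, map_mul, map_one, qS_X0, qS_X1, qS_C, hcg]
    · rw [hf]; simp only [map_add, map_mul, map_one, qS_X0, qS_X1, qS_C, hcf]

theorem Y2 {c : k} (hc1 : c ≠ 1) (ξ : MK k) :
    sy (Aa c) * (sy (RatFunc.C (1 - c)) * mp RatFunc.C ξ) ∈ Yg k K p := by
  classical
  have n1 := one_add_X_ne (k := k)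
  have nX : (RatFunc.X : RatFunc k) ≠ 0 := RatFunc.X_ne_zero
  have e1 : sy (Aa c) * (sy (RatFunc.C (1 - c)) * mp RatFunc.C ξ) =
      -(sy (Aa c) * (sy (RatFunc.X / (1 + RatFunc.X) : RatFunc k) * mp RatFunc.C ξ)) := by
    have nc : (RatFunc.C (1 - c) : RatFunc k) ≠ 0 := by
      rw [Ne, map_eq_zero]; exact sub_ne_zero.2 hc1.symm
    have h := sy_st (x := Aa c) (y := RatFunc.C (1 - c) * (RatFunc.X / (1 + RatFunc.X))) (by
      rw [Aa, map_sub, map_one]; field_simp; ring)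
    rw [sy_mul nc (div_ne_zero nX n1), mul_add] at h
    rw [eq_neg_iff_add_eq_zero, ← mul_assoc, ← mul_assoc, ← add_mul, h, zero_mul]
  rw [e1]
  apply neg_mem
  set f : M2P k := 1 + MvPolynomial.C c * MvPolynomial.X 1 + MvPolynomial.X 0 with hf
  set g : M2P k := 1 + MvPolynomial.X 1 + MvPolynomial.X 0 with hg
  set t : M2P k := MvPolynomial.X 1 + MvPolynomial.X 0 with ht
  have hsub : f - g = MvPolynomial.C (c - 1) * MvPolynomial.X 1 := by
    rw [hf, hg]; simp only [map_sub, map_one]; ring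
  have hsub2 : t - g = MvPolynomial.C (-1) := by
    rw [ht, hg]; simp only [map_neg, map_one]; ring
  have hg' : g = MvPolynomial.C 1 + MvPolynomial.X 1 + MvPolynomial.X 0 := by
    rw [hg, map_one]
  refine ⟨sy (kk k K f / kk k K g) * (sy (kk k K t / kk k K g) * mp (kC k K) ξ), ?_, ?_⟩
  · intro q hq
    rcases lt_trichotomy q.β 0 with h | h | h
    · have : hlc (q.E k K (kk k K t / kk k K g)) = 1 := by
        refine q.ratio (e := Finsupp.single 1 1) ?_ ?_
        · rw [MvPolynomial.mem_support_iff, hg']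
          simp only [MvPolynomial.coeff_add, MvPolynomial.coeff_C_mul, MvPolynomial.coeff_C, MvPolynomial.coeff_X', MvPolynomial.coeff_X_pow]
          simp [zne 1 2 two_ne_zero, zne 1 1 one_ne_zero, zne 0 1 one_ne_zero, Finsupp.single_eq_single_iff]
        · intro e' he'
          rw [hsub2] at he'
          rw [supp_C he', w_t, w_zero]; simpa using h
      rw [map_mul, map_mul, lcE_sy, lcE_sy, this, sy_one, zero_mul, mul_zero]
    · have hα : q.α < 0 := hq.resolve_left (fun h' => h' h)
      have : hlc (q.E k K (kk k K t / kk k K g)) = 1 := by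
        refine q.ratio (e := Finsupp.single 0 1) ?_ ?_
        · rw [MvPolynomial.mem_support_iff, hg']
          simp only [MvPolynomial.coeff_add, MvPolynomial.coeff_C_mul, MvPolynomial.coeff_C, MvPolynomial.coeff_X', MvPolynomial.coeff_X_pow]
          simp [zne 1 2 two_ne_zero, zne 1 1 one_ne_zero, zne 0 1 one_ne_zero, Finsupp.single_eq_single_iff]
        · intro e' he'
          rw [hsub2] at he'
          rw [supp_C he', w_s, w_zero]; exact hα
      rw [map_mul, map_mul, lcE_sy, lcE_sy, this, sy_one, zero_mul, mul_zero]
    · have : hlc (q.E k K (kk k K f / kk k K g)) = 1 := by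
        refine q.ratio (e := 0) ?_ ?_
        · rw [MvPolynomial.mem_support_iff, hg']
          simp only [MvPolynomial.coeff_add, MvPolynomial.coeff_C_mul, MvPolynomial.coeff_C, MvPolynomial.coeff_X', MvPolynomial.coeff_X_pow]
          simp [zne 1 2 two_ne_zero, zne 1 1 one_ne_zero, zne 0 1 one_ne_zero, Finsupp.single_eq_single_iff]
        · intro e' he'
          rw [hsub] at he'
          rw [supp_X1 he', w_t, w_zero]; simpa using h
      rw [map_mul, lcE_sy, this, sy_one, zero_mul]
  · rw [map_mul, map_mul, lcE_sy, lcE_sy, Par.lc_C, map_mul, map_mul, psi_mp, mp_sy, mp_sy, Aa]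
    simp only [map_div₀]
    rw [qS_hlc (one_add_ne c) ?_, qS_hlc n1 ?_, qS_hlc nX ?_]
    · rw [ht]; simp only [map_add, qS_X0, qS_X1]
    · rw [hg]; simp only [map_add, map_one, qS_X0, qS_X1]
    · rw [hf]; simp only [map_add, map_mul, map_one, qS_X0, qS_X1, qS_C]

end four
end Izh

namespace Izh
section five
variable {k : Type} [Field k] {K : Type} [Field K] [Algebra (M2P k) K] [IsFractionRing (M2P k) K]
variable {p : ℕ} [hp : Fact p.Prime]

/-- Quotient by the boundary classes. -/
abbrev Bq (k K : Type) [Field k] [Field K] [Algebra (M2P k) K] [IsFractionRing (M2P k) K] (p : ℕ) [Fact p.Prime] : Type :=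
  MK (RatFunc k) ⧸ Yg k K p

open Classical in
/-- The action of a symbol. -/
noncomputable def actBf (k K : Type) [Field k] [Field K] [Algebra (M2P k) K] [IsFractionRing (M2P k) K] (p : ℕ) [Fact p.Prime]
    (a : k) : AddMonoid.End (MK k × Bq k K p) :=
  if a = 0 then 0 else
    AddMonoidHom.prod ((AddMonoidHom.mulLeft (sy a)).comp (AddMonoidHom.fst _ _))
      ((QuotientAddGroup.mk' (Yg k K p)).comp
        ((AddMonoidHom.mulLeft (sy (Aa a))).comp ((mp RatFunc.C).toAddMonoidHom.comp (AddMonoidHom.fst _ _))))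

theorem actBf_zero : actBf k K p 0 = 0 := if_pos rfl

theorem actBf_apply {a : k} (ha : a ≠ 0) (m : MK k) (b : Bq k K p) :
    actBf k K p a (m, b) = (sy a * m, QuotientAddGroup.mk' (Yg k K p) (sy (Aa a) * mp RatFunc.C m)) := by
  have h : actBf k K p a = (AddMonoidHom.prod ((AddMonoidHom.mulLeft (sy a)).comp (AddMonoidHom.fst _ _))
      ((QuotientAddGroup.mk' (Yg k K p)).comp
        ((AddMonoidHom.mulLeft (sy (Aa a))).comp ((mp RatFunc.C).toAddMonoidHom.comp (AddMonoidHom.fst _ _)))) :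
        MK k × Bq k K p →+ MK k × Bq k K p) := if_neg ha
  exact DFunLike.congr_fun h (m, b)

theorem eadd {A : Type} [AddCommGroup A] (f g : AddMonoid.End A) (x : A) : (f + g) x = f x + g x := rfl
theorem eneg {A : Type} [AddCommGroup A] (f : AddMonoid.End A) (x : A) : (-f) x = -f x := rfl
theorem esmul {A : Type} [AddCommGroup A] (n : ℕ) (f : AddMonoid.End A) (x : A) : (n • f) x = n • f x := rfl
theorem emul {A : Type} [AddCommGroup A] (f g : AddMonoid.End A) (x : A) : (f * g) x = f (g x) := rfl

/-- The action of the Milnor ring. -/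
noncomputable def actB (k K : Type) [Field k] [Field K] [Algebra (M2P k) K] [IsFractionRing (M2P k) K] (p : ℕ) [Fact p.Prime] :
    MK k →+* AddMonoid.End (MK k × Bq k K p) :=
  lift (actBf k K p) actBf_zero (by
    intro x y hx hy
    ext1 ⟨m, b⟩
    rw [eadd, actBf_apply hx, actBf_apply hy, actBf_apply (mul_ne_zero hx hy), Prod.mk_add_mk, ← add_mul,
      ← sy_mul hx hy, ← map_add]
    congr 1
    symm
    rw [← sub_eq_zero, ← map_sub]
    have := Y1 (K := K) (p := p) hx hy m
    rw [sub_mul, add_mul] at this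
    exact (QuotientAddGroup.eq_zero_iff _).2 this) (by
    intro x y hx hy h
    ext1 ⟨m, b⟩
    rw [emul, actBf_apply hy, actBf_apply hx, ← mul_assoc, sy_st h, zero_mul, map_mul (mp RatFunc.C), mp_sy]
    have hy' : y = 1 - x := by rw [← h]; ring
    have hx1 : x ≠ 1 := by rintro rfl; exact hy (by rw [hy', sub_self])
    have := Y2 (K := K) (p := p) hx1 m
    rw [← hy'] at this
    exact Prod.ext rfl ((QuotientAddGroup.eq_zero_iff _).2 this))

theorem actB_sy (a : k) : actB k K p (sy a) = actBf k K p a := lift_sy _ _ _ _ _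

theorem actB_fst (z : MK k) : ∀ v : MK k × Bq k K p, (actB k K p z v).1 = z * v.1 := by
  refine MK.induction (P := fun z => ∀ v : MK k × Bq k K p, (actB k K p z v).1 = z * v.1) ?_ ?_ ?_ ?_ z
  · intro v; rw [map_one, one_mul]; rfl
  · intro a b h1 h2 v; rw [map_add, eadd, Prod.fst_add, h1, h2, add_mul]
  · intro a h v; rw [map_neg, eneg, Prod.fst_neg, h, neg_mul]
  · intro x a h v
    rw [map_mul, emul, actB_sy]
    by_cases hx : x = 0
    · rw [hx, actBf_zero, sy_zero, zero_mul, zero_mul]; rfl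
    · rw [← Prod.mk.eta (p := actB k K p a v), actBf_apply hx, h, mul_assoc]

theorem exists_y2 {n : ℕ} {α : MK k} (hα : α ∈ dg k (n + 1)) : ∃ y ∈ dg (RatFunc k) (n + 1),
    ((∀ (γ : ℝ) (h : 0 < γ), lcE (Eg h.ne') y = 0) ∧ ∀ (γ : ℝ) (h : γ < 0), lcE (Eg h.ne) y = α) ∧
    (actB k K p α (1, 0)).2 = QuotientAddGroup.mk' (Yg k K p) y := by
  refine dg_induction (P := fun α => ∃ y ∈ dg (RatFunc k) (n + 1),
    ((∀ (γ : ℝ) (h : 0 < γ), lcE (Eg h.ne') y = 0) ∧ ∀ (γ : ℝ) (h : γ < 0), lcE (Eg h.ne) y = α) ∧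
    (actB k K p α (1, 0)).2 = QuotientAddGroup.mk' (Yg k K p) y) ?_ ?_ ?_ ?_ hα
  · exact ⟨0, zero_mem _, ⟨by simp, by simp⟩, by rw [map_zero, map_zero]; rfl⟩
  · rintro a b ⟨y, hy, ⟨h1, h2⟩, h3⟩ ⟨y', hy', ⟨h1', h2'⟩, h3'⟩
    exact ⟨y + y', add_mem hy hy', ⟨by intro γ h; rw [map_add, h1 γ h, h1' γ h, add_zero],
      by intro γ h; rw [map_add, h2 γ h, h2' γ h]⟩, by rw [map_add, eadd, Prod.snd_add, h3, h3', map_add]⟩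
  · rintro a ⟨y, hy, ⟨h1, h2⟩, h3⟩
    exact ⟨-y, neg_mem hy, ⟨by intro γ h; rw [map_neg, h1 γ h, neg_zero], by intro γ h; rw [map_neg, h2 γ h]⟩,
      by rw [map_neg, eneg, Prod.snd_neg, h3, map_neg]⟩
  · intro x a ha
    by_cases hx : x = 0
    · exact ⟨0, zero_mem _, ⟨by simp, by simp [hx, sy_zero]⟩, by rw [hx, sy_zero, zero_mul, map_zero, map_zero]; rfl⟩
    refine ⟨sy (Aa x) * mp RatFunc.C a, sy_mul_mem _ ((mp_homog _).mem ha), ⟨?_, ?_⟩, ?_⟩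
    · intro γ h
      rw [map_mul, lcE_sy, hlc_Aa_pos h, sy_one, zero_mul]
    · intro γ h
      rw [map_mul, lcE_sy, hlc_Aa_neg h hx, lcEg_C]
    · rw [map_mul, emul, actB_sy, ← Prod.mk.eta (p := actB k K p a (1, 0)), actBf_apply hx, actB_fst, mul_one]

/-- The element `y` and the global class `u`. -/
theorem exists_yu {n : ℕ} {x : MK k} (hx : x ∈ dg k (n + 1)) (h : p • x = 0) : ∃ y ∈ dg (RatFunc k) (n + 1),
    ((∀ (γ : ℝ) (h : 0 < γ), lcE (Eg h.ne') y = 0) ∧ ∀ (γ : ℝ) (h : γ < 0), lcE (Eg h.ne) y = x) ∧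
    ∃ u ∈ dg K (n + 1), (∀ q : Par, NS q → lcE (q.E k K) u = 0) ∧ lcE ((qS p).E k K) u = p • mp (psi k p) y := by
  obtain ⟨y, hy, h1, h2⟩ := exists_y2 (K := K) (p := p) hx
  refine ⟨y, hy, h1, ?_⟩
  have hm : p • y ∈ Yg k K p := by
    rw [← QuotientAddGroup.eq_zero_iff]
    change QuotientAddGroup.mk' (Yg k K p) (p • y) = 0
    rw [map_nsmul, ← h2, ← Prod.smul_snd, ← esmul, ← map_nsmul, h, map_zero]
    rfl
  obtain ⟨u, hu1, hu2⟩ := hm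
  refine ⟨pr (n + 1) u, pr_mem _ _, ?_, ?_⟩
  · intro q hq
    rw [← (lcE_homog _).pr, hu1 q hq]
    exact pr_of_mem (zero_mem _)
  · rw [← (lcE_homog _).pr, hu2, map_nsmul]
    exact pr_of_mem (nsmul_mem ((mp_homog _).mem hy) _)

end five
end Izh

namespace Izh
section six

theorem fm_p {K : Type} [Field K] {p : ℕ} [CharP K p] {ι : Type} (D : ι → Der K) (z : MK K) : fm D (p • z) = 0 := by
  rw [fm_nsmul]
  funext L
  change p • fm D z L = 0
  rw [nsmul_eq_mul, CharP.cast_eq_zero, zero_mul]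

theorem der_pow0 {F : Type} [Field F] {d : Der F} {x : F} (h : d x = 0) (n : ℕ) : d (x ^ n) = 0 := by
  rw [Derivation.leibniz_pow, h, smul_zero, smul_zero]

variable {p : ℕ} [hp : Fact p.Prime]

/-- Absence of torsion in degree `n`. -/
def An (p n : ℕ) : Prop := ∀ (F : Type) [Field F] [CharP F p], FG p F → ∀ z ∈ dg F n, p • z = 0 → z = 0

theorem rigid {n : ℕ} (hA : An p n) {k : Type} [Field k] [CharP k p] (hk : FG p k) {z : MK (RatFunc k)}
    (hz : z ∈ dg (RatFunc k) (n + 1)) (h : p • z = 0) : ∃ c, z = mp RatFunc.C c := by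
  apply M1
  intro π
  haveI : CharP π.κ p := charP_of_injective_ringHom (AdjoinRoot.of π.1).injective p
  refine hA π.κ (adjFG hk π) _ (π.d.r_mem hz) ?_
  rw [← map_nsmul, h, map_zero]

theorem A_succ {n : ℕ} (hA : An p n) {k K : Type} [Field k] [Field K] [Algebra (M2P k) K] [IsFractionRing (M2P k) K]
    [CharP k p] [CharP K p] (hk : FG p k) {x : MK k} (hx : x ∈ dg k (n + 1)) (h : p • x = 0) : x = 0 := by
  haveI : CharP (RatFunc k) p := charP_of_injective_ringHom (RatFunc.C : k →+* RatFunc k).injective p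
  obtain ⟨m, 𝒟, hb⟩ := exists_PD hk
  obtain ⟨𝒟z, hxz⟩ := (ratEx (F := k)).pd 𝒟
  obtain ⟨𝒟', hx'⟩ := (mvEx (k := k) (K := K)).pd 𝒟
  have hpl : ∀ (q : Par) i x, q.E k K (𝒟'.D i x) = hd (𝒟z.D i) (q.E k K x) := by
    intro q
    have hX : ∀ i, 𝒟z.D i RatFunc.X = 0 := fun i => hxz.DT i _ rfl
    refine ExPD.place mvEx hx' RatFunc.C 𝒟z.D hxz.DC (q.E k K) q.E_C ?_
    rintro i t ⟨j, rfl⟩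
    fin_cases j
    · change hd (𝒟z.D i) (q.E k K (kk k K (MvPolynomial.X 0))) = 0
      rw [Par.E_X0, hd_single, der_pow0 (hX i), HahnSeries.single_eq_zero]
    · change hd (𝒟z.D i) (q.E k K (kk k K (MvPolynomial.X 1))) = 0
      rw [Par.E_X1, hd_single, der_pow0 (hX i), HahnSeries.single_eq_zero]
  obtain ⟨y, hy, ⟨hy0, hyi⟩, u, hu, hu1, hu2⟩ := exists_yu (K := K) hx h
  obtain ⟨w, hw, hfw, N, hN, hlw⟩ := lemS 𝒟' (fun R => ∃ q : Par, (NS q ∨ q = qS p) ∧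
      R = ⟨RatFunc k, 𝒟z.D, q.E k K, hpl q⟩) hu (by
    rintro P ⟨q, hq | rfl, rfl⟩
    · change fm 𝒟z.D (lcE (q.E k K) u) = 0
      rw [hu1 q hq, fm_zero]
    · change fm 𝒟z.D (lcE ((qS p).E k K) u) = 0
      rw [hu2, fm_p])
  have hwq : ∀ q : Par, (NS q ∨ q = qS p) → N • lcE (q.E k K) w = 0 := fun q hq => hlw _ ⟨q, hq, rfl⟩
  have hI : InI (mp (psK k K p) (u - w)) := ExPD.InI mvEx hx' hb (psK k K p) psK_C
    (by rintro t ⟨i, rfl⟩; exact psK_X i) (by rw [fm_sub, hfw, sub_self])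
  obtain ⟨v, hv, huv⟩ := BKG (n + 1) K (mvFG (k := k) hk) _ ((mp_homog _).mem (sub_mem hu hw)) hI
  have hvq : ∀ q : Par, lcE ((q.mul p).E k K) (u - w) = p • lcE (q.E k K) v := by
    intro q
    rw [← Par.E_psK, ← lcE_mp, huv, map_nsmul]
  have hlm : ∀ q : Par, N • lcE (q.E k K) v ∈ dg (RatFunc k) (n + 1) :=
    fun q => nsmul_mem ((lcE_homog _).mem hv) _
  have hNS : ∀ q : Par, NS q → ∃ c, N • lcE (q.E k K) v = mp RatFunc.C c := by
    intro q hq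
    refine rigid hA hk (hlm q) ?_
    have hq' : NS (q.mul p) := by
      have hp0 : (0 : ℝ) < p := by exact_mod_cast hp.out.pos
      rcases hq with hq | hq
      · exact Or.inl (mul_ne_zero hp0.ne' hq)
      · exact Or.inr (mul_neg_of_pos_of_neg hp0 hq)
    rw [smul_comm, ← hvq, map_sub, hu1 _ hq', zero_sub, smul_neg, hwq _ (Or.inl hq'), neg_zero]
  obtain ⟨c1, hc1⟩ : ∃ c, N • lcE ((qi 1 one_ne_zero).E k K) v - N • mp (psi k p) y = mp RatFunc.C c := by
    refine rigid hA hk (sub_mem (hlm _) (nsmul_mem ((mp_homog _).mem hy) _)) ?_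
    have e := hvq (qi 1 one_ne_zero)
    change lcE ((qS p).E k K) (u - w) = _ at e
    rw [smul_sub, smul_comm, ← e, map_sub, hu2, smul_sub, hwq _ (Or.inr rfl), sub_zero, smul_comm, sub_self]
  have hm1 : (-1 : ℝ) ≠ 0 := by norm_num
  have h1 : (1 : ℝ) ≠ 0 := one_ne_zero
  obtain ⟨c2, hc2⟩ := hNS (qi (-1) hm1) (Or.inr (by norm_num [qi]))
  have key : ∀ (ε : ℝ) (hε : ε ≠ 0), c1 + N • lcE (Eg hε) (mp (psi k p) y) = c2 := by
    intro ε hε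
    have e := lc_const (k := k) (K := K) hε (h1 := h1) (hm1 := hm1) (N • v) (by
      intro α
      obtain ⟨c, hc⟩ := hNS (qa ε hε α) (Or.inl hε)
      rw [map_nsmul (lcE ((qa ε hε α).E k K)), hc, lcEg_C, lcEg_C])
    rw [map_nsmul (lcE ((qi 1 h1).E k K)), map_nsmul (lcE ((qi (-1) hm1).E k K)), hc2, lcEg_C, sub_eq_iff_eq_add.1 hc1, map_add,
      lcEg_C, map_nsmul] at e
    exact e
  have hp0 : (0 : ℝ) < p := by exact_mod_cast hp.out.pos
  have hm0 : (-p : ℝ) < 0 := neg_lt_zero.2 hp0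
  have k1 := key 1 h1
  have k2 := key (-1) hm1
  rw [lcE_mp, Eg_psi h1 hp0.ne' (by ring), hy0 _ hp0, smul_zero, add_zero] at k1
  rw [lcE_mp, Eg_psi hm1 hm0.ne (by ring), hyi _ hm0, k1, add_eq_left] at k2
  have hd1 : addOrderOf x ∣ 1 := by
    rw [← hN]
    exact Nat.dvd_gcd (addOrderOf_dvd_of_nsmul_eq_zero k2) (addOrderOf_dvd_of_nsmul_eq_zero h)
  exact AddMonoid.addOrderOf_eq_one_iff.1 (Nat.dvd_one.1 hd1)

theorem An_all (n : ℕ) : An p n := by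
  induction n with
  | zero =>
    intro F _ _ _ z hz h
    exact dg_zero_torsion hz (p : ℤ) (by exact_mod_cast hp.out.ne_zero) (by rw [← h]; simp)
  | succ n ih =>
    intro k _ _ hk x hx h
    haveI : CharP (FractionRing (M2P k)) p := charP_of_injective_ringHom (kC k (FractionRing (M2P k))).injective p
    exact A_succ (K := FractionRing (M2P k)) ih hk hx h

end six
end Izh

namespace Izh

theorem fgs_FG {F : Type} [Field F] (p : ℕ) (S : Finset F) : FG p (fgs F S) := by
  classical
  refine ⟨S.attach.image fun x => ⟨x.1, Subfield.subset_closure x.2⟩, ?_⟩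
  rw [eq_top_iff]
  set M := Subfield.closure (Set.range (fun x : fgs F S => x ^ p) ∪
    ((S.attach.image fun x => (⟨x.1, Subfield.subset_closure x.2⟩ : fgs F S) : Finset (fgs F S)) : Set (fgs F S))) with hM
  have h : fgs F S ≤ M.map (fgs F S).subtype := by
    rw [Subfield.closure_le]
    intro x hx
    refine ⟨⟨x, Subfield.subset_closure hx⟩, Subfield.subset_closure (Or.inr ?_), rfl⟩
    simp only [Finset.coe_image, Set.mem_image]
    exact ⟨⟨x, hx⟩, by simp, rfl⟩
  rintro x -
  obtain ⟨y, hy, hyx⟩ := h x.2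
  have : y = x := Subtype.ext hyx
  exact this ▸ hy

theorem final {F : Type} [Field F] (p : ℕ) [CharP F p] (hp : p ≠ 0) (n : ℕ) {z : MK F} (hz : z ∈ dg F n) (h : p • z = 0) :
    z = 0 := by
  haveI : Fact p.Prime := ⟨(CharP.char_is_prime_or_zero F p).resolve_right hp⟩
  refine torsion_colim p ?_ hz h
  intro S n z hz h
  haveI : CharP (fgs F S) p := (fgs F S).subtype.charP (fgs F S).subtype.injective p
  exact An_all n (fgs F S) (fgs_FG p S) z hz h

end Izh

/-- Izhboldin's theorem: for a field `F` of characteristic `p > 0`, the Milnor K-group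
`K^M_n(F)` has no `p`-torsion. -/
theorem stmt18 (F : Type) [Field F] (p : ℕ) [CharP F p] (hp : p ≠ 0) (n : ℕ)
    (x : MilnorK F n) (hx : p • x = 0) : x = 0 := by
  apply Izh.link_inj
  refine Izh.final p hp n (Izh.link_mem x) ?_
  rw [← map_nsmul, hx, map_zero]
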